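/- Let H = 1/6, let (Ω,F,P) be a probability space, and let X¹, X² : ℝ → Ω → ℝ be two independent centered Gaussian processes, each with covariance C_{1/6} and with continuous sample paths. Let f ∈ C_b^∞(ℝ²) and fix t ≥ 0. Set σ_f(ω)² = κ₁² ∫₀ᵗ (∂₁₁₁f(X¹_s,X²_s))² ds + κ₂² ∫₀ᵗ (∂₂₂₂f(X¹_s,X²_s))² ds + κ₃² ∫₀ᵗ (∂₁₂₂f(X¹_s,X²_s))² ds + κ₄² ∫₀ᵗ (∂₁₁₂f(X¹_s,X²_s))² ds. Then for every m ≥ 1, every ψ ∈ C_b^∞(ℝ^{2m}), all times s₁,…,s_m ∈ ℝ and every λ ∈ ℝ: lim_{n→∞} E[ ψ(X¹_{s₁},X²_{s₁},…,X¹_{s_m},X²_{s_m}) · exp(iλ V³_n(f,t)) ] = E[ ψ(X¹_{s₁},X²_{s₁},…,X¹_{s_m},X²_{s_m}) · exp(−(λ²/2) σ_f²) ]. (This expresses the stable convergence in law of V³_n(f,t) to the conditionally Gaussian random variable ∫₀ᵗ D³f(X_s) d³X_s, an Itô integral against a 4-dimensional Brownian motion independent of (X¹,X²).) -/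

import Mathlib

open MeasureTheory ProbabilityTheory Filter

noncomputable section

/-- Covariance function of the (two-sided) fractional Brownian motion with Hurst index `H`:
`C_H(t,s) = (|t|^{2H} + |s|^{2H} − |t−s|^{2H})/2`. -/
def covH (H t s : ℝ) : ℝ :=
  (|t| ^ (2 * H) + |s| ^ (2 * H) - |t - s| ^ (2 * H)) / 2

/-- `ρ_H(k) = (1/2)(|k+1|^{2H} + |k−1|^{2H} − 2|k|^{2H})`. -/
def rhoH (H : ℝ) (k : ℤ) : ℝ :=
  (|(k : ℝ) + 1| ^ (2 * H) + |(k : ℝ) - 1| ^ (2 * H) - 2 * |(k : ℝ)| ^ (2 * H)) / 2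

/-- `X` is a centered Gaussian process with covariance function `C` under `P`: every finite
linear combination of values of the process is a centered real Gaussian random variable with
the appropriate variance. -/
def IsCenteredGaussianProcess {Ω : Type*} [MeasurableSpace Ω] (P : Measure Ω)
    (X : ℝ → Ω → ℝ) (C : ℝ → ℝ → ℝ) : Prop :=
  (∀ t, Measurable (X t)) ∧
  ∀ (m : ℕ) (ts : Fin m → ℝ) (c : Fin m → ℝ),
    Measure.map (fun ω => ∑ i, c i * X (ts i) ω) P =
      gaussianReal 0 (Real.toNNReal (∑ i, ∑ j, c i * c j * C (ts i) (ts j)))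

/-- The σ-algebras generated by the two processes `X1` and `X2` are independent under `P`. -/
def IndepProcesses {Ω : Type*} [MeasurableSpace Ω] (P : Measure Ω)
    (X1 X2 : ℝ → Ω → ℝ) : Prop :=
  ProbabilityTheory.Indep
    (⨆ t : ℝ, MeasurableSpace.comap (X1 t) inferInstance)
    (⨆ t : ℝ, MeasurableSpace.comap (X2 t) inferInstance) P

/-- `g` is infinitely differentiable and bounded together with all its derivatives. -/
def CbSmooth {E : Type*} [NormedAddCommGroup E] [NormedSpace ℝ E] (g : E → ℝ) : Prop :=
  (∀ n : ℕ, ContDiff ℝ n g) ∧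
  ∀ k : ℕ, ∃ M : ℝ, ∀ x : E, ‖iteratedFDeriv ℝ k g x‖ ≤ M

/-- `f : ℝ² → ℝ` (in curried form) belongs to `C_b^∞(ℝ²)`. -/
def CbSmooth2 (f : ℝ → ℝ → ℝ) : Prop :=
  CbSmooth fun p : ℝ × ℝ => f p.1 p.2

/-- Partial derivative of `f : ℝ → ℝ → ℝ`, taken `k` times in the first variable and `l` times
in the second variable. -/
def pd (k l : ℕ) (f : ℝ → ℝ → ℝ) (x y : ℝ) : ℝ :=
  iteratedDeriv k (fun u => iteratedDeriv l (fun v => f u v) y) x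

/-- The dyadic point `j·2^{−n/2}`. -/
def dyadicPt (n j : ℕ) : ℝ := (j : ℝ) * (2 : ℝ) ^ (-(n : ℝ) / 2)

/-- The number of dyadic steps `⌊2^{n/2} t⌋`. -/
def nSteps (n : ℕ) (t : ℝ) : ℕ := Nat.floor ((2 : ℝ) ^ ((n : ℝ) / 2) * t)

variable {Ω : Type*}

/-- The increment `X_{(j+1)2^{−n/2}} − X_{j2^{−n/2}}` of the process `X`. -/
def Xincr (X : ℝ → Ω → ℝ) (n j : ℕ) (ω : Ω) : ℝ :=
  X (dyadicPt n (j + 1)) ω - X (dyadicPt n j) ω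

/-- The midpoint evaluation `Δ_{j,n} g(X¹,X²)`. -/
def Xmid (X1 X2 : ℝ → Ω → ℝ) (g : ℝ → ℝ → ℝ) (n j : ℕ) (ω : Ω) : ℝ :=
  g ((X1 (dyadicPt n (j + 1)) ω + X1 (dyadicPt n j) ω) / 2)
    ((X2 (dyadicPt n (j + 1)) ω + X2 (dyadicPt n j) ω) / 2)

set_option linter.unusedSectionVars false

section Admissible

variable {E A : Type*} [NormedAddCommGroup E] [NormedSpace ℝ E]
  [NormedAddCommGroup A] [NormedSpace ℝ A]

/-- Continuous functions of at most polynomial growth. -/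
structure Adm (F : E → A) : Prop where
  cont : Continuous F
  growth : ∃ (C : ℝ) (k : ℕ), 0 ≤ C ∧ ∀ x, ‖F x‖ ≤ C * (1 + ‖x‖) ^ k

lemma Adm.of_bound {F : E → A} (hF : Continuous F) (C : ℝ) (h : ∀ x, ‖F x‖ ≤ C) : Adm F := by
  refine ⟨hF, |C|, 0, abs_nonneg _, fun x => ?_⟩
  simpa using (h x).trans (le_abs_self C)

lemma Adm.const (a : A) : Adm (fun _ : E => a) :=
  Adm.of_bound continuous_const ‖a‖ fun _ => le_rfl

lemma Adm.clm (L : E →L[ℝ] A) : Adm (fun x => L x) := by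
  refine ⟨L.continuous, ‖L‖, 1, norm_nonneg _, fun x => (L.le_opNorm x).trans ?_⟩
  have := norm_nonneg L
  have := norm_nonneg x
  nlinarith

lemma Adm.add {F G : E → A} (hF : Adm F) (hG : Adm G) : Adm (fun x => F x + G x) := by
  obtain ⟨C, k, hC, h⟩ := hF.growth
  obtain ⟨D, l, hD, h'⟩ := hG.growth
  refine ⟨hF.cont.add hG.cont, C + D, max k l, by positivity, fun x => ?_⟩
  have h1 : (1 : ℝ) ≤ 1 + ‖x‖ := by linarith [norm_nonneg x]
  have a1 := pow_le_pow_right₀ h1 (le_max_left k l)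
  have a2 := pow_le_pow_right₀ h1 (le_max_right k l)
  calc ‖F x + G x‖ ≤ ‖F x‖ + ‖G x‖ := norm_add_le _ _
    _ ≤ C * (1 + ‖x‖) ^ k + D * (1 + ‖x‖) ^ l := add_le_add (h x) (h' x)
    _ ≤ C * (1 + ‖x‖) ^ (max k l) + D * (1 + ‖x‖) ^ (max k l) := by gcongr
    _ = _ := by ring

lemma Adm.mono {B : Type*} [NormedAddCommGroup B] {F : E → A} {G : E → B} (hF : Continuous F)
    (hG : Adm G) (h : ∀ x, ‖F x‖ ≤ ‖G x‖) : Adm F := by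
  obtain ⟨C, k, hC, hk⟩ := hG.growth
  exact ⟨hF, C, k, hC, fun x => (h x).trans (hk x)⟩

lemma Adm.sum {ι : Type*} {s : Finset ι} {F : ι → E → A} (h : ∀ i ∈ s, Adm (F i)) :
    Adm (fun x => ∑ i ∈ s, F i x) := by
  classical
  induction s using Finset.induction_on with
  | empty => simpa using Adm.const (0 : A)
  | insert a s ha ih =>
    simp only [Finset.sum_insert ha]
    exact (h a (Finset.mem_insert_self _ _)).add
      (ih fun i hi => h i (Finset.mem_insert_of_mem hi))

lemma Adm.mul_aux {B : Type*} [NormedAddCommGroup B] [NormedSpace ℝ B] {F : E → A} {G : E → B}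
    {D : Type*} [NormedAddCommGroup D] {K : E → D}
    (hF : Adm F) (hG : Adm G) (hK : Continuous K) (h : ∀ x, ‖K x‖ ≤ ‖F x‖ * ‖G x‖) : Adm K := by
  obtain ⟨C, k, hC, hk⟩ := hF.growth
  obtain ⟨D, l, hD, hl⟩ := hG.growth
  refine ⟨hK, C * D, k + l, by positivity, fun x => (h x).trans ?_⟩
  have : 0 ≤ 1 + ‖x‖ := by positivity
  calc ‖F x‖ * ‖G x‖ ≤ (C * (1 + ‖x‖) ^ k) * (D * (1 + ‖x‖) ^ l) :=
        mul_le_mul (hk x) (hl x) (norm_nonneg _) (by positivity)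
    _ = _ := by ring

lemma Adm.smul {F : E → A} {c : E → ℝ} (hc : Adm c) (hF : Adm F) : Adm (fun x => c x • F x) :=
  Adm.mul_aux hc hF (hc.cont.smul hF.cont) fun _ => (norm_smul _ _).le

lemma Adm.neg {F : E → A} (hF : Adm F) : Adm (fun x => - F x) :=
  Adm.mono hF.cont.neg hF fun x => by simp

lemma Adm.sub {F G : E → A} (hF : Adm F) (hG : Adm G) : Adm (fun x => F x - G x) := by
  simpa only [sub_eq_add_neg] using hF.add hG.neg

lemma Adm.norm {F : E → A} (hF : Adm F) : Adm (fun x => ‖F x‖) :=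
  Adm.mono hF.cont.norm hF fun x => by simp

lemma Adm.comp_clm {E' : Type*} [NormedAddCommGroup E'] [NormedSpace ℝ E'] {F : E' → A}
    (hF : Adm F) (L : E →L[ℝ] E') : Adm (fun x => F (L x)) := by
  obtain ⟨C, k, hC, hk⟩ := hF.growth
  refine ⟨hF.cont.comp L.continuous, C * (1 + ‖L‖) ^ k, k, by positivity, fun x => ?_⟩
  calc ‖F (L x)‖ ≤ C * (1 + ‖L x‖) ^ k := hk _
    _ ≤ C * ((1 + ‖L‖) * (1 + ‖x‖)) ^ k := by
        have h1 := L.le_opNorm x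
        have h2 := norm_nonneg L
        have h3 := norm_nonneg x
        gcongr
        nlinarith
    _ = _ := by rw [mul_pow]; ring

section Algebra

variable {A : Type*} [NormedCommRing A] [NormedAlgebra ℝ A]

lemma Adm.mul {F G : E → A} (hF : Adm F) (hG : Adm G) : Adm (fun x => F x * G x) :=
  Adm.mul_aux hF hG (hF.cont.mul hG.cont) fun _ => norm_mul_le _ _

lemma Adm.pow {F : E → A} (hF : Adm F) (k : ℕ) : Adm (fun x => F x ^ k) := by
  induction k with
  | zero => simpa using Adm.const (1 : A)
  | succ k ih => simpa only [pow_succ] using ih.mul hF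

end Algebra

lemma Adm.ofReal {F : E → ℝ} (hF : Adm F) : Adm (fun x => (F x : ℂ)) :=
  Adm.mono (Complex.continuous_ofReal.comp hF.cont) hF fun x => by simp

variable [MeasurableSpace E] [BorelSpace E] [SecondCountableTopology E] [CompleteSpace E]

lemma Adm.integrable {F : E → A} (hF : Adm F) (μ : Measure E) [IsGaussian μ] :
    Integrable F μ := by
  obtain ⟨C, k, hC, hk⟩ := hF.growth
  have h0 : MemLp (fun x : E => ‖x‖) (k : ENNReal) μ :=
    (IsGaussian.memLp_id μ (k : ENNReal) (ENNReal.natCast_ne_top k)).norm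
  have hc : MemLp (fun _ : E => (1 : ℝ)) (k : ENNReal) μ := memLp_const 1
  have h1 : MemLp (fun x : E => (1 : ℝ) + ‖x‖) (k : ENNReal) μ := hc.add h0
  have h3 : Integrable (fun x : E => ‖(1 : ℝ) + ‖x‖‖ ^ k) μ := h1.integrable_norm_pow'
  have h4 : ∀ x : E, ‖(1 : ℝ) + ‖x‖‖ = 1 + ‖x‖ := fun x => by
    rw [Real.norm_eq_abs, abs_of_nonneg (by positivity)]
  simp only [h4] at h3
  have h2 : Integrable (fun x : E => C * (1 + ‖x‖) ^ k) μ := h3.const_mul C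
  exact h2.mono' hF.cont.aestronglyMeasurable (ae_of_all _ hk)

end Admissible

section Stein

variable {E A : Type*} [NormedAddCommGroup E] [NormedSpace ℝ E]
  [NormedAddCommGroup A] [NormedSpace ℝ A]

lemma hasDerivAt_gaussianPDFReal (V : NNReal) (hV : V ≠ 0) (z : ℝ) :
    HasDerivAt (gaussianPDFReal 0 V) (-(z / V) * gaussianPDFReal 0 V z) z := by
  have hV' : (V : ℝ) ≠ 0 := by exact_mod_cast hV
  have h : HasDerivAt (fun z : ℝ => -(z - 0) ^ 2 / (2 * V)) (-(z / V)) z := by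
    have := (((hasDerivAt_id z).sub_const 0).pow 2).neg.div_const (2 * (V : ℝ))
    refine this.congr_deriv ?_
    simp
    field_simp
  have h2 := (h.exp).const_mul (√(2 * Real.pi * V))⁻¹
  rw [gaussianPDFReal_def]
  refine h2.congr_deriv ?_
  ring

lemma integrable_gaussianReal_iff_smul {V : NNReal} (hV : V ≠ 0) {G : ℝ → A} :
    Integrable G (gaussianReal 0 V) ↔ Integrable (fun z => gaussianPDFReal 0 V z • G z) := by
  rw [gaussianReal_of_var_ne_zero _ hV,
    integrable_withDensity_iff_integrable_smul₀' (measurable_gaussianPDF 0 V).aemeasurable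
      (ae_of_all _ fun _ ↦ gaussianPDF_lt_top)]
  simp [toReal_gaussianPDF]

/-- Gaussian integration by parts on the line. -/
lemma stein_real {V : NNReal} (hV : V ≠ 0) {G G' : ℝ → A} (hG : Adm G) (hG' : Adm G')
    (h : ∀ z, HasDerivAt G (G' z) z) :
    ∫ z, z • G z ∂(gaussianReal 0 V) = (V : ℝ) • ∫ z, G' z ∂(gaussianReal 0 V) := by
  have hV' : (V : ℝ) ≠ 0 := by exact_mod_cast hV
  have hzG : Adm (fun z : ℝ => z • G z) := (Adm.clm (ContinuousLinearMap.id ℝ ℝ)).smul hG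
  have i0 := (integrable_gaussianReal_iff_smul hV).1 (hG.integrable (gaussianReal 0 V))
  have i1 := (integrable_gaussianReal_iff_smul hV).1 (hG'.integrable (gaussianReal 0 V))
  have i2 := (integrable_gaussianReal_iff_smul hV).1 (hzG.integrable (gaussianReal 0 V))
  have key : ∫ z, (gaussianPDFReal 0 V z • G' z - (V : ℝ)⁻¹ • (gaussianPDFReal 0 V z • z • G z))
      = 0 := by
    refine integral_eq_zero_of_hasDerivAt_of_integrable
      (f := fun z => gaussianPDFReal 0 V z • G z) (fun z => ?_) (i1.sub (i2.smul _)) i0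
    refine ((hasDerivAt_gaussianPDFReal V hV z).smul (h z)).congr_deriv ?_
    simp only [smul_smul, sub_eq_add_neg, ← neg_smul]
    congr 2
    field_simp
  have i3 : Integrable (fun z => (V : ℝ)⁻¹ • (gaussianPDFReal 0 V z • z • G z)) := i2.smul _
  rw [integral_sub i1 i3, integral_smul, sub_eq_zero] at key
  rw [integral_gaussianReal_eq_integral_smul hV, integral_gaussianReal_eq_integral_smul hV, key,
    smul_smul, mul_inv_cancel₀ hV', one_smul]

variable [MeasurableSpace E] [BorelSpace E] [SecondCountableTopology E] [CompleteSpace E]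

/-- `v` is the Cameron-Martin vector of the linear functional `L` under the centered Gaussian
measure `μ`. -/
structure IsCMVector (μ : Measure E) (L : StrongDual ℝ E) (v : E) : Prop where
  cov : ∀ L' : StrongDual ℝ E, ∫ x, L x * L' x ∂μ = L' v

/-- Gaussian integration by parts for a centered Gaussian measure. -/
lemma stein (μ : Measure E) [IsGaussian μ] (hμ : ∀ L : StrongDual ℝ E, ∫ x, L x ∂μ = 0)
    {L : StrongDual ℝ E} {v : E} (hv : IsCMVector μ L v) (hV : 0 < L v)
    {F F' : E → A} (hF : Adm F) (hF' : Adm F')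
    (h : ∀ x, HasDerivAt (fun s : ℝ => F (x + s • v)) (F' x) 0) :
    ∫ x, L x • F x ∂μ = ∫ x, F' x ∂μ := by
  set V : NNReal := (L v).toNNReal with hVdef
  have hVv : (V : ℝ) = L v := Real.coe_toNNReal _ hV.le
  have hV0 : V ≠ 0 := by
    intro h0
    rw [h0] at hVv
    simp at hVv
    linarith
  set Y : E →L[ℝ] E := ContinuousLinearMap.id ℝ E - ((L v)⁻¹ • L).smulRight v with hY
  have hYx : ∀ x, Y x = x - ((L v)⁻¹ * L x) • v := fun x => by simp [hY]
  have hLlaw : μ.map L = gaussianReal 0 V := by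
    rw [IsGaussian.map_eq_gaussianReal, hμ L]
    congr 1
    rw [hVdef, variance_eq_sub (IsGaussian.memLp_dual μ L 2 (by simp)), hμ L, ← hv.cov L]
    simp [pow_two]
  have hind : IndepFun (fun x => L x) (fun x => Y x) μ := by
    refine HasGaussianLaw.indepFun_of_covariance_strongDual ?_ ?_
    · exact (IsGaussian.hasGaussianLaw_id (μ := μ)).map_fun (L.prod Y)
    · intro L₁ L₂
      have e1 : (L₁ ∘ fun x => L x) = fun x => (L₁.comp L) x := rfl
      have e2 : (L₂ ∘ fun x => Y x) = fun x => (L₂.comp Y) x := rfl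
      rw [e1, e2, covariance_eq_sub (IsGaussian.memLp_dual μ _ 2 (by simp))
        (IsGaussian.memLp_dual μ _ 2 (by simp)), hμ, zero_mul, sub_zero]
      have e3 : ∀ x, ((fun x => (L₁.comp L) x) * fun x => (L₂.comp Y) x) x
          = L₁ 1 * (L x * (L₂.comp Y) x) := by
        intro x
        have : L₁ (L x) = L x * L₁ 1 := by
          rw [← smul_eq_mul, ← map_smul, smul_eq_mul, mul_one]
        simp [this]
        ring
      simp_rw [e3]
      rw [integral_const_mul, hv.cov]
      simp [hYx, hV.ne']
  have hprod : μ.map (fun x => (L x, Y x)) = (gaussianReal 0 V).prod (μ.map Y) := by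
    rw [← hLlaw]
    exact (indepFun_iff_map_prod_eq_prod_map_map L.continuous.measurable.aemeasurable
      Y.continuous.measurable.aemeasurable).1 hind
  set T : ℝ × E →L[ℝ] E := ContinuousLinearMap.snd ℝ ℝ E +
    ((L v)⁻¹ • ContinuousLinearMap.fst ℝ ℝ E).smulRight v with hT
  have hTz : ∀ z y, T (z, y) = y + ((L v)⁻¹ * z) • v := fun z y => by simp [hT]
  have hTx : ∀ x, T (L x, Y x) = x := fun x => by simp [hTz, hYx]
  have hm : Measurable (fun x => (L x, Y x)) :=
    L.continuous.measurable.prodMk Y.continuous.measurable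
  have : IsGaussian ((gaussianReal 0 V).prod (μ.map Y)) := inferInstance
  have htrans : ∀ {G : ℝ × E → A}, Adm G → ∫ x, G (L x, Y x) ∂μ
      = ∫ y, ∫ z, G (z, y) ∂(gaussianReal 0 V) ∂(μ.map Y) := by
    intro G hG
    rw [← integral_prod_symm _ (hG.integrable _), ← hprod,
      integral_map hm.aemeasurable hG.cont.aestronglyMeasurable]
  have a1 : Adm (fun p : ℝ × E => p.1 • F (T p)) :=
    (Adm.clm (ContinuousLinearMap.fst ℝ ℝ E)).smul (hF.comp_clm T)
  have a2 : Adm (fun p : ℝ × E => F' (T p)) := hF'.comp_clm T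
  have l1 : ∫ x, L x • F x ∂μ = ∫ x, (fun p : ℝ × E => p.1 • F (T p)) (L x, Y x) ∂μ := by
    simp only [hTx]
  have l2 : ∫ x, F' x ∂μ = ∫ x, (fun p : ℝ × E => F' (T p)) (L x, Y x) ∂μ := by
    simp only [hTx]
  rw [l1, l2, htrans a1, htrans a2]
  congr 1
  ext y
  have aff : ∀ {H : E → A}, Adm H → Adm (fun z : ℝ => H (T (z, y))) := by
    intro H hH
    obtain ⟨C, k, hC, hk⟩ := hH.growth
    refine ⟨hH.cont.comp (by fun_prop), C * (1 + (‖y‖ + ‖(L v)⁻¹‖ * ‖v‖)) ^ k, k, by positivity,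
      fun z => (hk _).trans ?_⟩
    rw [mul_assoc, ← mul_pow]
    have h0 : ‖T (z, y)‖ ≤ ‖y‖ + ‖(L v)⁻¹‖ * ‖v‖ * ‖z‖ := by
      rw [hTz]
      refine (norm_add_le _ _).trans ?_
      rw [norm_smul, norm_mul]
      linarith
    have h1 := norm_nonneg y
    have h2 : 0 ≤ ‖(L v)⁻¹‖ * ‖v‖ := by positivity
    have h3 := norm_nonneg z
    gcongr
    nlinarith
  have hder : ∀ z, HasDerivAt (fun z : ℝ => F (T (z, y))) ((L v)⁻¹ • F' (T (z, y))) z := by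
    intro z
    have h1 := h (T (z, y))
    have h2 : HasDerivAt (fun w : ℝ => (L v)⁻¹ * (w - z)) (L v)⁻¹ z := by
      simpa using ((hasDerivAt_id z).sub_const z).const_mul (L v)⁻¹
    have h3 : HasDerivAt (fun s : ℝ => F (T (z, y) + s • v)) (F' (T (z, y)))
        ((fun w : ℝ => (L v)⁻¹ * (w - z)) z) := by simpa using h1
    have h4 := h3.scomp z h2
    refine h4.congr_of_eventuallyEq (Eventually.of_forall fun w => ?_)
    simp only [Function.comp, hTz]
    congr 1
    rw [add_assoc, ← add_smul]
    congr 2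
    ring
  have := stein_real hV0 (aff hF) ((Adm.const (E := ℝ) (L v)⁻¹).smul (aff hF')) hder
  rw [this, integral_smul, smul_smul, hVv, mul_inv_cancel₀ hV.ne', one_smul]

end Stein

section Smooth

variable {E F : Type*} [NormedAddCommGroup E] [NormedSpace ℝ E]
  [NormedAddCommGroup F] [NormedSpace ℝ F]

/-- Directional derivative in the direction `w`. -/
def dd (w : E) (g : E → ℝ) (z : E) : ℝ := fderiv ℝ g z w

lemma CbSmooth.differentiable {g : E → ℝ} (hg : CbSmooth g) : Differentiable ℝ g :=
  (hg.1 1).differentiable (by simp)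

lemma CbSmooth.continuous {g : E → ℝ} (hg : CbSmooth g) : Continuous g := (hg.1 1).continuous

lemma CbSmooth.bound {g : E → ℝ} (hg : CbSmooth g) : ∃ K, 0 ≤ K ∧ ∀ z, |g z| ≤ K := by
  obtain ⟨M, hM⟩ := hg.2 0
  refine ⟨|M|, abs_nonneg _, fun z => ?_⟩
  have := hM z
  rw [norm_iteratedFDeriv_zero, Real.norm_eq_abs] at this
  exact this.trans (le_abs_self M)

lemma CbSmooth.dd {g : E → ℝ} (hg : CbSmooth g) (w : E) : CbSmooth (dd w g) := by
  have h1 : ∀ n : ℕ, ContDiff ℝ n (fderiv ℝ g) := fun n =>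
    (hg.1 (n + 1)).fderiv_right (by push_cast; exact le_rfl)
  refine ⟨fun n => (h1 n).clm_apply contDiff_const, fun k => ?_⟩
  obtain ⟨M, hM⟩ := hg.2 (k + 1)
  refine ⟨‖w‖ * M, fun x => ?_⟩
  refine (norm_iteratedFDeriv_clm_apply_const (h1 k).contDiffAt le_rfl).trans ?_
  rw [norm_iteratedFDeriv_fderiv]
  gcongr
  exact hM x

lemma CbSmooth.const_mul {g : E → ℝ} (hg : CbSmooth g) (a : ℝ) : CbSmooth (fun z => a * g z) := by
  refine ⟨fun n => contDiff_const.mul (hg.1 n), fun k => ?_⟩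
  obtain ⟨M, hM⟩ := hg.2 k
  refine ⟨‖a‖ * M, fun x => ?_⟩
  have : (fun z => a * g z) = a • g := rfl
  rw [this, iteratedFDeriv_const_smul_apply (hg.1 k).contDiffAt, norm_smul]
  gcongr
  exact hM x

lemma CbSmooth.add {g h : E → ℝ} (hg : CbSmooth g) (hh : CbSmooth h) :
    CbSmooth (fun z => g z + h z) := by
  refine ⟨fun n => (hg.1 n).add (hh.1 n), fun k => ?_⟩
  obtain ⟨M, hM⟩ := hg.2 k
  obtain ⟨M', hM'⟩ := hh.2 k
  refine ⟨M + M', fun x => ?_⟩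
  have : (fun z => g z + h z) = g + h := rfl
  rw [this, iteratedFDeriv_add_apply (hg.1 k).contDiffAt (hh.1 k).contDiffAt]
  exact (norm_add_le _ _).trans (add_le_add (hM x) (hM' x))

lemma CbSmooth.zero : CbSmooth (fun _ : E => (0 : ℝ)) := by
  refine ⟨fun n => contDiff_const, fun k => ⟨0, fun x => ?_⟩⟩
  have : (fun _ : E => (0 : ℝ)) = 0 := rfl
  simp [this]

lemma CbSmooth.sum {ι : Type*} {s : Finset ι} {g : ι → E → ℝ} (h : ∀ i ∈ s, CbSmooth (g i)) :
    CbSmooth (fun x => ∑ i ∈ s, g i x) := by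
  classical
  induction s using Finset.induction_on with
  | empty => simpa using CbSmooth.zero
  | insert a s ha ih =>
    simp only [Finset.sum_insert ha]
    exact (h a (Finset.mem_insert_self _ _)).add
      (ih fun i hi => h i (Finset.mem_insert_of_mem hi))

lemma CbSmooth.mul {g h : E → ℝ} (hg : CbSmooth g) (hh : CbSmooth h) :
    CbSmooth (fun z => g z * h z) := by
  refine ⟨fun n => (hg.1 n).mul (hh.1 n), fun k => ?_⟩
  choose M hM using hg.2
  choose M' hM' using hh.2
  refine ⟨∑ i ∈ Finset.range (k + 1), (k.choose i : ℝ) * M i * M' (k - i), fun x => ?_⟩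
  refine (norm_iteratedFDeriv_mul_le (hg.1 k) (hh.1 k) x le_rfl).trans ?_
  refine Finset.sum_le_sum fun i _ => ?_
  have h1 := hM i x
  have h2 := hM' (k - i) x
  have := (norm_nonneg _).trans h1
  gcongr

lemma dd_smul (c : ℝ) (w : E) (g : E → ℝ) : dd (c • w) g = fun z => c * dd w g z := by
  ext z
  simp [dd]

lemma dd_add_dir (w w' : E) (g : E → ℝ) : dd (w + w') g = fun z => dd w g z + dd w' g z := by
  ext z
  simp [dd]

lemma dd_const_mul {g : E → ℝ} (hg : CbSmooth g) (c : ℝ) (w : E) :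
    dd w (fun z => c * g z) = fun z => c * dd w g z := by
  ext z
  simp [dd, fderiv_const_mul (hg.differentiable z)]

lemma dd_add {g h : E → ℝ} (hg : CbSmooth g) (hh : CbSmooth h) (w : E) :
    dd w (fun z => g z + h z) = fun z => dd w g z + dd w h z := by
  ext z
  simp only [dd]
  rw [fderiv_fun_add (hg.differentiable z) (hh.differentiable z)]
  rfl

lemma dd_comm {g : E → ℝ} (hg : CbSmooth g) (w w' : E) : dd w (dd w' g) = dd w' (dd w g) := by
  ext z
  have h1 : Differentiable ℝ (fderiv ℝ g) :=
    ((hg.1 2).fderiv_right (m := 1) (by norm_num)).differentiable (by simp)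
  have key : ∀ a b : E, dd a (dd b g) z = fderiv ℝ (fderiv ℝ g) z a b := by
    intro a b
    have : HasFDerivAt (dd b g) ((ContinuousLinearMap.apply ℝ ℝ b).comp
        (fderiv ℝ (fderiv ℝ g) z)) z :=
      (ContinuousLinearMap.apply ℝ ℝ b).hasFDerivAt.comp z (h1 z).hasFDerivAt
    rw [dd, this.fderiv]
    rfl
  rw [key, key]
  exact second_derivative_symmetric (fun y => (hg.differentiable y).hasFDerivAt)
    (h1 z).hasFDerivAt w w'

lemma dd_iterate {g : E → ℝ} (hg : CbSmooth g) (w : E) (r : ℕ) :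
    (dd w)^[r] g = fun z => iteratedFDeriv ℝ r g z (fun _ => w) := by
  induction r with
  | zero => ext z; simp
  | succ r ih =>
    ext z
    rw [Function.iterate_succ_apply', ih, iteratedFDeriv_succ_apply_left]
    have h1 : Differentiable ℝ (iteratedFDeriv ℝ r g) :=
      (hg.1 (r + 1)).differentiable_iteratedFDeriv (by exact_mod_cast Nat.lt_succ_self r)
    have : HasFDerivAt (fun z => iteratedFDeriv ℝ r g z (fun _ => w))
        ((ContinuousMultilinearMap.apply ℝ (fun _ : Fin r => E) ℝ (fun _ => w)).comp
        (fderiv ℝ (iteratedFDeriv ℝ r g) z)) z :=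
      (ContinuousMultilinearMap.apply ℝ (fun _ : Fin r => E) ℝ
        (fun _ => w)).hasFDerivAt.comp z (h1 z).hasFDerivAt
    rw [dd, this.fderiv]
    rfl

lemma dd_iterate_bound {g : E → ℝ} (hg : CbSmooth g) (r : ℕ) :
    ∃ K, 0 ≤ K ∧ ∀ w z, |(dd w)^[r] g z| ≤ K * ‖w‖ ^ r := by
  obtain ⟨M, hM⟩ := hg.2 r
  refine ⟨|M|, abs_nonneg _, fun w z => ?_⟩
  rw [dd_iterate hg, ← Real.norm_eq_abs]
  refine ((iteratedFDeriv ℝ r g z).le_opNorm _).trans ?_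
  simp only [Finset.prod_const, Finset.card_univ, Fintype.card_fin]
  gcongr
  exact (hM z).trans (le_abs_self M)

lemma CbSmooth.lipschitz {g : E → ℝ} (hg : CbSmooth g) :
    ∃ K, 0 ≤ K ∧ ∀ y z, |g y - g z| ≤ K * ‖y - z‖ := by
  obtain ⟨M, hM⟩ := hg.2 1
  refine ⟨|M|, abs_nonneg _, fun y z => ?_⟩
  have h : ∀ x ∈ (Set.univ : Set E), ‖fderiv ℝ g x‖ ≤ |M| := fun x _ => by
    rw [← norm_iteratedFDeriv_zero (𝕜 := ℝ) (f := fderiv ℝ g), norm_iteratedFDeriv_fderiv]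
    exact (hM x).trans (le_abs_self M)
  rw [← Real.norm_eq_abs]
  exact convex_univ.norm_image_sub_le_of_norm_fderiv_le
    (fun x _ => hg.differentiable x) h (Set.mem_univ z) (Set.mem_univ y)

lemma CbSmooth.adm_comp {g : E → ℝ} (hg : CbSmooth g) (L : F →L[ℝ] E) :
    Adm (fun x => g (L x)) := by
  obtain ⟨K, _, hK⟩ := hg.bound
  exact Adm.of_bound (hg.continuous.comp L.continuous) K fun x => by
    simpa using hK (L x)

end Smooth

section Jets

variable {E A : Type*} [NormedAddCommGroup E] [NormedSpace ℝ E]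
  [NormedCommRing A] [NormedAlgebra ℝ A]

/-- `F₁`, `F₂`, `F₃` are the successive derivatives of `F₀` along `v`. -/
structure Jet (v : E) (F₀ F₁ F₂ F₃ : E → A) : Prop where
  a0 : Adm F₀
  a1 : Adm F₁
  a2 : Adm F₂
  a3 : Adm F₃
  d0 : ∀ x, HasDerivAt (fun s : ℝ => F₀ (x + s • v)) (F₁ x) 0
  d1 : ∀ x, HasDerivAt (fun s : ℝ => F₁ (x + s • v)) (F₂ x) 0
  d2 : ∀ x, HasDerivAt (fun s : ℝ => F₂ (x + s • v)) (F₃ x) 0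

variable {v : E} {F₀ F₁ F₂ F₃ G₀ G₁ G₂ G₃ : E → A}

lemma Jet.const (a : A) : Jet v (fun _ => a) (fun _ => 0) (fun _ => 0) (fun _ => 0) :=
  ⟨Adm.const a, Adm.const 0, Adm.const 0, Adm.const 0, fun _ => hasDerivAt_const _ _,
    fun _ => hasDerivAt_const _ _, fun _ => hasDerivAt_const _ _⟩

lemma Jet.add (hF : Jet v F₀ F₁ F₂ F₃) (hG : Jet v G₀ G₁ G₂ G₃) :
    Jet v (fun x => F₀ x + G₀ x) (fun x => F₁ x + G₁ x) (fun x => F₂ x + G₂ x)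
      (fun x => F₃ x + G₃ x) :=
  ⟨hF.a0.add hG.a0, hF.a1.add hG.a1, hF.a2.add hG.a2, hF.a3.add hG.a3,
    fun x => (hF.d0 x).add (hG.d0 x), fun x => (hF.d1 x).add (hG.d1 x),
    fun x => (hF.d2 x).add (hG.d2 x)⟩

lemma Jet.sum {ι : Type*} (s : Finset ι) {F₀ F₁ F₂ F₃ : ι → E → A}
    (h : ∀ i ∈ s, Jet v (F₀ i) (F₁ i) (F₂ i) (F₃ i)) :
    Jet v (fun x => ∑ i ∈ s, F₀ i x) (fun x => ∑ i ∈ s, F₁ i x) (fun x => ∑ i ∈ s, F₂ i x)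
      (fun x => ∑ i ∈ s, F₃ i x) := by
  classical
  induction s using Finset.induction_on with
  | empty => simpa using Jet.const (v := v) (0 : A)
  | insert a s ha ih =>
    simp only [Finset.sum_insert ha]
    exact (h a (Finset.mem_insert_self _ _)).add
      (ih fun i hi => h i (Finset.mem_insert_of_mem hi))

lemma Jet.mul (hF : Jet v F₀ F₁ F₂ F₃) (hG : Jet v G₀ G₁ G₂ G₃) :
    Jet v (fun x => F₀ x * G₀ x) (fun x => F₁ x * G₀ x + F₀ x * G₁ x)
      (fun x => F₂ x * G₀ x + 2 * (F₁ x * G₁ x) + F₀ x * G₂ x)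
      (fun x => F₃ x * G₀ x + 3 * (F₂ x * G₁ x) + 3 * (F₁ x * G₂ x) + F₀ x * G₃ x) := by
  have hz : ∀ (F : E → A) x, F (x + (0 : ℝ) • v) = F x := fun F x => by simp
  refine ⟨hF.a0.mul hG.a0, (hF.a1.mul hG.a0).add (hF.a0.mul hG.a1),
    ((hF.a2.mul hG.a0).add ((Adm.const 2).mul (hF.a1.mul hG.a1))).add (hF.a0.mul hG.a2),
    (((hF.a3.mul hG.a0).add ((Adm.const 3).mul (hF.a2.mul hG.a1))).add
      ((Adm.const 3).mul (hF.a1.mul hG.a2))).add (hF.a0.mul hG.a3), fun x => ?_, fun x => ?_,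
    fun x => ?_⟩
  · refine ((hF.d0 x).mul (hG.d0 x)).congr_deriv ?_
    simp only [hz]
  · refine (((hF.d1 x).mul (hG.d0 x)).add ((hF.d0 x).mul (hG.d1 x))).congr_deriv ?_
    simp only [hz]
    ring
  · refine ((((hF.d2 x).mul (hG.d0 x)).add
      (((hF.d1 x).mul (hG.d1 x)).const_mul 2)).add ((hF.d0 x).mul (hG.d2 x))).congr_deriv ?_
    simp only [hz]
    ring

lemma Jet.congr {F₀' F₁' F₂' F₃' : E → A} (h : Jet v F₀ F₁ F₂ F₃)
    (h0 : ∀ x, F₀ x = F₀' x) (h1 : ∀ x, F₁ x = F₁' x) (h2 : ∀ x, F₂ x = F₂' x)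
    (h3 : ∀ x, F₃ x = F₃' x) : Jet v F₀' F₁' F₂' F₃' := by
  rw [← funext h0, ← funext h1, ← funext h2, ← funext h3]
  exact h

lemma Jet.const_mul (a : A) (h : Jet v F₀ F₁ F₂ F₃) :
    Jet v (fun x => a * F₀ x) (fun x => a * F₁ x) (fun x => a * F₂ x) (fun x => a * F₃ x) :=
  ((Jet.const a).mul h).congr (fun x => by ring) (fun x => by ring) (fun x => by ring)
    fun x => by ring

lemma Jet.ofReal {F₀ F₁ F₂ F₃ : E → ℝ} (h : Jet v F₀ F₁ F₂ F₃) :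
    Jet v (fun x => (F₀ x : ℂ)) (fun x => (F₁ x : ℂ)) (fun x => (F₂ x : ℂ))
      (fun x => (F₃ x : ℂ)) :=
  ⟨h.a0.ofReal, h.a1.ofReal, h.a2.ofReal, h.a3.ofReal, fun x => (h.d0 x).ofReal_comp,
    fun x => (h.d1 x).ofReal_comp, fun x => (h.d2 x).ofReal_comp⟩

lemma Jet.clm (L : E →L[ℝ] ℝ) : Jet v (fun x => L x) (fun _ => L v) (fun _ => 0) (fun _ => 0) := by
  refine ⟨Adm.clm L, Adm.const _, Adm.const 0, Adm.const 0, fun x => ?_,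
    fun _ => hasDerivAt_const _ _, fun _ => hasDerivAt_const _ _⟩
  have := ((hasDerivAt_id (0 : ℝ)).mul_const (L v)).const_add (L x)
  simpa using this

lemma Jet.comp_clm {E' : Type*} [NormedAddCommGroup E'] [NormedSpace ℝ E'] {g : E' → ℝ}
    (hg : CbSmooth g) (L : E →L[ℝ] E') :
    Jet v (fun x => g (L x)) (fun x => dd (L v) g (L x)) (fun x => dd (L v) (dd (L v) g) (L x))
      (fun x => dd (L v) (dd (L v) (dd (L v) g)) (L x)) := by
  have key : ∀ {h : E' → ℝ}, CbSmooth h → ∀ x,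
      HasDerivAt (fun s : ℝ => h (L (x + s • v))) (dd (L v) h (L x)) 0 := by
    intro h hh x
    have h1 : HasDerivAt (fun s : ℝ => L (x + s • v)) (L v) 0 := by
      have := ((hasDerivAt_id (0 : ℝ)).smul_const (L v)).const_add (L x)
      simpa using this
    have h2 := (hh.differentiable (L (x + (0 : ℝ) • v))).hasFDerivAt.comp_hasDerivAt 0 h1
    refine h2.congr_deriv ?_
    simp [dd]
  exact ⟨hg.adm_comp L, (hg.dd _).adm_comp L, ((hg.dd _).dd _).adm_comp L,
    (((hg.dd _).dd _).dd _).adm_comp L, key hg, key (hg.dd _), key ((hg.dd _).dd _)⟩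

lemma Adm.cexp {B : E → ℂ} (hB : Adm B) {K : ℝ} (hK : ∀ x, (B x).re ≤ K) :
    Adm (fun x => Complex.exp (B x)) :=
  Adm.of_bound (Complex.continuous_exp.comp hB.cont) (Real.exp K) fun x => by
    rw [Complex.norm_exp]
    exact Real.exp_le_exp.2 (hK x)

lemma Jet.cexp {B₀ B₁ B₂ B₃ : E → ℂ} (h : Jet v B₀ B₁ B₂ B₃) {K : ℝ}
    (hK : ∀ x, (B₀ x).re ≤ K) :
    Jet v (fun x => Complex.exp (B₀ x)) (fun x => B₁ x * Complex.exp (B₀ x))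
      (fun x => (B₂ x + B₁ x ^ 2) * Complex.exp (B₀ x))
      (fun x => (B₃ x + 3 * (B₁ x * B₂ x) + B₁ x ^ 3) * Complex.exp (B₀ x)) := by
  have hz : ∀ (F : E → ℂ) x, F (x + (0 : ℝ) • v) = F x := fun F x => by simp
  have he := h.a0.cexp hK
  have hd : ∀ x, HasDerivAt (fun s : ℝ => Complex.exp (B₀ (x + s • v)))
      (B₁ x * Complex.exp (B₀ x)) 0 := fun x => by
    refine ((h.d0 x).cexp).congr_deriv ?_
    rw [hz B₀, mul_comm]
  refine ⟨he, h.a1.mul he, (h.a2.add (h.a1.pow 2)).mul he,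
    ((h.a3.add ((Adm.const 3).mul (h.a1.mul h.a2))).add (h.a1.pow 3)).mul he, hd,
    fun x => ?_, fun x => ?_⟩
  · refine ((h.d1 x).mul (hd x)).congr_deriv ?_
    simp only [hz]
    ring
  · refine (((h.d2 x).add ((h.d1 x).pow 2)).mul (hd x)).congr_deriv ?_
    simp only [Pi.add_apply, Pi.pow_apply, hz]
    ring

end Jets

section SteinThree

variable {E A : Type*} [NormedAddCommGroup E] [NormedSpace ℝ E]
  [NormedCommRing A] [NormedAlgebra ℝ A]
  [MeasurableSpace E] [BorelSpace E] [SecondCountableTopology E] [CompleteSpace E]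

/-- Triple integration by parts against the third Hermite polynomial. -/
lemma stein_three (μ : Measure E) [IsGaussian μ] (hμ : ∀ L : StrongDual ℝ E, ∫ x, L x ∂μ = 0)
    {L : StrongDual ℝ E} {v : E} (hv : IsCMVector μ L v) (hV : 0 < L v)
    {F₀ F₁ F₂ F₃ : E → A} (h : Jet v F₀ F₁ F₂ F₃) :
    ∫ x, (L x ^ 3 - 3 * L v * L x) • F₀ x ∂μ = ∫ x, F₃ x ∂μ := by
  have hL : Adm (fun x => L x) := Adm.clm L
  have hLd : ∀ x, HasDerivAt (fun s : ℝ => L (x + s • v)) (L v) 0 := (Jet.clm L).d0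
  have s0 := stein μ hμ hv hV h.a0 h.a1 h.d0
  have s2 := stein μ hμ hv hV h.a2 h.a3 h.d2
  have s1 := stein μ hμ hv hV (F := fun x => L x • F₁ x)
    (F' := fun x => L v • F₁ x + L x • F₂ x) (hL.smul h.a1)
    (((Adm.const (L v)).smul h.a1).add (hL.smul h.a2)) fun x => by
      refine ((hLd x).smul (h.d1 x)).congr_deriv ?_
      simp [add_comm]
  have s3 := stein μ hμ hv hV (F := fun x => L x ^ 2 • F₀ x)
    (F' := fun x => (2 * L v) • (L x • F₀ x) + L x ^ 2 • F₁ x) ((hL.pow 2).smul h.a0)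
    (((Adm.const (2 * L v)).smul (hL.smul h.a0)).add ((hL.pow 2).smul h.a1)) fun x => by
      refine (((hLd x).pow 2).smul (h.d0 x)).congr_deriv ?_
      simp only [zero_smul, add_zero, smul_smul]
      rw [add_comm]
      norm_num
      ring_nf
  have i0 : Integrable (fun x => L x • F₀ x) μ := (hL.smul h.a0).integrable μ
  have i1 : Integrable (fun x => L x ^ 2 • F₁ x) μ := ((hL.pow 2).smul h.a1).integrable μ
  have i2 : Integrable (fun x => L x • F₂ x) μ := (hL.smul h.a2).integrable μ
  have i3 : Integrable (fun x => L x • L x ^ 2 • F₀ x) μ :=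
    (hL.smul ((hL.pow 2).smul h.a0)).integrable μ
  have j1 : Integrable (fun x => F₁ x) μ := h.a1.integrable μ
  have e1 : ∀ x, L x • L x • F₁ x = L x ^ 2 • F₁ x := fun x => by rw [smul_smul, pow_two]
  simp_rw [e1] at s1
  have k1 : Integrable (fun x => (2 * L v) • (L x • F₀ x)) μ := i0.smul (2 * L v)
  have k2 : Integrable (fun x => L v • F₁ x) μ := j1.smul (L v)
  rw [integral_add k1 i1, integral_smul, s1, integral_add k2 i2, integral_smul, s2, s0] at s3
  have e2 : ∀ x, (L x ^ 3 - 3 * L v * L x) • F₀ x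
      = L x • L x ^ 2 • F₀ x - (3 * L v) • (L x • F₀ x) := fun x => by
    simp only [smul_smul, ← sub_smul]
    congr 1
    ring
  have k3 : Integrable (fun x => (3 * L v) • (L x • F₀ x)) μ := i0.smul (3 * L v)
  simp_rw [e2]
  rw [integral_sub i3 k3, integral_smul, s3, s0, ← add_assoc, ← add_smul]
  have : (2 * L v + L v) = 3 * L v := by ring
  rw [this]
  abel

end SteinThree

section Rho

/-- The variogram `|x| ^ (1/3)` of the process. -/
def phi (x : ℝ) : ℝ := |x| ^ ((1 : ℝ) / 3)

lemma phi_nonneg (x : ℝ) : 0 ≤ phi x := Real.rpow_nonneg (abs_nonneg x) _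

lemma phi_neg (x : ℝ) : phi (-x) = phi x := by simp [phi]

lemma phi_zero : phi 0 = 0 := by simp [phi]

lemma phi_one : phi 1 = 1 := by simp [phi]

lemma phi_pow_three (x : ℝ) : phi x ^ 3 = |x| := by
  rw [phi, ← Real.rpow_natCast, ← Real.rpow_mul (abs_nonneg x)]
  norm_num

lemma phi_mono {x y : ℝ} (h : |x| ≤ |y|) : phi x ≤ phi y :=
  Real.rpow_le_rpow (abs_nonneg x) h (by norm_num)

lemma phi_mul (x y : ℝ) : phi (x * y) = phi x * phi y := by
  rw [phi, abs_mul, Real.mul_rpow (abs_nonneg x) (abs_nonneg y)]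
  rfl

lemma phi_add_le (x y : ℝ) : phi (x + y) ≤ phi x + phi y := by
  refine (Real.rpow_le_rpow (abs_nonneg _) (abs_add_le x y) (by norm_num)).trans ?_
  exact Real.rpow_add_le_add_rpow (abs_nonneg x) (abs_nonneg y) (by norm_num) (by norm_num)

lemma abs_phi_sub_le (x y : ℝ) : |phi x - phi y| ≤ phi (x - y) := by
  have h1 := phi_add_le (x - y) y
  have h2 := phi_add_le (y - x) x
  rw [sub_add_cancel] at h1 h2
  rw [← neg_sub x y, phi_neg] at h2
  rw [abs_sub_le_iff]
  constructor <;> linarith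

lemma covH_eq_phi (t s : ℝ) : covH (1 / 6) t s = (phi t + phi s - phi (t - s)) / 2 := by
  have : (2 : ℝ) * (1 / 6) = 1 / 3 := by norm_num
  simp only [covH, phi, this]

/-- The autocovariance of the increments. -/
abbrev rho (r : ℤ) : ℝ := rhoH (1 / 6) r

lemma rho_eq_phi (r : ℤ) : rho r = (phi (r + 1) + phi (r - 1) - 2 * phi r) / 2 := by
  have : (2 : ℝ) * (1 / 6) = 1 / 3 := by norm_num
  simp only [rho, rhoH, phi, this]

lemma rho_zero : rho 0 = 1 := by
  rw [rho_eq_phi]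
  have : phi (-1) = 1 := by rw [phi_neg, phi_one]
  simp [phi_one, phi_zero, this]

lemma rho_neg (r : ℤ) : rho (-r) = rho r := by
  rw [rho_eq_phi, rho_eq_phi]
  push_cast
  rw [phi_neg, show -(r : ℝ) + 1 = -(r - 1) by ring, show -(r : ℝ) - 1 = -(r + 1) by ring,
    phi_neg, phi_neg]
  ring

lemma abs_rho_le_one (r : ℤ) : |rho r| ≤ 1 := by
  have h1 := abs_phi_sub_le (r + 1) r
  have h2 := abs_phi_sub_le (r - 1) r
  rw [show (r : ℝ) + 1 - r = 1 by ring, phi_one] at h1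
  rw [show (r : ℝ) - 1 - r = -1 by ring, phi_neg, phi_one] at h2
  rw [rho_eq_phi, abs_le]
  rw [abs_le] at h1 h2
  constructor <;> linarith [h1.1, h1.2, h2.1, h2.2]

/-- Increments of `phi` along the natural numbers. -/
def dphi (r : ℕ) : ℝ := phi (r + 1) - phi r

lemma dphi_nonneg (r : ℕ) : 0 ≤ dphi r := by
  have h : (0 : ℝ) ≤ r := Nat.cast_nonneg r
  refine sub_nonneg.2 (phi_mono ?_)
  rw [abs_of_nonneg h, abs_of_nonneg (by linarith)]
  linarith

lemma rho_succ (r : ℕ) : rho (r + 1) = (dphi (r + 1) - dphi r) / 2 := by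
  rw [rho_eq_phi, dphi, dphi]
  push_cast
  rw [add_sub_cancel_right]
  ring

lemma dphi_anti (r : ℕ) : dphi (r + 1) ≤ dphi r := by
  have hr : (0 : ℝ) ≤ r := Nat.cast_nonneg r
  have hc := Real.concaveOn_rpow (p := (1 : ℝ) / 3) (by norm_num) (by norm_num)
  have := hc.2 (Set.mem_Ici.2 hr) (Set.mem_Ici.2 (show (0 : ℝ) ≤ (r : ℝ) + 1 + 1 by linarith))
    (show (0 : ℝ) ≤ 1 / 2 by norm_num) (show (0 : ℝ) ≤ 1 / 2 by norm_num) (by norm_num)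
  simp only [smul_eq_mul] at this
  rw [show 1 / 2 * (r : ℝ) + 1 / 2 * (r + 1 + 1) = r + 1 by ring] at this
  simp only [dphi, phi, Nat.cast_add, Nat.cast_one]
  rw [abs_of_nonneg hr, abs_of_nonneg (show (0 : ℝ) ≤ r + 1 by linarith),
    abs_of_nonneg (show (0 : ℝ) ≤ r + 1 + 1 by linarith)]
  linarith

lemma dphi_sq_mul_le (r : ℕ) : dphi r ^ 2 * (r + 1) ≤ 1 := by
  have hr : (0 : ℝ) ≤ r := Nat.cast_nonneg r
  set a := phi ((r : ℝ) + 1) with ha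
  set b := phi (r : ℝ) with hb
  have ha3 : a ^ 3 = r + 1 := by rw [ha, phi_pow_three, abs_of_nonneg (by linarith)]
  have hb3 : b ^ 3 = r := by rw [hb, phi_pow_three, abs_of_nonneg hr]
  have hb0 : 0 ≤ b := phi_nonneg _
  have hab : b ≤ a := sub_nonneg.1 (dphi_nonneg r)
  have ha1 : 1 ≤ a := by
    by_contra! h
    have := pow_lt_one₀ (hb0.trans hab) h (n := 3) (by norm_num)
    linarith
  have hd : dphi r = a - b := rfl
  rw [hd, ← ha3]
  have h1 : (a - b) * (a ^ 2 + a * b + b ^ 2) = 1 := by nlinarith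
  have h0 : 0 ≤ a - b := by linarith
  have h2 : (a - b) * a ^ 2 ≤ 1 := by
    rw [← h1]
    gcongr
    nlinarith
  have h3 : ((a - b) * a ^ 2) ^ 2 ≤ 1 := pow_le_one₀ (by positivity) h2
  calc (a - b) ^ 2 * a ^ 3 ≤ (a - b) ^ 2 * a ^ 4 := by
        exact mul_le_mul_of_nonneg_left (pow_le_pow_right₀ ha1 (by norm_num)) (sq_nonneg _)
    _ = ((a - b) * a ^ 2) ^ 2 := by ring
    _ ≤ 1 := h3

lemma abs_rho_succ (r : ℕ) : |rho (r + 1)| = (dphi r - dphi (r + 1)) / 2 := by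
  have := dphi_anti r
  rw [rho_succ, abs_of_nonpos (by linarith)]
  ring

lemma summable_abs_rho : Summable fun r : ℤ => |rho r| := by
  have h : Summable fun r : ℕ => |rho (r : ℤ)| := by
    rw [← summable_nat_add_iff 1]
    refine summable_of_sum_range_le (c := dphi 0 / 2) (fun _ => abs_nonneg _) fun n => ?_
    have : ∀ i : ℕ, |rho ((i + 1 : ℕ) : ℤ)| = dphi i / 2 - dphi (i + 1) / 2 := fun i => by
      push_cast
      rw [abs_rho_succ]
      ring
    simp_rw [this]
    rw [Finset.sum_range_sub']
    linarith [dphi_nonneg n]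
  refine Summable.of_nat_of_neg h ?_
  simpa only [rho_neg] using h

lemma abs_mul_rho_cube_le (r : ℤ) : |(r : ℝ)| * |rho r| ^ 3 ≤ |rho r| := by
  wlog hr : 0 ≤ r generalizing r
  · have := this (-r) (by omega)
    rwa [rho_neg, Int.cast_neg, abs_neg] at this
  lift r to ℕ using hr
  rcases r with _ | r
  · simp
  · push_cast
    have h0 : (0 : ℝ) ≤ (r : ℝ) + 1 := by positivity
    rw [abs_of_nonneg h0]
    have h1 : |rho (r + 1)| ≤ dphi r := by
      rw [abs_rho_succ]
      linarith [dphi_nonneg r, dphi_nonneg (r + 1)]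
    have h2 := dphi_sq_mul_le r
    have h3 := abs_nonneg (rho (r + 1))
    have h4 : |rho (r + 1)| ^ 2 ≤ dphi r ^ 2 := by gcongr
    have h5 : |rho (r + 1)| ^ 2 * ((r : ℝ) + 1) ≤ 1 :=
      (mul_le_mul_of_nonneg_right h4 h0).trans h2
    calc ((r : ℝ) + 1) * |rho (r + 1)| ^ 3
        = (|rho (r + 1)| ^ 2 * ((r : ℝ) + 1)) * |rho (r + 1)| := by ring
      _ ≤ 1 * |rho (r + 1)| := by gcongr
      _ = _ := one_mul _

lemma summable_abs_rho_cube : Summable fun r : ℤ => |rho r| ^ 3 := by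
  refine Summable.of_nonneg_of_le (fun _ => by positivity) (fun r => ?_) summable_abs_rho
  exact pow_le_of_le_one (abs_nonneg _) (abs_rho_le_one r) (by norm_num)

/-- The constant `∑ ρ(r)³`. -/
def kappa : ℝ := ∑' r : ℤ, rho r ^ 3

/-- The constant `∑ |ρ(r)|`. -/
def rhoMass : ℝ := ∑' r : ℤ, |rho r|

lemma sum_shift_le_tsum {g : ℤ → ℝ} (h0 : ∀ r, 0 ≤ g r) (hg : Summable g) (N j : ℕ) :
    ∑ k ∈ Finset.range N, g ((k : ℤ) - j) ≤ ∑' r, g r := by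
  classical
  have hinj : Set.InjOn (fun k : ℕ => (k : ℤ) - j) (Finset.range N : Set ℕ) :=
    fun a _ b _ hab => by
      simp only at hab
      omega
  rw [← Finset.sum_image (f := g) hinj]
  exact hg.sum_le_tsum _ fun r _ => h0 r

lemma sum_abs_rho_le (N j : ℕ) :
    ∑ k ∈ Finset.range N, |rho ((k : ℤ) - j)| ≤ rhoMass :=
  sum_shift_le_tsum (fun _ => abs_nonneg _) summable_abs_rho N j

lemma rhoMass_nonneg : 0 ≤ rhoMass := tsum_nonneg fun _ => abs_nonneg _

end Rho

section Models

/-- Scalar product with `u` on `ℝ × ℝ`. -/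
def dotL (u : ℝ × ℝ) : (ℝ × ℝ) →L[ℝ] ℝ :=
  u.1 • ContinuousLinearMap.fst ℝ ℝ ℝ + u.2 • ContinuousLinearMap.snd ℝ ℝ ℝ

lemma dotL_apply (u z : ℝ × ℝ) : dotL u z = u.1 * z.1 + u.2 * z.2 := by simp [dotL]

/-- The four polarization directions. -/
def dir : Fin 4 → ℝ × ℝ := ![(1, 0), (0, 1), (1, 1), (1, -1)]

lemma norm_dir (u : Fin 4) : ‖dir u‖ = 1 := by
  fin_cases u <;> simp [dir, Prod.norm_def]

lemma abs_dotL_dir_le (u : Fin 4) (z : ℝ × ℝ) : |dotL (dir u) z| ≤ 2 * ‖z‖ := by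
  have h1 : |z.1| ≤ ‖z‖ := norm_fst_le z
  have h2 : |z.2| ≤ ‖z‖ := norm_snd_le z
  rw [abs_le] at *
  fin_cases u <;> simp [dotL_apply, dir] <;> constructor <;> linarith [h1.1, h1.2, h2.1, h2.2]

lemma abs_dotL_dir_dir_le (u w : Fin 4) : |dotL (dir u) (dir w)| ≤ 2 := by
  simpa [norm_dir] using abs_dotL_dir_le u (dir w)

lemma one_le_dotL_dir (u : Fin 4) : 1 ≤ dotL (dir u) (dir u) := by
  fin_cases u <;> simp [dotL_apply, dir]

/-- Finite-dimensional Gaussian data of a discretized planar process: `P k` is the value of the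
process at the `k`-th grid point, `loc` its values at finitely many fixed times, `vec j u` the
Cameron-Martin vector of the `j`-th increment in the direction `u`. -/
structure Model (C₀ : ℝ) (m : ℕ) where
  d : ℕ
  N : ℕ
  θ : ℝ
  μ : Measure (Fin d → ℝ × ℝ)
  P : ℕ → (Fin d → ℝ × ℝ) →L[ℝ] ℝ × ℝ
  loc : (Fin d → ℝ × ℝ) →L[ℝ] (Fin m → ℝ × ℝ)
  vec : ℕ → ℝ × ℝ → Fin d → ℝ × ℝ
  γ : ℕ → ℝ
  τ : ℕ → ℕ → ℝ
  b : ℕ → ℝ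
  one_le : 1 ≤ C₀
  gauss : IsGaussian μ
  cent : ∀ L : StrongDual ℝ (Fin d → ℝ × ℝ), ∫ x, L x ∂μ = 0
  θ_pos : 0 < θ
  θ_le : θ ≤ 1
  N_le : N * (θ ^ 8) ^ 6 ≤ C₀
  cm : ∀ j < N, ∀ u, IsCMVector μ ((dotL u).comp (P (j + 1) - P j)) (vec j u)
  incr_vec : ∀ j < N, ∀ k < N, ∀ u,
    (P (k + 1) - P k) (vec j u) = ((θ ^ 8) ^ 2 * rho ((k : ℤ) - j)) • u
  mid_vec : ∀ j < N, ∀ k < N, ∀ u,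
    ((1 / 2 : ℝ) • (P (k + 1) + P k)) (vec j u) = (γ j + τ j k) • u
  loc_vec : ∀ j < N, ∀ u, ‖loc (vec j u)‖ ≤ b j * ‖u‖
  γ_le : ∀ j < N, |γ j| ≤ b j
  b_le : ∀ j < N, b j ≤ C₀ * (θ ^ 8) ^ 2
  b_sum : ∑ j ∈ Finset.range N, b j ≤ C₀
  τ_self : ∀ j < N, τ j j = 0
  τ_le : ∀ j < N, ∀ k < N, |τ j k| ≤ C₀ * (θ ^ 8) ^ 2
  τ_sum : ∀ j < N, ∑ k ∈ Finset.range N, |τ j k| ≤ C₀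

namespace Model

variable {C₀ : ℝ} {m : ℕ} (M : Model C₀ m)

/-- The state space of the model. -/
abbrev E : Type := Fin M.d → ℝ × ℝ

/-- Standard deviation of the increments. -/
def η : ℝ := M.θ ^ 8

/-- Increments of the process. -/
def incr (k : ℕ) : M.E →L[ℝ] ℝ × ℝ := M.P (k + 1) - M.P k

/-- Midpoints of the process. -/
def mid (k : ℕ) : M.E →L[ℝ] ℝ × ℝ := (1 / 2 : ℝ) • (M.P (k + 1) + M.P k)

/-- Increments in the polarization directions. -/
def ξ (k : ℕ) (w : Fin 4) : StrongDual ℝ M.E := (dotL (dir w)).comp (M.incr k)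

/-- Variances of `ξ`. -/
def V (w : Fin 4) : ℝ := M.η ^ 2 * dotL (dir w) (dir w)

/-- Third Hermite polynomials of the increments. -/
def herm (k : ℕ) (w : Fin 4) (x : M.E) : ℝ := M.ξ k w x ^ 3 - 3 * M.V w * M.ξ k w x

/-- Normalized amplitude of the increments. -/
def amp (x : M.E) : ℝ := 1 + ‖fun k : Fin M.N => M.incr k x‖ / M.η

/-- Weighted sums of third Hermite polynomials. -/
def W (α : Fin 4 → ℝ × ℝ → ℝ) (x : M.E) : ℝ :=
  ∑ k ∈ Finset.range M.N, ∑ w, α w (M.mid k x) * M.herm k w x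

/-- The Cameron-Martin vector of `ξ`. -/
def cmv (j : ℕ) (u : Fin 4) : M.E := M.vec j (dir u)

instance : IsGaussian M.μ := M.gauss

lemma η_pos : 0 < M.η := pow_pos M.θ_pos 8

lemma η_le : M.η ≤ 1 := pow_le_one₀ M.θ_pos.le M.θ_le

lemma N_mul_le : M.N * M.η ^ 6 ≤ C₀ := M.N_le

lemma one_le_amp (x : M.E) : 1 ≤ M.amp x := by
  have : 0 ≤ ‖fun k : Fin M.N => M.incr k x‖ / M.η := div_nonneg (norm_nonneg _) M.η_pos.le
  rw [amp]
  linarith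

lemma norm_incr_le {k : ℕ} (hk : k < M.N) (x : M.E) : ‖M.incr k x‖ ≤ M.amp x * M.η := by
  have h := norm_le_pi_norm (fun k : Fin M.N => M.incr k x) ⟨k, hk⟩
  have h1 : M.amp x * M.η = M.η + ‖fun k : Fin M.N => M.incr k x‖ := by
    rw [amp, add_mul, one_mul, div_mul_cancel₀ _ M.η_pos.ne']
  rw [h1]
  have := M.η_pos
  simp only at h
  linarith

lemma abs_ξ_le {k : ℕ} (hk : k < M.N) (w : Fin 4) (x : M.E) :
    |M.ξ k w x| ≤ 2 * (M.amp x * M.η) :=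
  (abs_dotL_dir_le w (M.incr k x)).trans (by linarith [M.norm_incr_le hk x])

lemma V_nonneg (w : Fin 4) : 0 ≤ M.V w :=
  mul_nonneg (sq_nonneg _) (zero_le_one.trans (one_le_dotL_dir w))

lemma V_le (w : Fin 4) : M.V w ≤ 2 * M.η ^ 2 := by
  have := (le_abs_self _).trans (abs_dotL_dir_dir_le w w)
  rw [V, mul_comm]
  gcongr

lemma b_nonneg {j : ℕ} (hj : j < M.N) : 0 ≤ M.b j := (abs_nonneg _).trans (M.γ_le j hj)

lemma b_le' {j : ℕ} (hj : j < M.N) : M.b j ≤ C₀ * M.η ^ 2 := M.b_le j hj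

lemma τ_le' {j k : ℕ} (hj : j < M.N) (hk : k < M.N) : |M.τ j k| ≤ C₀ * M.η ^ 2 :=
  M.τ_le j hj k hk

lemma ξ_cmv {j k : ℕ} (hj : j < M.N) (hk : k < M.N) (u w : Fin 4) :
    M.ξ k w (M.cmv j u) = M.η ^ 2 * rho ((k : ℤ) - j) * dotL (dir w) (dir u) := by
  rw [ξ, ContinuousLinearMap.comp_apply, cmv, incr, M.incr_vec j hj k hk, map_smul, smul_eq_mul]
  rfl

lemma mid_cmv {j k : ℕ} (hj : j < M.N) (hk : k < M.N) (u : Fin 4) :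
    M.mid k (M.cmv j u) = (M.γ j + M.τ j k) • dir u := M.mid_vec j hj k hk _

lemma ξ_cmv_self {j : ℕ} (hj : j < M.N) (u : Fin 4) : M.ξ j u (M.cmv j u) = M.V u := by
  rw [M.ξ_cmv hj hj, sub_self, rho_zero, mul_one, V]

lemma V_pos (u : Fin 4) : 0 < M.V u :=
  mul_pos (pow_pos M.η_pos 2) (zero_lt_one.trans_le (one_le_dotL_dir u))

lemma isCMVector {j : ℕ} (hj : j < M.N) (u : Fin 4) : IsCMVector M.μ (M.ξ j u) (M.cmv j u) :=
  M.cm j hj _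

/-- Integration by parts against a third Hermite polynomial. -/
lemma integral_herm_smul {A : Type*} [NormedCommRing A] [NormedAlgebra ℝ A] {j : ℕ} (hj : j < M.N)
    (u : Fin 4) {F₀ F₁ F₂ F₃ : M.E → A} (h : Jet (M.cmv j u) F₀ F₁ F₂ F₃) :
    ∫ x, M.herm j u x • F₀ x ∂M.μ = ∫ x, F₃ x ∂M.μ := by
  have hV : 0 < M.ξ j u (M.cmv j u) := by rw [M.ξ_cmv_self hj]; exact M.V_pos u
  have := stein_three M.μ M.cent (M.isCMVector hj u) hV h
  rw [M.ξ_cmv_self hj] at this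
  exact this

lemma adm_herm (k : ℕ) (w : Fin 4) : Adm (M.herm k w) :=
  ((Adm.clm _).pow 3).sub ((Adm.const _).mul (Adm.clm _))

lemma adm_W {α : Fin 4 → ℝ × ℝ → ℝ} (hα : ∀ w, CbSmooth (α w)) : Adm (M.W α) :=
  Adm.sum fun k _ => Adm.sum fun w _ => ((hα w).adm_comp _).mul (M.adm_herm k w)

lemma adm_amp : Adm M.amp := by
  refine (Adm.const 1).add ?_
  have : Adm (fun x : M.E => ‖ContinuousLinearMap.pi (fun k : Fin M.N => M.incr k) x‖) :=
    (Adm.clm _).norm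
  simp only [div_eq_mul_inv]
  exact this.mul (Adm.const _)

end Model

lemma exists_bound_family {E ι κ : Type*} [Finite ι] [Finite κ] (F : ι → κ → E → ℝ)
    (h : ∀ i k, ∃ K, 0 ≤ K ∧ ∀ z, |F i k z| ≤ K) :
    ∃ K, 0 ≤ K ∧ ∀ i k z, |F i k z| ≤ K := by
  classical
  have := Fintype.ofFinite ι
  have := Fintype.ofFinite κ
  choose K h0 hK using h
  refine ⟨∑ i, ∑ k, K i k, Finset.sum_nonneg fun i _ => Finset.sum_nonneg fun k _ => h0 i k,
    fun i k z => (hK i k z).trans ?_⟩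
  calc K i k ≤ ∑ k, K i k := Finset.single_le_sum (f := fun k => K i k)
        (fun k _ => h0 i k) (Finset.mem_univ k)
    _ ≤ _ := Finset.single_le_sum (f := fun i => ∑ k, K i k)
        (fun i _ => Finset.sum_nonneg fun k _ => h0 i k) (Finset.mem_univ i)

/-- Uniform bound for a finite family and its directional derivatives up to order three. -/
lemma exists_bound_dd {ι : Type*} [Finite ι] (α : ι → ℝ × ℝ → ℝ) (hα : ∀ w, CbSmooth (α w)) :
    ∃ K, 0 ≤ K ∧ ∀ (w : ι) (u : Fin 4) z, |α w z| ≤ K ∧ |dd (dir u) (α w) z| ≤ K ∧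
      |dd (dir u) (dd (dir u) (α w)) z| ≤ K ∧
      |dd (dir u) (dd (dir u) (dd (dir u) (α w))) z| ≤ K := by
  obtain ⟨K0, p0, h0⟩ := exists_bound_family (fun (w : ι) (_ : Fin 4) => α w)
    fun w u => (hα w).bound
  obtain ⟨K1, p1, h1⟩ := exists_bound_family (fun (w : ι) (u : Fin 4) => dd (dir u) (α w))
    fun w u => ((hα w).dd _).bound
  obtain ⟨K2, p2, h2⟩ := exists_bound_family (fun (w : ι) (u : Fin 4) =>
    dd (dir u) (dd (dir u) (α w))) fun w u => (((hα w).dd _).dd _).bound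
  obtain ⟨K3, p3, h3⟩ := exists_bound_family (fun (w : ι) (u : Fin 4) =>
    dd (dir u) (dd (dir u) (dd (dir u) (α w)))) fun w u => ((((hα w).dd _).dd _).dd _).bound
  refine ⟨K0 + K1 + K2 + K3, by positivity, fun w u z => ⟨?_, ?_, ?_, ?_⟩⟩
  · linarith [h0 w u z]
  · linarith [h1 w u z]
  · linarith [h2 w u z]
  · linarith [h3 w u z]

end Models

section TermBounds

/-- Bounds for the third Hermite polynomial and its derivatives. -/
lemma herm_bounds {ξ V e R y η : ℝ} (hξ : |ξ| ≤ 2 * (y * η)) (hV0 : 0 ≤ V) (hV : V ≤ 2 * η ^ 2)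
    (he : |e| ≤ 2 * R * η ^ 2) (hR0 : 0 ≤ R) (hR : R ≤ 1) (hy : 1 ≤ y) (hη : 0 < η) :
    |ξ ^ 3 - 3 * V * ξ| ≤ 20 * (y ^ 3 * η ^ 3) ∧
    |3 * (ξ ^ 2 - V) * e| ≤ 36 * (y ^ 3 * η ^ 4 * R) ∧
    |6 * ξ * e ^ 2| ≤ 48 * (y ^ 3 * η ^ 5 * R) := by
  have y0 : 0 ≤ y := by linarith
  have y1 : y ≤ y ^ 3 := by simpa using pow_le_pow_right₀ hy (show 1 ≤ 3 by norm_num)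
  have y2 : 1 ≤ y ^ 2 := one_le_pow₀ hy
  have y23 : y ^ 2 ≤ y ^ 3 := pow_le_pow_right₀ hy (by norm_num)
  refine ⟨?_, ?_, ?_⟩
  · calc |ξ ^ 3 - 3 * V * ξ| ≤ |ξ ^ 3| + |3 * V * ξ| := abs_sub _ _
      _ = |ξ| ^ 3 + 3 * V * |ξ| := by rw [abs_pow, abs_mul, abs_of_nonneg (show 0 ≤ 3 * V by linarith)]
      _ ≤ (2 * (y * η)) ^ 3 + 3 * (2 * η ^ 2) * (2 * (y * η)) := by gcongr
      _ = 8 * (y ^ 3 * η ^ 3) + 12 * (y * η ^ 3) := by ring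
      _ ≤ 8 * (y ^ 3 * η ^ 3) + 12 * (y ^ 3 * η ^ 3) := by gcongr
      _ = _ := by ring
  · have h1 : |ξ ^ 2 - V| ≤ 6 * (y ^ 2 * η ^ 2) := by
      calc |ξ ^ 2 - V| ≤ |ξ ^ 2| + |V| := abs_sub _ _
        _ = |ξ| ^ 2 + V := by rw [abs_pow, abs_of_nonneg hV0]
        _ ≤ (2 * (y * η)) ^ 2 + 2 * (y ^ 2 * η ^ 2) := by
          gcongr
          refine hV.trans ?_
          have : 1 * η ^ 2 ≤ y ^ 2 * η ^ 2 := by gcongr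
          linarith
        _ = _ := by ring
    rw [abs_mul, abs_mul, abs_of_pos (show (0 : ℝ) < 3 by norm_num)]
    calc 3 * |ξ ^ 2 - V| * |e| ≤ 3 * (6 * (y ^ 2 * η ^ 2)) * (2 * R * η ^ 2) := by gcongr
      _ = 36 * (y ^ 2 * η ^ 4 * R) := by ring
      _ ≤ _ := by gcongr
  · rw [abs_mul, abs_mul, abs_pow, abs_of_pos (show (0 : ℝ) < 6 by norm_num)]
    calc 6 * |ξ| * |e| ^ 2 ≤ 6 * (2 * (y * η)) * (2 * R * η ^ 2) ^ 2 := by gcongr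
      _ = 48 * (y * η ^ 5 * (R * R)) := by ring
      _ ≤ 48 * (y ^ 3 * η ^ 5 * (R * 1)) := by gcongr
      _ = _ := by ring

lemma term_one_bound {K t a₀ a₁ τ H h₁ X R η : ℝ} (h0 : |a₀| ≤ K) (h1 : |a₁| ≤ K)
    (ht : |τ| ≤ t) (hH : |H| ≤ 20 * (X * η ^ 3)) (hh : |h₁| ≤ 36 * (X * η ^ 4 * R))
    (hX : 0 ≤ X) (hη : 0 < η) :
    |τ * a₁ * H + a₀ * h₁| ≤ 36 * K * X * (t * η ^ 3 + R * η ^ 4) := by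
  have hK : 0 ≤ K := (abs_nonneg _).trans h0
  have ht0 : 0 ≤ t := (abs_nonneg _).trans ht
  calc |τ * a₁ * H + a₀ * h₁| ≤ |τ * a₁ * H| + |a₀ * h₁| := abs_add_le _ _
    _ = |τ| * |a₁| * |H| + |a₀| * |h₁| := by simp only [abs_mul]
    _ ≤ t * K * (20 * (X * η ^ 3)) + K * (36 * (X * η ^ 4 * R)) := by gcongr
    _ = 36 * K * X * (t * η ^ 3 + R * η ^ 4) - 16 * (K * X * t * η ^ 3) := by ring
    _ ≤ _ := sub_le_self _ (by positivity)

lemma term_two_bound {K q a₀ a₁ a₂ c H h₁ h₂ X R η : ℝ} (h0 : |a₀| ≤ K) (h1 : |a₁| ≤ K)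
    (h2 : |a₂| ≤ K) (hc : |c| ≤ q) (hH : |H| ≤ 20 * (X * η ^ 3))
    (hh1 : |h₁| ≤ 36 * (X * η ^ 4 * R)) (hh2 : |h₂| ≤ 48 * (X * η ^ 5 * R))
    (hX : 0 ≤ X) (hη : 0 < η) (hR : 0 ≤ R) :
    |c ^ 2 * a₂ * H + 2 * (c * a₁ * h₁) + a₀ * h₂|
      ≤ 72 * K * X * (q ^ 2 * η ^ 3 + q * R * η ^ 4 + R * η ^ 5) := by
  have hK : 0 ≤ K := (abs_nonneg _).trans h0
  have hq0 : 0 ≤ q := (abs_nonneg _).trans hc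
  calc |c ^ 2 * a₂ * H + 2 * (c * a₁ * h₁) + a₀ * h₂|
      ≤ |c ^ 2 * a₂ * H| + |2 * (c * a₁ * h₁)| + |a₀ * h₂| := abs_add_three _ _ _
    _ = |c| ^ 2 * |a₂| * |H| + 2 * (|c| * |a₁| * |h₁|) + |a₀| * |h₂| := by
        simp only [abs_mul, abs_pow, abs_two]
    _ ≤ q ^ 2 * K * (20 * (X * η ^ 3)) + 2 * (q * K * (36 * (X * η ^ 4 * R)))
        + K * (48 * (X * η ^ 5 * R)) := by gcongr
    _ = 72 * K * X * (q ^ 2 * η ^ 3 + q * R * η ^ 4 + R * η ^ 5)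
        - (52 * (K * X * q ^ 2 * η ^ 3) + 24 * (K * X * R * η ^ 5)) := by ring
    _ ≤ _ := sub_le_self _ (by positivity)

lemma term_three_bound {K q a₁ a₂ a₃ c H h₁ h₂ X R η : ℝ} (h1 : |a₁| ≤ K)
    (h2 : |a₂| ≤ K) (h3 : |a₃| ≤ K) (hc : |c| ≤ q) (hH : |H| ≤ 20 * (X * η ^ 3))
    (hh1 : |h₁| ≤ 36 * (X * η ^ 4 * R)) (hh2 : |h₂| ≤ 48 * (X * η ^ 5 * R))
    (hX : 0 ≤ X) (hη : 0 < η) (hR : 0 ≤ R) :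
    |c ^ 3 * a₃ * H + 3 * (c ^ 2 * a₂ * h₁) + 3 * (c * a₁ * h₂)|
      ≤ 144 * K * X * (q ^ 3 * η ^ 3 + q ^ 2 * R * η ^ 4 + q * R * η ^ 5) := by
  have hK : 0 ≤ K := (abs_nonneg _).trans h1
  have hq0 : 0 ≤ q := (abs_nonneg _).trans hc
  calc |c ^ 3 * a₃ * H + 3 * (c ^ 2 * a₂ * h₁) + 3 * (c * a₁ * h₂)|
      ≤ |c ^ 3 * a₃ * H| + |3 * (c ^ 2 * a₂ * h₁)| + |3 * (c * a₁ * h₂)| := abs_add_three _ _ _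
    _ = |c| ^ 3 * |a₃| * |H| + 3 * (|c| ^ 2 * |a₂| * |h₁|) + 3 * (|c| * |a₁| * |h₂|) := by
        simp only [abs_mul, abs_pow, abs_of_pos (show (0 : ℝ) < 3 by norm_num)]
    _ ≤ q ^ 3 * K * (20 * (X * η ^ 3)) + 3 * (q ^ 2 * K * (36 * (X * η ^ 4 * R)))
        + 3 * (q * K * (48 * (X * η ^ 5 * R))) := by gcongr
    _ = 144 * K * X * (q ^ 3 * η ^ 3 + q ^ 2 * R * η ^ 4 + q * R * η ^ 5)
        - (124 * (K * X * q ^ 3 * η ^ 3) + 36 * (K * X * q ^ 2 * R * η ^ 4)) := by ring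
    _ ≤ _ := sub_le_self _ (by positivity)

end TermBounds

namespace Model

variable {C₀ : ℝ} {m : ℕ} (M : Model C₀ m)

lemma C₀_nonneg (M : Model C₀ m) : 0 ≤ C₀ := zero_le_one.trans M.one_le

/-- Coefficient of `dir u` in the midpoint of a Cameron-Martin vector. -/
def c (j k : ℕ) : ℝ := M.γ j + M.τ j k

/-- Value of an increment at a Cameron-Martin vector. -/
def e (j : ℕ) (u : Fin 4) (k : ℕ) (w : Fin 4) : ℝ :=
  M.η ^ 2 * rho ((k : ℤ) - j) * dotL (dir w) (dir u)

lemma abs_c_le {j : ℕ} (hj : j < M.N) (k : ℕ) : |M.c j k| ≤ M.b j + |M.τ j k| :=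
  (abs_add_le _ _).trans (add_le_add_left (M.γ_le j hj) _)

lemma abs_e_le (j : ℕ) (u : Fin 4) (k : ℕ) (w : Fin 4) :
    |M.e j u k w| ≤ 2 * |rho ((k : ℤ) - j)| * M.η ^ 2 := by
  rw [e, abs_mul, abs_mul, abs_of_nonneg (sq_nonneg M.η)]
  have := abs_dotL_dir_dir_le w u
  calc M.η ^ 2 * |rho ((k : ℤ) - j)| * |dotL (dir w) (dir u)|
      ≤ M.η ^ 2 * |rho ((k : ℤ) - j)| * 2 := by gcongr
    _ = _ := by ring

lemma jet_herm {j k : ℕ} (hj : j < M.N) (hk : k < M.N) (u w : Fin 4) :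
    Jet (M.cmv j u) (M.herm k w) (fun x => 3 * (M.ξ k w x ^ 2 - M.V w) * M.e j u k w)
      (fun x => 6 * M.ξ k w x * M.e j u k w ^ 2) (fun _ => 6 * M.e j u k w ^ 3) := by
  have h : Jet (M.cmv j u) (fun x => M.ξ k w x) (fun _ => M.e j u k w) (fun _ => 0)
      (fun _ => 0) := by
    have := Jet.clm (v := M.cmv j u) (M.ξ k w)
    rwa [M.ξ_cmv hj hk] at this
  refine (((h.mul h).mul h).add (h.const_mul (-(3 * M.V w)))).congr (fun x => ?_) (fun x => ?_)
    (fun x => ?_) (fun x => ?_)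
  · rw [herm]
    ring
  all_goals ring

lemma jet_mid {j k : ℕ} (hj : j < M.N) (hk : k < M.N) (u : Fin 4) {g : ℝ × ℝ → ℝ}
    (hg : CbSmooth g) :
    Jet (M.cmv j u) (fun x => g (M.mid k x)) (fun x => M.c j k * dd (dir u) g (M.mid k x))
      (fun x => M.c j k ^ 2 * dd (dir u) (dd (dir u) g) (M.mid k x))
      (fun x => M.c j k ^ 3 * dd (dir u) (dd (dir u) (dd (dir u) g)) (M.mid k x)) := by
  have h := Jet.comp_clm (v := M.cmv j u) hg (M.mid k)
  rw [M.mid_cmv hj hk, dd_smul, dd_smul, dd_const_mul (hg.dd _), dd_smul,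
    dd_const_mul (((hg.dd _).dd _).const_mul _), dd_const_mul ((hg.dd _).dd _)] at h
  refine h.congr (fun x => rfl) (fun x => rfl) (fun x => ?_) (fun x => ?_)
  · simp only [c]
    ring
  · simp only [c]
    ring

lemma sum_abs_rho_le' (j : ℕ) :
    ∑ k ∈ Finset.range M.N, |rho ((k : ℤ) - j)| ≤ rhoMass := sum_abs_rho_le _ _

/-- Summing the second-order terms over the grid. -/
lemma sum_two_le {j : ℕ} (hj : j < M.N) :
    ∑ k ∈ Finset.range M.N, ((M.b j + |M.τ j k|) ^ 2 * M.η ^ 3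
        + (M.b j + |M.τ j k|) * |rho ((k : ℤ) - j)| * M.η ^ 4 + |rho ((k : ℤ) - j)| * M.η ^ 5)
      ≤ (2 + 2 * C₀ ^ 2 + (2 * C₀ + 1) * rhoMass)
        * (M.N * M.η ^ 3 * M.b j ^ 2 + M.η ^ 5) := by
  have hη := M.η_pos
  have hη1 := M.η_le
  have hb := M.b_nonneg hj
  have hC := M.C₀_nonneg
  have hr := rhoMass_nonneg
  have h1 : ∀ k ∈ Finset.range M.N, (M.b j + |M.τ j k|) ^ 2 * M.η ^ 3
        + (M.b j + |M.τ j k|) * |rho ((k : ℤ) - j)| * M.η ^ 4 + |rho ((k : ℤ) - j)| * M.η ^ 5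
      ≤ 2 * M.b j ^ 2 * M.η ^ 3 + 2 * C₀ * M.η ^ 5 * |M.τ j k|
        + (2 * C₀ + 1) * M.η ^ 5 * |rho ((k : ℤ) - j)| := by
    intro k hk
    have hk' := Finset.mem_range.1 hk
    have ht := M.τ_le' hj hk'
    have hbC := M.b_le' hj
    have a1 : (M.b j + |M.τ j k|) ^ 2 ≤ 2 * M.b j ^ 2 + 2 * (C₀ * M.η ^ 2) * |M.τ j k| := by
      have : |M.τ j k| ^ 2 ≤ C₀ * M.η ^ 2 * |M.τ j k| := by
        rw [pow_two]
        gcongr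
      nlinarith [sq_nonneg (M.b j - |M.τ j k|)]
    have a2 : (M.b j + |M.τ j k|) * M.η ^ 4 ≤ 2 * C₀ * M.η ^ 5 := by
      calc (M.b j + |M.τ j k|) * M.η ^ 4 ≤ (C₀ * M.η ^ 2 + C₀ * M.η ^ 2) * M.η ^ 4 := by gcongr
        _ = 2 * C₀ * M.η ^ 5 * M.η := by ring
        _ ≤ 2 * C₀ * M.η ^ 5 * 1 := by gcongr
        _ = _ := mul_one _
    have a3 := mul_le_mul_of_nonneg_right a1 (pow_nonneg hη.le 3)
    have a4 := mul_le_mul_of_nonneg_right a2 (abs_nonneg (rho ((k : ℤ) - j)))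
    nlinarith
  refine (Finset.sum_le_sum h1).trans ?_
  rw [Finset.sum_add_distrib, Finset.sum_add_distrib, Finset.sum_const, Finset.card_range,
    ← Finset.mul_sum, ← Finset.mul_sum, nsmul_eq_mul]
  have h2 := mul_le_mul_of_nonneg_left (M.τ_sum j hj)
    (show 0 ≤ 2 * C₀ * M.η ^ 5 by positivity)
  have h3 := mul_le_mul_of_nonneg_left (M.sum_abs_rho_le' j)
    (show 0 ≤ (2 * C₀ + 1) * M.η ^ 5 by positivity)
  have h4 : 0 ≤ (2 * C₀ ^ 2 + (2 * C₀ + 1) * rhoMass) * (M.N * M.η ^ 3 * M.b j ^ 2) := by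
    positivity
  have h5 : 0 ≤ M.η ^ 5 := by positivity
  nlinarith

/-- Summing the third-order terms over the grid. -/
lemma sum_three_le {j : ℕ} (hj : j < M.N) :
    ∑ k ∈ Finset.range M.N, ((M.b j + |M.τ j k|) ^ 3 * M.η ^ 3
        + (M.b j + |M.τ j k|) ^ 2 * |rho ((k : ℤ) - j)| * M.η ^ 4
        + (M.b j + |M.τ j k|) * |rho ((k : ℤ) - j)| * M.η ^ 5)
      ≤ (4 + 4 * C₀ ^ 3 + (4 * C₀ ^ 2 + 2 * C₀) * rhoMass)
        * (M.N * M.η ^ 3 * M.b j ^ 3 + M.η ^ 7) := by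
  have hη := M.η_pos
  have hη1 := M.η_le
  have hb := M.b_nonneg hj
  have hC := M.C₀_nonneg
  have hr := rhoMass_nonneg
  have h1 : ∀ k ∈ Finset.range M.N, (M.b j + |M.τ j k|) ^ 3 * M.η ^ 3
        + (M.b j + |M.τ j k|) ^ 2 * |rho ((k : ℤ) - j)| * M.η ^ 4
        + (M.b j + |M.τ j k|) * |rho ((k : ℤ) - j)| * M.η ^ 5
      ≤ 4 * M.b j ^ 3 * M.η ^ 3 + 4 * C₀ ^ 2 * M.η ^ 7 * |M.τ j k|
        + (4 * C₀ ^ 2 + 2 * C₀) * M.η ^ 7 * |rho ((k : ℤ) - j)| := by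
    intro k hk
    have hk' := Finset.mem_range.1 hk
    have ht := M.τ_le' hj hk'
    have hbC := M.b_le' hj
    have t0 := abs_nonneg (M.τ j k)
    have a0 : M.b j + |M.τ j k| ≤ 2 * C₀ * M.η ^ 2 := by linarith
    have a1 : (M.b j + |M.τ j k|) ^ 3 ≤ 4 * M.b j ^ 3 + 4 * (C₀ * M.η ^ 2) ^ 2 * |M.τ j k| := by
      have h3 : |M.τ j k| ^ 3 ≤ (C₀ * M.η ^ 2) ^ 2 * |M.τ j k| := by
        rw [pow_succ]
        gcongr
      have h4 : (M.b j + |M.τ j k|) ^ 3 ≤ 4 * (M.b j ^ 3 + |M.τ j k| ^ 3) := by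
        nlinarith [mul_nonneg (add_nonneg hb t0) (sq_nonneg (M.b j - |M.τ j k|))]
      linarith
    have a2 : (M.b j + |M.τ j k|) ^ 2 * M.η ^ 4 ≤ 4 * C₀ ^ 2 * M.η ^ 7 := by
      calc (M.b j + |M.τ j k|) ^ 2 * M.η ^ 4 ≤ (2 * C₀ * M.η ^ 2) ^ 2 * M.η ^ 4 := by gcongr
        _ = 4 * C₀ ^ 2 * M.η ^ 7 * M.η := by ring
        _ ≤ 4 * C₀ ^ 2 * M.η ^ 7 * 1 := by gcongr
        _ = _ := mul_one _
    have a2' : (M.b j + |M.τ j k|) * M.η ^ 5 ≤ 2 * C₀ * M.η ^ 7 := by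
      calc (M.b j + |M.τ j k|) * M.η ^ 5 ≤ (2 * C₀ * M.η ^ 2) * M.η ^ 5 := by gcongr
        _ = _ := by ring
    have a3 := mul_le_mul_of_nonneg_right a1 (pow_nonneg hη.le 3)
    have a4 := mul_le_mul_of_nonneg_right a2 (abs_nonneg (rho ((k : ℤ) - j)))
    have a5 := mul_le_mul_of_nonneg_right a2' (abs_nonneg (rho ((k : ℤ) - j)))
    nlinarith
  refine (Finset.sum_le_sum h1).trans ?_
  rw [Finset.sum_add_distrib, Finset.sum_add_distrib, Finset.sum_const, Finset.card_range,
    ← Finset.mul_sum, ← Finset.mul_sum, nsmul_eq_mul]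
  have h2 := mul_le_mul_of_nonneg_left (M.τ_sum j hj)
    (show 0 ≤ 4 * C₀ ^ 2 * M.η ^ 7 by positivity)
  have h3 := mul_le_mul_of_nonneg_left (M.sum_abs_rho_le' j)
    (show 0 ≤ (4 * C₀ ^ 2 + 2 * C₀) * M.η ^ 7 by positivity)
  have h4 : 0 ≤ (4 * C₀ ^ 3 + (4 * C₀ ^ 2 + 2 * C₀) * rhoMass)
      * (M.N * M.η ^ 3 * M.b j ^ 3) := by
    positivity
  have h5 : 0 ≤ M.η ^ 7 := by positivity
  nlinarith

lemma sum_one_le {j : ℕ} (hj : j < M.N) :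
    ∑ k ∈ Finset.range M.N, (|M.τ j k| * M.η ^ 3 + |rho ((k : ℤ) - j)| * M.η ^ 4)
      ≤ (C₀ + rhoMass) * M.η ^ 3 := by
  have hη := M.η_pos
  have hr := rhoMass_nonneg
  rw [Finset.sum_add_distrib, ← Finset.sum_mul, ← Finset.sum_mul, add_mul]
  have h : M.η ^ 4 ≤ M.η ^ 3 := pow_le_pow_of_le_one hη.le M.η_le (by norm_num)
  refine add_le_add (by gcongr; exact M.τ_sum j hj) ?_
  exact mul_le_mul (M.sum_abs_rho_le' j) h (by positivity) hr

end Model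

namespace Model

variable {C₀ : ℝ} {m : ℕ}

/-- Principal part of the third derivative of `W`. -/
def top (M : Model C₀ m) (α : Fin 4 → ℝ × ℝ → ℝ) (j : ℕ) (u : Fin 4) (x : M.E) : ℝ :=
  ∑ k ∈ Finset.range M.N, ∑ w, α w (M.mid k x) * (6 * M.e j u k w ^ 3)

lemma sum_sum_le (M : Model C₀ m) {F : ℕ → Fin 4 → ℝ} {B : ℕ → ℝ} {c : ℝ}
    (h : ∀ k < M.N, ∀ w, |F k w| ≤ c * B k) :
    |∑ k ∈ Finset.range M.N, ∑ w, F k w| ≤ 4 * c * ∑ k ∈ Finset.range M.N, B k := by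
  rw [Finset.mul_sum]
  refine (Finset.abs_sum_le_sum_abs _ _).trans (Finset.sum_le_sum fun k hk => ?_)
  refine (Finset.abs_sum_le_sum_abs _ _).trans ?_
  refine (Finset.sum_le_sum fun w _ => h k (Finset.mem_range.1 hk) w).trans ?_
  simp
  linarith

lemma herm_bounds (M : Model C₀ m) (j : ℕ) (u : Fin 4) {k : ℕ} (hk : k < M.N) (w : Fin 4)
    (x : M.E) :
    |M.herm k w x| ≤ 20 * (M.amp x ^ 3 * M.η ^ 3) ∧
    |3 * (M.ξ k w x ^ 2 - M.V w) * M.e j u k w|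
      ≤ 36 * (M.amp x ^ 3 * M.η ^ 4 * |rho ((k : ℤ) - j)|) ∧
    |6 * M.ξ k w x * M.e j u k w ^ 2|
      ≤ 48 * (M.amp x ^ 3 * M.η ^ 5 * |rho ((k : ℤ) - j)|) :=
  _root_.herm_bounds (M.abs_ξ_le hk w x) (M.V_nonneg w) (M.V_le w) (M.abs_e_le j u k w)
    (abs_nonneg _) (abs_rho_le_one _) (M.one_le_amp x) M.η_pos

/-- Crude pointwise bound for `W`. -/
lemma abs_W_le (α : Fin 4 → ℝ × ℝ → ℝ) (hα : ∀ w, CbSmooth (α w)) :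
    ∃ C, 0 ≤ C ∧ ∀ (M : Model C₀ m) (x : M.E),
      |M.W α x| ≤ C * (M.N * M.η ^ 3 * M.amp x ^ 3) := by
  obtain ⟨K, hK0, hK⟩ := exists_bound_dd α hα
  refine ⟨80 * K, by positivity, fun M x => ?_⟩
  have := M.sum_sum_le (F := fun k w => α w (M.mid k x) * M.herm k w x)
    (B := fun _ => M.amp x ^ 3 * M.η ^ 3) (c := 20 * K) fun k hk w => by
      rw [abs_mul]
      calc |α w (M.mid k x)| * |M.herm k w x| ≤ K * (20 * (M.amp x ^ 3 * M.η ^ 3)) :=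
            mul_le_mul (hK w 0 _).1 (M.herm_bounds 0 0 hk w x).1 (abs_nonneg _) hK0
        _ = _ := by ring
  refine this.trans (le_of_eq ?_)
  simp
  ring

/-- Derivatives of `W` along a Cameron-Martin vector. -/
lemma exists_jet_W (α : Fin 4 → ℝ × ℝ → ℝ) (hα : ∀ w, CbSmooth (α w)) :
    ∃ C, 0 ≤ C ∧ ∀ (M : Model C₀ m) (j : ℕ), j < M.N → ∀ u : Fin 4,
      ∃ W₁ W₂ W₃ : M.E → ℝ, Jet (M.cmv j u) (M.W α) W₁ W₂ W₃ ∧ ∀ x,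
        |W₁ x| ≤ C * (M.b j * |M.W (fun w => dd (dir u) (α w)) x| + M.η ^ 3 * M.amp x ^ 3) ∧
        |W₂ x| ≤ C * ((M.N * M.η ^ 3 * M.b j ^ 2 + M.η ^ 5) * M.amp x ^ 3) ∧
        |W₃ x - M.top α j u x| ≤ C * ((M.N * M.η ^ 3 * M.b j ^ 3 + M.η ^ 7) * M.amp x ^ 3) := by
  obtain ⟨K, hK0, hK⟩ := exists_bound_dd α hα
  have hr := rhoMass_nonneg
  set D1 : ℝ := |C₀| + rhoMass with hD1
  set D2 : ℝ := 2 + 2 * |C₀| ^ 2 + (2 * |C₀| + 1) * rhoMass with hD2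
  set D3 : ℝ := 4 + 4 * |C₀| ^ 3 + (4 * |C₀| ^ 2 + 2 * |C₀|) * rhoMass with hD3
  have p1 : 0 ≤ D1 := by positivity
  have p2 : 0 ≤ D2 := by positivity
  have p3 : 0 ≤ D3 := by positivity
  refine ⟨1 + 4 * (36 * K) * D1 + 4 * (72 * K) * D2 + 4 * (144 * K) * D3, by positivity,
    fun M j hj u => ?_⟩
  have hη := M.η_pos
  have hCa : |C₀| = C₀ := abs_of_nonneg M.C₀_nonneg
  have hb := M.b_nonneg hj
  have hjet := Jet.sum (v := M.cmv j u) (Finset.range M.N)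
    (fun k hk => Jet.sum Finset.univ fun w _ =>
      (M.jet_mid hj (Finset.mem_range.1 hk) u (hα w)).mul
        (M.jet_herm hj (Finset.mem_range.1 hk) u w))
  refine ⟨_, _, _, hjet, fun x => ?_⟩
  have hX : 0 ≤ M.amp x ^ 3 := pow_nonneg (zero_le_one.trans (M.one_le_amp x)) 3
  set X := M.amp x ^ 3 with hXdef
  refine ⟨?_, ?_, ?_⟩
  · have e1 : (∑ k ∈ Finset.range M.N, ∑ w, (M.c j k * dd (dir u) (α w) (M.mid k x)
          * M.herm k w x + α w (M.mid k x) * (3 * (M.ξ k w x ^ 2 - M.V w) * M.e j u k w)))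
        = M.γ j * M.W (fun w => dd (dir u) (α w)) x
          + ∑ k ∈ Finset.range M.N, ∑ w, (M.τ j k * dd (dir u) (α w) (M.mid k x)
          * M.herm k w x + α w (M.mid k x) * (3 * (M.ξ k w x ^ 2 - M.V w) * M.e j u k w)) := by
      rw [W, Finset.mul_sum, ← Finset.sum_add_distrib]
      refine Finset.sum_congr rfl fun k _ => ?_
      rw [Finset.mul_sum, ← Finset.sum_add_distrib]
      refine Finset.sum_congr rfl fun w _ => ?_
      rw [c]
      ring
    rw [e1]
    have h1 := M.sum_sum_le (F := fun k w => M.τ j k * dd (dir u) (α w) (M.mid k x)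
          * M.herm k w x + α w (M.mid k x) * (3 * (M.ξ k w x ^ 2 - M.V w) * M.e j u k w))
      (B := fun k => |M.τ j k| * M.η ^ 3 + |rho ((k : ℤ) - j)| * M.η ^ 4)
      (c := 36 * K * X) fun k hk w => by
        obtain ⟨b1, b2, b3⟩ := M.herm_bounds j u hk w x
        exact term_one_bound (hK w u _).1 (hK w u _).2.1 le_rfl b1 b2 hX hη
    have h2 := M.sum_one_le hj
    rw [← show D1 = C₀ + rhoMass by rw [hD1, hCa]] at h2
    have h3 : 4 * (36 * K * X) * ∑ k ∈ Finset.range M.N,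
        (|M.τ j k| * M.η ^ 3 + |rho ((k : ℤ) - j)| * M.η ^ 4)
        ≤ 4 * (36 * K * X) * (D1 * M.η ^ 3) := by gcongr
    set ω := |M.W (fun w => dd (dir u) (α w)) x| with hω
    have h4 : |M.γ j * M.W (fun w => dd (dir u) (α w)) x| ≤ M.b j * ω := by
      rw [abs_mul]
      exact mul_le_mul_of_nonneg_right (M.γ_le j hj) (abs_nonneg _)
    have hω0 : 0 ≤ ω := abs_nonneg _
    have q1 : 0 ≤ (4 * (36 * K) * D1 + 4 * (72 * K) * D2 + 4 * (144 * K) * D3)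
      * (M.b j * ω) := by positivity
    have q2 : 0 ≤ (1 + 4 * (72 * K) * D2 + 4 * (144 * K) * D3) * (M.η ^ 3 * X) := by positivity
    refine (abs_add_le _ _).trans ?_
    linarith
  · have h1 := M.sum_sum_le
      (F := fun k w => M.c j k ^ 2 * dd (dir u) (dd (dir u) (α w)) (M.mid k x) * M.herm k w x
        + 2 * (M.c j k * dd (dir u) (α w) (M.mid k x)
          * (3 * (M.ξ k w x ^ 2 - M.V w) * M.e j u k w))
        + α w (M.mid k x) * (6 * M.ξ k w x * M.e j u k w ^ 2))
      (B := fun k => (M.b j + |M.τ j k|) ^ 2 * M.η ^ 3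
        + (M.b j + |M.τ j k|) * |rho ((k : ℤ) - j)| * M.η ^ 4 + |rho ((k : ℤ) - j)| * M.η ^ 5)
      (c := 72 * K * X) fun k hk w => by
        obtain ⟨b1, b2, b3⟩ := M.herm_bounds j u hk w x
        exact term_two_bound (hK w u _).1 (hK w u _).2.1 (hK w u _).2.2.1 (M.abs_c_le hj k)
          b1 b2 b3 hX hη (abs_nonneg _)
    refine h1.trans ?_
    have h2 := M.sum_two_le hj
    rw [← show D2 = 2 + 2 * C₀ ^ 2 + (2 * C₀ + 1) * rhoMass by rw [hD2, hCa]] at h2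
    have h3 := mul_le_mul_of_nonneg_left h2 (show 0 ≤ 4 * (72 * K * X) by positivity)
    refine h3.trans ?_
    have q : 0 ≤ (1 + 4 * (36 * K) * D1 + 4 * (144 * K) * D3)
      * ((M.N * M.η ^ 3 * M.b j ^ 2 + M.η ^ 5) * X) := by positivity
    linarith
  · have e1 : (∑ k ∈ Finset.range M.N, ∑ w,
        (M.c j k ^ 3 * dd (dir u) (dd (dir u) (dd (dir u) (α w))) (M.mid k x) * M.herm k w x
        + 3 * (M.c j k ^ 2 * dd (dir u) (dd (dir u) (α w)) (M.mid k x)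
          * (3 * (M.ξ k w x ^ 2 - M.V w) * M.e j u k w))
        + 3 * (M.c j k * dd (dir u) (α w) (M.mid k x) * (6 * M.ξ k w x * M.e j u k w ^ 2))
        + α w (M.mid k x) * (6 * M.e j u k w ^ 3))) - M.top α j u x
        = ∑ k ∈ Finset.range M.N, ∑ w,
        (M.c j k ^ 3 * dd (dir u) (dd (dir u) (dd (dir u) (α w))) (M.mid k x) * M.herm k w x
        + 3 * (M.c j k ^ 2 * dd (dir u) (dd (dir u) (α w)) (M.mid k x)
          * (3 * (M.ξ k w x ^ 2 - M.V w) * M.e j u k w))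
        + 3 * (M.c j k * dd (dir u) (α w) (M.mid k x)
          * (6 * M.ξ k w x * M.e j u k w ^ 2))) := by
      rw [top, ← Finset.sum_sub_distrib]
      refine Finset.sum_congr rfl fun k _ => ?_
      rw [← Finset.sum_sub_distrib]
      exact Finset.sum_congr rfl fun w _ => by ring
    rw [e1]
    have h1 := M.sum_sum_le
      (F := fun k w => M.c j k ^ 3 * dd (dir u) (dd (dir u) (dd (dir u) (α w))) (M.mid k x)
          * M.herm k w x
        + 3 * (M.c j k ^ 2 * dd (dir u) (dd (dir u) (α w)) (M.mid k x)
          * (3 * (M.ξ k w x ^ 2 - M.V w) * M.e j u k w))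
        + 3 * (M.c j k * dd (dir u) (α w) (M.mid k x) * (6 * M.ξ k w x * M.e j u k w ^ 2)))
      (B := fun k => (M.b j + |M.τ j k|) ^ 3 * M.η ^ 3
        + (M.b j + |M.τ j k|) ^ 2 * |rho ((k : ℤ) - j)| * M.η ^ 4
        + (M.b j + |M.τ j k|) * |rho ((k : ℤ) - j)| * M.η ^ 5)
      (c := 144 * K * X) fun k hk w => by
        obtain ⟨b1, b2, b3⟩ := M.herm_bounds j u hk w x
        exact term_three_bound (hK w u _).2.1 (hK w u _).2.2.1 (hK w u _).2.2.2 (M.abs_c_le hj k)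
          b1 b2 b3 hX hη (abs_nonneg _)
    refine h1.trans ?_
    have h2 := M.sum_three_le hj
    rw [← show D3 = 4 + 4 * C₀ ^ 3 + (4 * C₀ ^ 2 + 2 * C₀) * rhoMass by rw [hD3, hCa]] at h2
    have h3 := mul_le_mul_of_nonneg_left h2 (show 0 ≤ 4 * (144 * K * X) by positivity)
    refine h3.trans ?_
    have q : 0 ≤ (1 + 4 * (36 * K) * D1 + 4 * (72 * K) * D2)
      * ((M.N * M.η ^ 3 * M.b j ^ 3 + M.η ^ 7) * X) := by positivity
    linarith

/-- Riemann sums along the midpoints. -/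
def S (M : Model C₀ m) (q : ℝ × ℝ → ℝ) (x : M.E) : ℝ :=
  M.η ^ 6 * ∑ k ∈ Finset.range M.N, q (M.mid k x)

/-- Derivatives of Riemann sums along a Cameron-Martin vector. -/
lemma exists_jet_S (q : ℝ × ℝ → ℝ) (hq : CbSmooth q) :
    ∃ C, 0 ≤ C ∧ ∀ (M : Model C₀ m), (∀ x, |M.S q x| ≤ C) ∧ ∀ (j : ℕ), j < M.N → ∀ u : Fin 4,
      ∃ S₁ S₂ S₃ : M.E → ℝ, Jet (M.cmv j u) (M.S q) S₁ S₂ S₃ ∧ ∀ x,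
        |S₁ x| ≤ C * (M.b j + M.η ^ 3) ∧
        |S₂ x| ≤ C * (M.N * M.η ^ 3 * M.b j ^ 2 + M.η ^ 5) ∧
        |S₃ x| ≤ C * (M.N * M.η ^ 3 * M.b j ^ 3 + M.η ^ 7) := by
  obtain ⟨K, hK0, hK⟩ := exists_bound_dd (fun _ : Unit => q) fun _ => hq
  have hr := rhoMass_nonneg
  set D2 : ℝ := 2 + 2 * |C₀| ^ 2 + (2 * |C₀| + 1) * rhoMass with hD2
  set D3 : ℝ := 4 + 4 * |C₀| ^ 3 + (4 * |C₀| ^ 2 + 2 * |C₀|) * rhoMass with hD3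
  have p2 : 0 ≤ D2 := by positivity
  have p3 : 0 ≤ D3 := by positivity
  refine ⟨K * |C₀| + K * D2 + K * D3, by positivity, fun M => ?_⟩
  have hη := M.η_pos
  have hη1 := M.η_le
  have hCa : |C₀| = C₀ := abs_of_nonneg M.C₀_nonneg
  have hC := M.C₀_nonneg
  have hN := M.N_mul_le
  have hsum : ∀ (F : ℕ → ℝ) (B : ℕ → ℝ), (∀ k < M.N, |F k| ≤ K * B k) →
      |M.η ^ 6 * ∑ k ∈ Finset.range M.N, F k|
        ≤ K * (M.η ^ 6 * ∑ k ∈ Finset.range M.N, B k) := by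
    intro F B h
    rw [abs_mul, abs_of_pos (pow_pos hη 6)]
    have : |∑ k ∈ Finset.range M.N, F k| ≤ K * ∑ k ∈ Finset.range M.N, B k := by
      rw [Finset.mul_sum]
      exact (Finset.abs_sum_le_sum_abs _ _).trans
        (Finset.sum_le_sum fun k hk => h k (Finset.mem_range.1 hk))
    calc M.η ^ 6 * |∑ k ∈ Finset.range M.N, F k|
        ≤ M.η ^ 6 * (K * ∑ k ∈ Finset.range M.N, B k) := by gcongr
      _ = _ := by ring
  refine ⟨fun x => ?_, fun j hj u => ?_⟩
  · have := hsum (fun k => q (M.mid k x)) (fun _ => 1) fun k _ => by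
      simpa using (hK () 0 (M.mid k x)).1
    refine this.trans ?_
    simp only [Finset.sum_const, Finset.card_range, nsmul_eq_mul, mul_one]
    rw [mul_comm (M.η ^ 6), hCa]
    have : K * (M.N * M.η ^ 6) ≤ K * C₀ := by gcongr
    have q1 : 0 ≤ K * D2 + K * D3 := by positivity
    linarith
  have hb := M.b_nonneg hj
  have hjet := (Jet.sum (v := M.cmv j u) (Finset.range M.N)
    (fun k hk => (M.jet_mid hj (Finset.mem_range.1 hk) u hq))).const_mul (M.η ^ 6)
  refine ⟨_, _, _, hjet, fun x => ⟨?_, ?_, ?_⟩⟩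
  · refine (hsum _ (fun k => M.b j + |M.τ j k|) fun k _ => ?_).trans ?_
    · rw [abs_mul, mul_comm K]
      exact mul_le_mul (M.abs_c_le hj k) (hK () u _).2.1 (abs_nonneg _) (by positivity)
    · rw [Finset.sum_add_distrib, Finset.sum_const, Finset.card_range, nsmul_eq_mul]
      have h1 := M.τ_sum j hj
      have h2 : M.η ^ 6 ≤ M.η ^ 3 := pow_le_pow_of_le_one hη.le hη1 (by norm_num)
      have h3 : M.η ^ 6 * (M.N * M.b j + ∑ k ∈ Finset.range M.N, |M.τ j k|)
          ≤ C₀ * (M.b j + M.η ^ 3) := by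
        have : M.η ^ 6 * ∑ k ∈ Finset.range M.N, |M.τ j k| ≤ M.η ^ 3 * C₀ := by gcongr
        have : M.N * M.η ^ 6 * M.b j ≤ C₀ * M.b j := by gcongr
        linarith
      have h4 := mul_le_mul_of_nonneg_left h3 hK0
      have q1 : 0 ≤ (K * D2 + K * D3) * (M.b j + M.η ^ 3) := by positivity
      rw [hCa]
      linarith
  · refine (hsum _ (fun k => (M.b j + |M.τ j k|) ^ 2) fun k _ => ?_).trans ?_
    · rw [abs_mul, abs_pow, mul_comm K]
      have := M.abs_c_le hj k
      exact mul_le_mul (by gcongr) (hK () u _).2.2.1 (abs_nonneg _) (by positivity)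
    · have h2 := M.sum_two_le hj
      rw [← show D2 = 2 + 2 * C₀ ^ 2 + (2 * C₀ + 1) * rhoMass by rw [hD2, hCa]] at h2
      have h3 : M.η ^ 6 * ∑ k ∈ Finset.range M.N, (M.b j + |M.τ j k|) ^ 2
          ≤ D2 * (M.N * M.η ^ 3 * M.b j ^ 2 + M.η ^ 5) := by
        refine le_trans ?_ h2
        rw [Finset.mul_sum]
        refine Finset.sum_le_sum fun k _ => ?_
        have h5 : M.η ^ 6 ≤ M.η ^ 3 := pow_le_pow_of_le_one hη.le hη1 (by norm_num)
        have h6 : M.η ^ 6 * (M.b j + |M.τ j k|) ^ 2 ≤ M.η ^ 3 * (M.b j + |M.τ j k|) ^ 2 := by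
          gcongr
        have h7 : 0 ≤ (M.b j + |M.τ j k|) * |rho ((k : ℤ) - j)| * M.η ^ 4
          + |rho ((k : ℤ) - j)| * M.η ^ 5 := by positivity
        linarith
      have h4 := mul_le_mul_of_nonneg_left h3 hK0
      have q1 : 0 ≤ (K * |C₀| + K * D3) * (M.N * M.η ^ 3 * M.b j ^ 2 + M.η ^ 5) := by positivity
      linarith
  · refine (hsum _ (fun k => (M.b j + |M.τ j k|) ^ 3) fun k _ => ?_).trans ?_
    · rw [abs_mul, abs_pow, mul_comm K]
      have := M.abs_c_le hj k
      exact mul_le_mul (by gcongr) (hK () u _).2.2.2 (abs_nonneg _) (by positivity)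
    · have h2 := M.sum_three_le hj
      rw [← show D3 = 4 + 4 * C₀ ^ 3 + (4 * C₀ ^ 2 + 2 * C₀) * rhoMass by rw [hD3, hCa]] at h2
      have h3 : M.η ^ 6 * ∑ k ∈ Finset.range M.N, (M.b j + |M.τ j k|) ^ 3
          ≤ D3 * (M.N * M.η ^ 3 * M.b j ^ 3 + M.η ^ 7) := by
        refine le_trans ?_ h2
        rw [Finset.mul_sum]
        refine Finset.sum_le_sum fun k _ => ?_
        have h5 : M.η ^ 6 ≤ M.η ^ 3 := pow_le_pow_of_le_one hη.le hη1 (by norm_num)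
        have h6 : M.η ^ 6 * (M.b j + |M.τ j k|) ^ 3 ≤ M.η ^ 3 * (M.b j + |M.τ j k|) ^ 3 := by
          gcongr
        have h7 : 0 ≤ (M.b j + |M.τ j k|) ^ 2 * |rho ((k : ℤ) - j)| * M.η ^ 4
          + (M.b j + |M.τ j k|) * |rho ((k : ℤ) - j)| * M.η ^ 5 := by positivity
        linarith
      have h4 := mul_le_mul_of_nonneg_left h3 hK0
      have q1 : 0 ≤ (K * |C₀| + K * D2) * (M.N * M.η ^ 3 * M.b j ^ 3 + M.η ^ 7) := by positivity
      linarith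

/-- Derivatives of the weights along a Cameron-Martin vector. -/
lemma exists_jet_weight (α : Fin 4 → ℝ × ℝ → ℝ) (hα : ∀ w, CbSmooth (α w))
    (ψ : (Fin m → ℝ × ℝ) → ℝ) (hψ : CbSmooth ψ) :
    ∃ C, 0 ≤ C ∧ ∀ (M : Model C₀ m) (j : ℕ), j < M.N → ∀ u : Fin 4,
      ∃ A₁ A₂ A₃ : M.E → ℝ,
        Jet (M.cmv j u) (fun x => α u (M.mid j x) * ψ (M.loc x)) A₁ A₂ A₃ ∧ ∀ x,
        |α u (M.mid j x) * ψ (M.loc x)| ≤ C ∧ |A₁ x| ≤ C * M.b j ∧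
        |A₂ x| ≤ C * M.b j ^ 2 ∧ |A₃ x| ≤ C * M.b j ^ 3 := by
  obtain ⟨K, hK0, hK⟩ := exists_bound_dd α hα
  obtain ⟨L0, p0, l0⟩ := dd_iterate_bound hψ 0
  obtain ⟨L1, p1, l1⟩ := dd_iterate_bound hψ 1
  obtain ⟨L2, p2, l2⟩ := dd_iterate_bound hψ 2
  obtain ⟨L3, p3, l3⟩ := dd_iterate_bound hψ 3
  set L := L0 + L1 + L2 + L3 with hL
  have hL0 : 0 ≤ L := by positivity
  refine ⟨8 * (K * L), by positivity, fun M j hj u => ?_⟩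
  have hb := M.b_nonneg hj
  have hloc : ‖M.loc (M.cmv j u)‖ ≤ M.b j := by
    simpa [norm_dir, cmv] using M.loc_vec j hj (dir u)
  have hc : |M.c j j| ≤ M.b j := by
    have := M.abs_c_le hj j
    rwa [M.τ_self j hj, abs_zero, add_zero] at this
  refine ⟨_, _, _, (M.jet_mid hj hj u (hα u)).mul (Jet.comp_clm hψ M.loc), fun x => ?_⟩
  obtain ⟨k0, k1, k2, k3⟩ := hK u u (M.mid j x)
  set β := M.b j with hβ
  have c1 : |M.c j j * dd (dir u) (α u) (M.mid j x)| ≤ β * K := by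
    rw [abs_mul]; gcongr
  have c2 : |M.c j j ^ 2 * dd (dir u) (dd (dir u) (α u)) (M.mid j x)| ≤ β ^ 2 * K := by
    rw [abs_mul, abs_pow]; gcongr
  have c3 : |M.c j j ^ 3 * dd (dir u) (dd (dir u) (dd (dir u) (α u))) (M.mid j x)|
      ≤ β ^ 3 * K := by
    rw [abs_mul, abs_pow]; gcongr
  have g0 : |ψ (M.loc x)| ≤ L := by
    have := l0 (M.loc (M.cmv j u)) (M.loc x)
    simp only [Function.iterate_zero, id, pow_zero, mul_one] at this
    linarith
  have g1 : |dd (M.loc (M.cmv j u)) ψ (M.loc x)| ≤ L * β := by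
    have := l1 (M.loc (M.cmv j u)) (M.loc x)
    simp only [Function.iterate_one, pow_one] at this
    refine this.trans ?_
    gcongr
    linarith
  have g2 : |dd (M.loc (M.cmv j u)) (dd (M.loc (M.cmv j u)) ψ) (M.loc x)| ≤ L * β ^ 2 := by
    refine (l2 (M.loc (M.cmv j u)) (M.loc x)).trans ?_
    gcongr
    linarith
  have g3 : |dd (M.loc (M.cmv j u)) (dd (M.loc (M.cmv j u)) (dd (M.loc (M.cmv j u)) ψ))
      (M.loc x)| ≤ L * β ^ 3 := by
    refine (l3 (M.loc (M.cmv j u)) (M.loc x)).trans ?_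
    gcongr
    linarith
  have hKL : 0 ≤ K * L := by positivity
  generalize M.c j j * dd (dir u) (α u) (M.mid j x) = a1 at *
  generalize M.c j j ^ 2 * dd (dir u) (dd (dir u) (α u)) (M.mid j x) = a2 at *
  generalize M.c j j ^ 3 * dd (dir u) (dd (dir u) (dd (dir u) (α u))) (M.mid j x) = a3 at *
  generalize dd (M.loc (M.cmv j u)) (dd (M.loc (M.cmv j u)) (dd (M.loc (M.cmv j u)) ψ))
    (M.loc x) = s3 at *
  generalize dd (M.loc (M.cmv j u)) (dd (M.loc (M.cmv j u)) ψ) (M.loc x) = s2 at *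
  generalize dd (M.loc (M.cmv j u)) ψ (M.loc x) = s1 at *
  generalize ψ (M.loc x) = s0 at *
  generalize α u (M.mid j x) = a0 at *
  have h3 : |(3 : ℝ)| = 3 := abs_of_pos (by norm_num)
  refine ⟨?_, ?_, ?_, ?_⟩
  · rw [abs_mul]
    calc |a0| * |s0| ≤ K * L := by gcongr
      _ ≤ _ := by linarith
  · calc |a1 * s0 + a0 * s1| ≤ |a1 * s0| + |a0 * s1| := abs_add_le _ _
      _ = |a1| * |s0| + |a0| * |s1| := by simp only [abs_mul]
      _ ≤ (β * K) * L + K * (L * β) := by gcongr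
      _ = 2 * (K * L) * β := by ring
      _ ≤ _ := by gcongr; norm_num
  · calc |a2 * s0 + 2 * (a1 * s1) + a0 * s2| ≤ |a2 * s0| + |2 * (a1 * s1)| + |a0 * s2| :=
          abs_add_three _ _ _
      _ = |a2| * |s0| + 2 * (|a1| * |s1|) + |a0| * |s2| := by simp only [abs_mul, abs_two]
      _ ≤ (β ^ 2 * K) * L + 2 * ((β * K) * (L * β)) + K * (L * β ^ 2) := by gcongr
      _ = 4 * (K * L) * β ^ 2 := by ring
      _ ≤ _ := by gcongr; norm_num
  · calc |a3 * s0 + 3 * (a2 * s1) + 3 * (a1 * s2) + a0 * s3|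
        ≤ |a3 * s0 + 3 * (a2 * s1) + 3 * (a1 * s2)| + |a0 * s3| := abs_add_le _ _
      _ ≤ |a3 * s0| + |3 * (a2 * s1)| + |3 * (a1 * s2)| + |a0 * s3| :=
          add_le_add_left (abs_add_three _ _ _) _
      _ = |a3| * |s0| + 3 * (|a2| * |s1|) + 3 * (|a1| * |s2|) + |a0| * |s3| := by
          simp only [abs_mul, h3]
      _ ≤ (β ^ 3 * K) * L + 3 * ((β ^ 2 * K) * (L * β)) + 3 * ((β * K) * (L * β ^ 2))
          + K * (L * β ^ 3) := by gcongr
      _ = 8 * (K * L) * β ^ 3 := by ring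

end Model

lemma CbSmooth.const {E : Type*} [NormedAddCommGroup E] [NormedSpace ℝ E] (c : ℝ) :
    CbSmooth (fun _ : E => c) := by
  refine ⟨fun n => contDiff_const, fun k => ?_⟩
  cases k with
  | zero => exact ⟨|c|, fun x => by simp⟩
  | succ k => exact ⟨0, fun x => by simp [iteratedFDeriv_succ_const]⟩

lemma norm_pow_le_sum {ι F : Type*} [Fintype ι] [SeminormedAddCommGroup F] (f : ι → F) {p : ℕ}
    (hp : p ≠ 0) : ‖f‖ ^ p ≤ ∑ i, ‖f i‖ ^ p := by
  rcases isEmpty_or_nonempty ι with h | h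
  · simp [Subsingleton.elim f 0, hp]
  · obtain ⟨i, -, hi⟩ := Finset.exists_mem_eq_sup Finset.univ Finset.univ_nonempty
      fun b => ‖f b‖₊
    have : ‖f‖ = ‖f i‖ := by rw [Pi.norm_def, hi, coe_nnnorm]
    rw [this]
    exact Finset.single_le_sum (f := fun i => ‖f i‖ ^ p) (fun i _ => by positivity)
      (Finset.mem_univ i)

lemma pow_le_inv_add {y θ : ℝ} (hy : 1 ≤ y) (hθ : 0 < θ) (p l : ℕ) :
    y ^ p ≤ θ⁻¹ + θ ^ l * y ^ (p * (l + 1)) := by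
  have hz : 0 < y ^ p := by positivity
  rw [pow_mul]
  set z := y ^ p
  rcases le_or_gt z θ⁻¹ with h | h
  · have : 0 ≤ θ ^ l * z ^ (l + 1) := by positivity
    linarith
  · have h1 : 1 ≤ θ * z := by
      have := mul_le_mul_of_nonneg_left h.le hθ.le
      rwa [mul_inv_cancel₀ hθ.ne'] at this
    have h2 : 1 ≤ (θ * z) ^ l := one_le_pow₀ h1
    have h3 : z * 1 ≤ z * (θ * z) ^ l := by gcongr
    have h4 : θ ^ l * z ^ (l + 1) = z * (θ * z) ^ l := by ring
    have h5 : 0 < θ⁻¹ := by positivity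
    linarith

namespace Model

variable {C₀ : ℝ} {m : ℕ}

lemma integral_xi_pow_succ (M : Model C₀ m) {k : ℕ} (hk : k < M.N) (w : Fin 4) (r : ℕ) :
    ∫ x, M.ξ k w x ^ (2 * (r + 1)) ∂M.μ
      = (2 * r + 1) * M.V w * ∫ x, M.ξ k w x ^ (2 * r) ∂M.μ := by
  have h := stein M.μ M.cent (M.isCMVector hk w) (by rw [M.ξ_cmv_self hk]; exact M.V_pos w)
    (F := fun x => M.ξ k w x ^ (2 * r + 1))
    (F' := fun x => (2 * r + 1) * M.V w * M.ξ k w x ^ (2 * r))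
    ((Adm.clm _).pow _) ((Adm.const _).mul ((Adm.clm _).pow _)) fun x => by
      have h1 := ((hasDerivAt_id (0 : ℝ)).mul_const (M.V w)).const_add (M.ξ k w x)
      have h2 := h1.pow (2 * r + 1)
      refine (h2.congr_of_eventuallyEq (Eventually.of_forall fun s => ?_)).congr_deriv ?_
      · simp [M.ξ_cmv_self hk]
      · simp
        ring
  rw [← integral_const_mul, ← h]
  refine integral_congr_ae (Eventually.of_forall fun x => ?_)
  simp only [smul_eq_mul]
  ring

lemma exists_integral_xi_pow (C₀ : ℝ) (m r : ℕ) :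
    ∃ D, 0 ≤ D ∧ ∀ (M : Model C₀ m) (k : ℕ), k < M.N → ∀ w,
      ∫ x, M.ξ k w x ^ (2 * r) ∂M.μ ≤ D * M.η ^ (2 * r) := by
  induction r with
  | zero => exact ⟨1, zero_le_one, fun M k _ w => by simp⟩
  | succ r ih =>
    obtain ⟨D, hD, h⟩ := ih
    refine ⟨(2 * r + 1) * 2 * D, by positivity, fun M k hk w => ?_⟩
    rw [M.integral_xi_pow_succ hk]
    have hV := M.V_le w
    have hV0 := M.V_nonneg w
    have hη := M.η_pos
    calc (2 * r + 1) * M.V w * ∫ x, M.ξ k w x ^ (2 * r) ∂M.μ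
        ≤ (2 * r + 1) * (2 * M.η ^ 2) * (D * M.η ^ (2 * r)) := by
          have := h M k hk w
          have : 0 ≤ ∫ x, M.ξ k w x ^ (2 * r) ∂M.μ :=
            integral_nonneg fun x => (even_two_mul r).pow_nonneg _
          gcongr
      _ = _ := by ring

lemma norm_incr_pow_le (M : Model C₀ m) (k : ℕ) (x : M.E) (r : ℕ) :
    ‖M.incr k x‖ ^ (2 * r) ≤ M.ξ k 0 x ^ (2 * r) + M.ξ k 1 x ^ (2 * r) := by
  have h0 : M.ξ k 0 x = (M.incr k x).1 := by simp [ξ, dotL_apply, dir]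
  have h1 : M.ξ k 1 x = (M.incr k x).2 := by simp [ξ, dotL_apply, dir]
  rw [h0, h1, Prod.norm_def]
  have e1 : 0 ≤ (M.incr k x).1 ^ (2 * r) := (even_two_mul r).pow_nonneg _
  have e2 : 0 ≤ (M.incr k x).2 ^ (2 * r) := (even_two_mul r).pow_nonneg _
  rcases max_cases ‖(M.incr k x).1‖ ‖(M.incr k x).2‖ with h | h
  · rw [h.1, Real.norm_eq_abs, (even_two_mul r).pow_abs]
    linarith
  · rw [h.1, Real.norm_eq_abs, (even_two_mul r).pow_abs]
    linarith

lemma exists_integral_amp_even (C₀ : ℝ) (m r : ℕ) (hr : r ≠ 0) :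
    ∃ D, 0 ≤ D ∧ ∀ (M : Model C₀ m), ∫ x, M.amp x ^ (2 * r) ∂M.μ ≤ D * (1 + M.N) := by
  obtain ⟨D, hD, h⟩ := exists_integral_xi_pow C₀ m r
  refine ⟨2 ^ (2 * r) * (1 + 2 * D), by positivity, fun M => ?_⟩
  have hη := M.η_pos
  set ε := M.η ^ (2 * r) with hε
  have hε0 : 0 < ε := pow_pos hη _
  have hp : ∀ x, M.amp x ^ (2 * r) ≤ 2 ^ (2 * r) * (1 + ε⁻¹ * ∑ k : Fin M.N,
      (M.ξ k 0 x ^ (2 * r) + M.ξ k 1 x ^ (2 * r))) := by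
    intro x
    have h1 : 0 ≤ ‖fun k : Fin M.N => M.incr k x‖ / M.η := div_nonneg (norm_nonneg _) hη.le
    have h2 : (‖fun k : Fin M.N => M.incr k x‖ / M.η) ^ (2 * r) ≤ ε⁻¹ * ∑ k : Fin M.N,
      (M.ξ k 0 x ^ (2 * r) + M.ξ k 1 x ^ (2 * r)) := by
      rw [div_pow, div_eq_inv_mul]
      gcongr
      refine (norm_pow_le_sum _ (by omega)).trans (Finset.sum_le_sum fun k _ => ?_)
      exact M.norm_incr_pow_le k x r
    calc M.amp x ^ (2 * r) ≤ 2 ^ (2 * r - 1) * (1 ^ (2 * r)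
          + (‖fun k : Fin M.N => M.incr k x‖ / M.η) ^ (2 * r)) :=
          add_pow_le zero_le_one h1 _
      _ ≤ 2 ^ (2 * r) * (1 + ε⁻¹ * ∑ k : Fin M.N,
        (M.ξ k 0 x ^ (2 * r) + M.ξ k 1 x ^ (2 * r))) := by
          rw [one_pow]
          gcongr
          · norm_num
          · omega
  have hadm : ∀ w, ∀ k : Fin M.N, Adm (fun x => M.ξ k w x ^ (2 * r)) :=
    fun w k => (Adm.clm _).pow _
  have hI : Integrable (fun x => ∑ k : Fin M.N,
      (M.ξ k 0 x ^ (2 * r) + M.ξ k 1 x ^ (2 * r))) M.μ :=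
    (Adm.sum fun k _ => (hadm 0 k).add (hadm 1 k)).integrable _
  calc ∫ x, M.amp x ^ (2 * r) ∂M.μ
      ≤ ∫ x, 2 ^ (2 * r) * (1 + ε⁻¹ * ∑ k : Fin M.N,
        (M.ξ k 0 x ^ (2 * r) + M.ξ k 1 x ^ (2 * r))) ∂M.μ :=
        integral_mono ((M.adm_amp.pow _).integrable _)
          (((integrable_const _).add (hI.const_mul _)).const_mul _) hp
    _ = 2 ^ (2 * r) * (1 + ε⁻¹ * ∑ k : Fin M.N,
        (∫ x, M.ξ k 0 x ^ (2 * r) ∂M.μ + ∫ x, M.ξ k 1 x ^ (2 * r) ∂M.μ)) := by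
        rw [integral_const_mul, integral_add (integrable_const _) (hI.const_mul _),
          integral_const_mul, integral_finsetSum _ fun k _ =>
            ((hadm 0 k).add (hadm 1 k)).integrable _]
        simp only [integral_const, probReal_univ, one_smul]
        congr 3
        refine Finset.sum_congr rfl fun k _ => ?_
        exact integral_add ((hadm 0 k).integrable _) ((hadm 1 k).integrable _)
    _ ≤ 2 ^ (2 * r) * (1 + ε⁻¹ * ∑ k : Fin M.N, (D * ε + D * ε)) := by
        gcongr with k
        · exact h M k k.2 0
        · exact h M k k.2 1
    _ = 2 ^ (2 * r) * (1 + 2 * D * M.N) := by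
        simp only [Finset.sum_const, Finset.card_univ, Fintype.card_fin, nsmul_eq_mul]
        field_simp
        ring
    _ ≤ 2 ^ (2 * r) * (1 + 2 * D) * (1 + M.N) := by
        have : (0 : ℝ) ≤ M.N := Nat.cast_nonneg _
        have h1 : 1 + 2 * D * M.N ≤ (1 + 2 * D) * (1 + M.N) := by nlinarith [mul_nonneg hD this]
        have h2 := mul_le_mul_of_nonneg_left h1 (show (0 : ℝ) ≤ 2 ^ (2 * r) by positivity)
        linarith

/-- All moments of the amplitude grow at most like `θ⁻¹`. -/
lemma exists_integral_amp (C₀ : ℝ) (m p : ℕ) (hp : p ≠ 0) :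
    ∃ D, 0 ≤ D ∧ ∀ (M : Model C₀ m), ∫ x, M.amp x ^ p ∂M.μ ≤ D * M.θ⁻¹ := by
  obtain ⟨D, hD, h⟩ := exists_integral_amp_even C₀ m (24 * p) (by omega)
  refine ⟨1 + D * (1 + |C₀|), by positivity, fun M => ?_⟩
  have hθ := M.θ_pos
  have hθ1 := M.θ_le
  have hN : M.N * M.θ ^ 48 ≤ |C₀| := by
    have := M.N_le
    rw [← pow_mul] at this
    exact this.trans (le_abs_self _)
  have hi : 1 ≤ M.θ⁻¹ := (one_le_inv₀ hθ).2 hθ1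
  calc ∫ x, M.amp x ^ p ∂M.μ ≤ ∫ x, (M.θ⁻¹ + M.θ ^ 47 * M.amp x ^ (2 * (24 * p))) ∂M.μ := by
        refine integral_mono ((M.adm_amp.pow _).integrable _)
          ((integrable_const _).add (((M.adm_amp.pow _).integrable _).const_mul _)) fun x => ?_
        have := pow_le_inv_add (M.one_le_amp x) hθ p 47
        rwa [show p * (47 + 1) = 2 * (24 * p) by ring] at this
    _ = M.θ⁻¹ + M.θ ^ 47 * ∫ x, M.amp x ^ (2 * (24 * p)) ∂M.μ := by
        rw [integral_add (integrable_const _) (((M.adm_amp.pow _).integrable _).const_mul _),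
          integral_const_mul]
        simp
    _ ≤ M.θ⁻¹ + M.θ ^ 47 * (D * (1 + M.N)) := by gcongr; exact h M
    _ = M.θ⁻¹ + D * (M.θ ^ 48 + M.N * M.θ ^ 48) * M.θ⁻¹ := by field_simp
    _ ≤ M.θ⁻¹ + D * (1 + |C₀|) * M.θ⁻¹ := by
        gcongr
        exact pow_le_one₀ hθ.le hθ1
    _ = _ := by ring

end Model

namespace Model

variable {C₀ : ℝ} {m : ℕ} (M : Model C₀ m)

lemma N_mul_b_sq_le {j : ℕ} (hj : j < M.N) :
    M.N * M.η ^ 3 * M.b j ^ 2 + M.η ^ 5 ≤ (C₀ ^ 3 + 1) * M.η := by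
  have hη := M.η_pos
  have hη1 := M.η_le
  have hb := M.b_nonneg hj
  have hC := M.C₀_nonneg
  have h1 : M.N * M.η ^ 3 * M.b j ^ 2 ≤ M.N * M.η ^ 3 * (C₀ * M.η ^ 2) ^ 2 := by
    have := M.b_le' hj
    gcongr
  have h2 : M.N * M.η ^ 3 * (C₀ * M.η ^ 2) ^ 2 = (M.N * M.η ^ 6) * (C₀ ^ 2 * M.η) := by ring
  have h3 : (M.N * M.η ^ 6) * (C₀ ^ 2 * M.η) ≤ C₀ * (C₀ ^ 2 * M.η) := by
    have := M.N_mul_le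
    gcongr
  have h4 : M.η ^ 5 ≤ M.η := pow_le_of_le_one hη.le hη1 (by norm_num)
  linarith

lemma N_mul_b_cube_le {j : ℕ} (hj : j < M.N) :
    M.N * M.η ^ 3 * M.b j ^ 3 + M.η ^ 7 ≤ (C₀ ^ 3 + 1) * (M.η * (M.b j + M.η ^ 6)) := by
  have hη := M.η_pos
  have hb := M.b_nonneg hj
  have hC := M.C₀_nonneg
  have h1 := mul_le_mul_of_nonneg_right (M.N_mul_b_sq_le hj) hb
  have h2 : 0 ≤ C₀ ^ 3 * (M.η * M.η ^ 6) := by positivity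
  have h3 : 0 ≤ M.η ^ 5 * M.b j := by positivity
  linarith

lemma sum_b_add_le : ∑ j ∈ Finset.range M.N, (M.b j + M.η ^ 6) ≤ 2 * C₀ := by
  rw [Finset.sum_add_distrib]
  have := M.b_sum
  have := M.N_mul_le
  simp only [Finset.sum_const, Finset.card_range, nsmul_eq_mul]
  linarith

lemma abs_e_cube_le (j : ℕ) (u : Fin 4) (k : ℕ) (w : Fin 4) :
    |6 * M.e j u k w ^ 3| ≤ 48 * M.η ^ 6 * |rho ((k : ℤ) - j)| := by
  have h := M.abs_e_le j u k w
  have h1 := abs_rho_le_one ((k : ℤ) - j)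
  have hη := M.η_pos
  rw [abs_mul, abs_pow, abs_of_pos (show (0 : ℝ) < 6 by norm_num)]
  set R := |rho ((k : ℤ) - j)|
  have hR : 0 ≤ R := abs_nonneg _
  calc 6 * |M.e j u k w| ^ 3 ≤ 6 * (2 * R * M.η ^ 2) ^ 3 := by gcongr
    _ = 48 * M.η ^ 6 * (R ^ 3) := by ring
    _ ≤ 48 * M.η ^ 6 * R := by
      gcongr
      exact pow_le_of_le_one hR h1 (by norm_num)

lemma abs_top_le {α : Fin 4 → ℝ × ℝ → ℝ} {K : ℝ} (hK : ∀ w z, |α w z| ≤ K) (j : ℕ) (u : Fin 4)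
    (x : M.E) : |M.top α j u x| ≤ 192 * K * rhoMass * M.η ^ 6 := by
  have hK0 : 0 ≤ K := (abs_nonneg _).trans (hK 0 0)
  have h := M.sum_sum_le (F := fun k w => α w (M.mid k x) * (6 * M.e j u k w ^ 3))
    (B := fun k => |rho ((k : ℤ) - j)|) (c := 48 * K * M.η ^ 6) fun k _ w => by
      rw [abs_mul]
      calc |α w (M.mid k x)| * |6 * M.e j u k w ^ 3|
          ≤ K * (48 * M.η ^ 6 * |rho ((k : ℤ) - j)|) :=
            mul_le_mul (hK _ _) (M.abs_e_cube_le j u k w) (abs_nonneg _) hK0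
        _ = _ := by ring
  refine h.trans ?_
  have hη := M.η_pos
  have := M.sum_abs_rho_le' j
  calc 4 * (48 * K * M.η ^ 6) * ∑ k ∈ Finset.range M.N, |rho ((k : ℤ) - j)|
      ≤ 4 * (48 * K * M.η ^ 6) * rhoMass := by gcongr
    _ = _ := by ring

end Model

lemma square_error {C D b η N y A₀ A₁ A₂ A₃ W₀ W₁ W₂ T : ℝ} {W₃ : ℝ}
    (hC : 0 ≤ C) (hD : 0 ≤ D) (hb : 0 ≤ b) (hη : 0 < η) (hη1 : η ≤ 1) (hy : 1 ≤ y)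
    (hbη : b ≤ D * η ^ 2)
    (h2 : N * η ^ 3 * b ^ 2 + η ^ 5 ≤ D * η)
    (h3 : N * η ^ 3 * b ^ 3 + η ^ 7 ≤ D * (η * (b + η ^ 6)))
    (a0 : |A₀| ≤ C) (a1 : |A₁| ≤ C * b) (a2 : |A₂| ≤ C * b ^ 2) (a3 : |A₃| ≤ C * b ^ 3)
    (w0 : |W₀| ≤ C * (N * η ^ 3 * y ^ 3))
    (w1 : |W₁| ≤ C * (b * (C * (N * η ^ 3 * y ^ 3)) + η ^ 3 * y ^ 3))
    (w2 : |W₂| ≤ C * ((N * η ^ 3 * b ^ 2 + η ^ 5) * y ^ 3))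
    (w3 : |W₃ - T| ≤ C * ((N * η ^ 3 * b ^ 3 + η ^ 7) * y ^ 3)) :
    |A₃ * W₀ + 3 * (A₂ * W₁) + 3 * (A₁ * W₂) + A₀ * W₃|
      ≤ C * |T| + C ^ 2 * D * (8 + 3 * C) * ((b + η ^ 6) * (η * y ^ 3)) := by
  have hy0 : 0 ≤ y ^ 3 := by positivity
  have e : A₃ * W₀ + 3 * (A₂ * W₁) + 3 * (A₁ * W₂) + A₀ * W₃
    = A₀ * T + (A₃ * W₀ + 3 * (A₂ * W₁) + 3 * (A₁ * W₂) + A₀ * (W₃ - T)) := by ring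
  have t3 : |(3 : ℝ)| = 3 := abs_of_pos (by norm_num)
  have g3 : N * η ^ 3 * b ^ 3 ≤ D * (η * (b + η ^ 6)) := by
    have : 0 ≤ η ^ 7 := by positivity
    linarith
  have g1 : b ^ 2 * η ^ 3 ≤ D * (η * (b + η ^ 6)) := by
    have h : b ^ 2 * η ^ 3 ≤ b * (D * η ^ 2) * η ^ 3 := by
      have : b ^ 2 = b * b := sq b
      rw [this]
      gcongr
    have h' : b * (D * η ^ 2) * η ^ 3 = D * (η * b) * η ^ 4 := by ring
    have h'' : D * (η * b) * η ^ 4 ≤ D * (η * b) * 1 := by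
      gcongr
      exact pow_le_one₀ hη.le hη1
    have : 0 ≤ D * (η * η ^ 6) := by positivity
    linarith
  have g2 : b * (N * η ^ 3 * b ^ 2 + η ^ 5) ≤ D * (η * (b + η ^ 6)) := by
    have h : b * (N * η ^ 3 * b ^ 2 + η ^ 5) ≤ b * (D * η) := by gcongr
    have : 0 ≤ D * (η * η ^ 6) := by positivity
    linarith
  set Z := D * (η * (b + η ^ 6)) with hZ
  have hZ0 : 0 ≤ Z := by positivity
  rw [e]
  calc |A₀ * T + (A₃ * W₀ + 3 * (A₂ * W₁) + 3 * (A₁ * W₂) + A₀ * (W₃ - T))|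
      ≤ |A₀ * T| + |A₃ * W₀ + 3 * (A₂ * W₁) + 3 * (A₁ * W₂) + A₀ * (W₃ - T)| := abs_add_le _ _
    _ ≤ |A₀ * T| + (|A₃ * W₀ + 3 * (A₂ * W₁) + 3 * (A₁ * W₂)| + |A₀ * (W₃ - T)|) := by
        gcongr; exact abs_add_le _ _
    _ ≤ |A₀ * T| + ((|A₃ * W₀| + |3 * (A₂ * W₁)| + |3 * (A₁ * W₂)|) + |A₀ * (W₃ - T)|) := by
        gcongr; exact abs_add_three _ _ _
    _ = |A₀| * |T| + ((|A₃| * |W₀| + 3 * (|A₂| * |W₁|) + 3 * (|A₁| * |W₂|)) + |A₀| * |W₃ - T|) := by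
        simp only [abs_mul, t3]
    _ ≤ C * |T| + ((C * b ^ 3 * (C * (N * η ^ 3 * y ^ 3))
        + 3 * (C * b ^ 2 * (C * (b * (C * (N * η ^ 3 * y ^ 3)) + η ^ 3 * y ^ 3)))
        + 3 * (C * b * (C * ((N * η ^ 3 * b ^ 2 + η ^ 5) * y ^ 3))))
        + C * (C * ((N * η ^ 3 * b ^ 3 + η ^ 7) * y ^ 3))) := by gcongr
    _ = C * |T| + C ^ 2 * y ^ 3 * ((1 + 3 * C) * (N * η ^ 3 * b ^ 3) + 3 * (b ^ 2 * η ^ 3)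
        + 3 * (b * (N * η ^ 3 * b ^ 2 + η ^ 5)) + (N * η ^ 3 * b ^ 3 + η ^ 7)) := by ring
    _ ≤ C * |T| + C ^ 2 * y ^ 3 * ((1 + 3 * C) * Z + 3 * Z + 3 * Z + Z) := by gcongr
    _ = _ := by rw [hZ]; ring

namespace Model

variable {C₀ : ℝ} {m : ℕ}

lemma abs_W_dd_le {α : Fin 4 → ℝ × ℝ → ℝ} (hα : ∀ w, CbSmooth (α w)) :
    ∃ C, 0 ≤ C ∧ ∀ (M : Model C₀ m) (u : Fin 4) (x : M.E),
      |M.W (fun w => dd (dir u) (α w)) x| ≤ C * (M.N * M.η ^ 3 * M.amp x ^ 3) := by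
  choose C hC h using fun u : Fin 4 => abs_W_le (C₀ := C₀) (m := m)
    (fun w => dd (dir u) (α w)) fun w => (hα w).dd _
  refine ⟨∑ u, C u, Finset.sum_nonneg fun u _ => hC u, fun M u x => (h u M x).trans ?_⟩
  have h1 : C u ≤ ∑ u, C u := Finset.single_le_sum (fun u _ => hC u) (Finset.mem_univ u)
  have := M.η_pos
  have := zero_le_one.trans (M.one_le_amp x)
  gcongr

lemma η_mul_inv_θ (M : Model C₀ m) : M.η * M.θ⁻¹ = M.θ ^ 7 := by
  have := M.θ_pos
  rw [η]
  field_simp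

lemma η_mul_inv_θ_le (M : Model C₀ m) : M.η * M.θ⁻¹ ≤ 1 := by
  rw [M.η_mul_inv_θ]
  exact pow_le_one₀ M.θ_pos.le M.θ_le

/-- Uniform second moment bound for weighted sums of third Hermite polynomials. -/
lemma exists_integral_W_sq (C₀ : ℝ) (m : ℕ) {α : Fin 4 → ℝ × ℝ → ℝ} (hα : ∀ w, CbSmooth (α w)) :
    ∃ D, 0 ≤ D ∧ ∀ M : Model C₀ m, ∫ x, M.W α x ^ 2 ∂M.μ ≤ D := by
  obtain ⟨C1, p1, h1⟩ := exists_jet_W (C₀ := C₀) (m := m) α hα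
  obtain ⟨C2, p2, h2⟩ := exists_jet_weight (C₀ := C₀) (m := m) α hα (fun _ => 1)
    (CbSmooth.const 1)
  obtain ⟨C3, p3, h3⟩ := abs_W_le (C₀ := C₀) (m := m) α hα
  obtain ⟨C4, p4, h4⟩ := abs_W_dd_le (C₀ := C₀) (m := m) hα
  obtain ⟨K, pK, hK⟩ := exists_bound_dd α hα
  obtain ⟨D0, pD0, hD0⟩ := exists_integral_amp C₀ m 3 (by norm_num)
  have hr := rhoMass_nonneg
  set C := C1 + C2 + C3 + C4 with hC
  set D := |C₀| ^ 3 + 1 + |C₀| with hD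
  have pC : 0 ≤ C := by positivity
  have pD : 0 ≤ D := by positivity
  set T := 192 * K * rhoMass with hT
  set Z := C ^ 2 * D * (8 + 3 * C) with hZ
  have pT : 0 ≤ T := by positivity
  have pZ : 0 ≤ Z := by positivity
  refine ⟨4 * (C * T * |C₀| + Z * (2 * |C₀|) * D0), by positivity, fun M => ?_⟩
  have hη := M.η_pos
  have hC₀ := M.C₀_nonneg
  have hpt : ∀ j < M.N, ∀ u : Fin 4, ∫ x, M.herm j u x • (α u (M.mid j x) * 1 * M.W α x) ∂M.μ
      ≤ C * (T * M.η ^ 6) + Z * ((M.b j + M.η ^ 6) * D0) := by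
    intro j hj u
    obtain ⟨A₁, A₂, A₃, jA, hA⟩ := h2 M j hj u
    obtain ⟨W₁, W₂, W₃, jW, hW⟩ := h1 M j hj u
    have jF := jA.mul jW
    rw [M.integral_herm_smul hj u jF]
    have hb := M.b_nonneg hj
    have hy : Integrable (fun x => M.amp x ^ 3) M.μ := (M.adm_amp.pow 3).integrable _
    refine (integral_mono (jF.a3.integrable _) (g := fun x => C * (T * M.η ^ 6)
      + Z * ((M.b j + M.η ^ 6) * (M.η * M.amp x ^ 3)))
      ((integrable_const _).add (((hy.const_mul _).const_mul _).const_mul _)) fun x => ?_).trans ?_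
    · have y1 := M.one_le_amp x
      have y3 : 0 ≤ M.amp x ^ 3 := by positivity
      obtain ⟨q0, q1, q2, q3⟩ := hA x
      obtain ⟨r1, r2, r3⟩ := hW x
      have hDC : C₀ ^ 3 + 1 ≤ D := by
        have := le_abs_self C₀
        have : C₀ ^ 3 ≤ |C₀| ^ 3 := by gcongr
        have := abs_nonneg C₀
        linarith
      have hDC' : C₀ ≤ D := by
        have := le_abs_self C₀
        have : 0 ≤ |C₀| ^ 3 := by positivity
        linarith
      have l1 : C1 ≤ C := by linarith
      have l2 : C2 ≤ C := by linarith
      have l3 : C3 ≤ C := by linarith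
      have l4 : C4 ≤ C := by linarith
      refine (le_abs_self _).trans ((square_error (T := M.top α j u x) (D := D) (b := M.b j)
        (η := M.η) (N := M.N) (y := M.amp x) pC pD hb hη M.η_le y1
        ((M.b_le' hj).trans (by gcongr)) ((M.N_mul_b_sq_le hj).trans (by gcongr))
        ((M.N_mul_b_cube_le hj).trans (by gcongr)) (q0.trans l2) (q1.trans (by gcongr))
        (q2.trans (by gcongr)) (q3.trans (by gcongr)) ((h3 M x).trans (by gcongr))
        (r1.trans ?_) (r2.trans (by gcongr)) (r3.trans (by gcongr))).trans ?_)
      · have := (h4 M u x).trans (mul_le_mul_of_nonneg_right l4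
          (show 0 ≤ M.N * M.η ^ 3 * M.amp x ^ 3 by positivity))
        gcongr
      · have := M.abs_top_le (α := α) (K := K) (fun w z => (hK w 0 z).1) j u x
        beta_reduce
        gcongr
    · rw [integral_add (integrable_const _) (((hy.const_mul _).const_mul _).const_mul _),
        integral_const_mul Z, integral_const_mul (M.b j + M.η ^ 6), integral_const_mul M.η]
      simp only [integral_const, probReal_univ, one_smul]
      have q : M.η * ∫ x, M.amp x ^ 3 ∂M.μ ≤ D0 := by
        calc M.η * ∫ x, M.amp x ^ 3 ∂M.μ ≤ M.η * (D0 * M.θ⁻¹) := by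
              gcongr
              exact hD0 M
          _ = D0 * (M.η * M.θ⁻¹) := by ring
          _ ≤ D0 * 1 := by
              gcongr
              exact M.η_mul_inv_θ_le
          _ = D0 := mul_one _
      gcongr
  have hadm : ∀ j u, Integrable (fun x => M.herm j u x • (α u (M.mid j x) * 1 * M.W α x)) M.μ :=
    fun j u => ((M.adm_herm j u).smul ((((hα u).adm_comp _).mul (Adm.const 1)).mul
      (M.adm_W hα))).integrable _
  have e1 : ∫ x, M.W α x ^ 2 ∂M.μ = ∑ j ∈ Finset.range M.N, ∑ u,
      ∫ x, M.herm j u x • (α u (M.mid j x) * 1 * M.W α x) ∂M.μ := by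
    simp_rw [← integral_finsetSum Finset.univ fun u _ => hadm _ u]
    rw [← integral_finsetSum _ fun j _ => integrable_finsetSum _ fun u _ => hadm j u]
    refine integral_congr_ae (Eventually.of_forall fun x => ?_)
    simp only
    rw [sq]
    conv_lhs => enter [1]; rw [W]
    rw [Finset.sum_mul]
    refine Finset.sum_congr rfl fun j _ => ?_
    rw [Finset.sum_mul]
    refine Finset.sum_congr rfl fun u _ => ?_
    rw [smul_eq_mul]
    ring
  rw [e1]
  calc ∑ j ∈ Finset.range M.N, ∑ u,
      ∫ x, M.herm j u x • (α u (M.mid j x) * 1 * M.W α x) ∂M.μ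
      ≤ ∑ j ∈ Finset.range M.N, ∑ _u : Fin 4,
        (C * (T * M.η ^ 6) + Z * ((M.b j + M.η ^ 6) * D0)) :=
        Finset.sum_le_sum fun j hj => Finset.sum_le_sum fun u _ =>
          hpt j (Finset.mem_range.1 hj) u
    _ = 4 * (C * T * (M.N * M.η ^ 6)
        + Z * (∑ j ∈ Finset.range M.N, (M.b j + M.η ^ 6)) * D0) := by
        simp only [Finset.sum_const, Finset.card_univ, Fintype.card_fin, nsmul_eq_mul,
          Finset.sum_add_distrib, ← Finset.mul_sum, ← Finset.sum_mul, Finset.card_range]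
        push_cast
        ring
    _ ≤ _ := by
        have := M.sum_b_add_le
        have := M.N_mul_le
        have := le_abs_self C₀
        gcongr <;> linarith

/-- Third absolute moments of weighted sums of third Hermite polynomials, up to scaling. -/
lemma exists_integral_W_cube (C₀ : ℝ) (m : ℕ) {α : Fin 4 → ℝ × ℝ → ℝ}
    (hα : ∀ w, CbSmooth (α w)) :
    ∃ D, 0 ≤ D ∧ ∀ M : Model C₀ m, M.η ^ 4 * ∫ x, |M.W α x| ^ 3 ∂M.μ ≤ D * M.θ ^ 7 := by
  obtain ⟨D2, p2, h2⟩ := exists_integral_W_sq C₀ m hα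
  obtain ⟨C, pC, hC⟩ := abs_W_le (C₀ := C₀) (m := m) α hα
  obtain ⟨D1, p1, h1⟩ := exists_integral_amp C₀ m 153 (by norm_num)
  refine ⟨C * |C₀| * (D2 + C ^ 2 * |C₀| ^ 2 * D1), by positivity, fun M => ?_⟩
  have hη := M.η_pos
  have hθ := M.θ_pos
  have hC₀ := M.C₀_nonneg
  have hN := M.N_mul_le
  have hpt : ∀ x, M.η ^ 4 * |M.W α x| ^ 3 ≤ C * C₀ * M.η * (M.θ⁻¹ * M.W α x ^ 2
      + C ^ 2 * C₀ ^ 2 * M.amp x ^ 153) := by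
    intro x
    have y1 := M.one_le_amp x
    have hW := hC M x
    have hW2 : M.W α x ^ 2 = |M.W α x| ^ 2 := (sq_abs _).symm
    rw [hW2]
    set w := |M.W α x|
    have hw : 0 ≤ w := abs_nonneg _
    set y := M.amp x
    have s1 : M.η ^ 4 * w ≤ C * C₀ * M.η * y ^ 3 := by
      calc M.η ^ 4 * w ≤ M.η ^ 4 * (C * (M.N * M.η ^ 3 * y ^ 3)) := by gcongr
        _ = C * (M.N * M.η ^ 6) * M.η * y ^ 3 := by ring
        _ ≤ _ := by gcongr
    have s2 : M.θ ^ 48 * w ^ 2 ≤ C ^ 2 * C₀ ^ 2 * y ^ 6 := by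
      calc M.θ ^ 48 * w ^ 2 ≤ M.θ ^ 48 * (C * (M.N * M.η ^ 3 * y ^ 3)) ^ 2 := by gcongr
        _ = C ^ 2 * (M.N * M.η ^ 6) ^ 2 * y ^ 6 := by rw [η]; ring
        _ ≤ _ := by gcongr
    have s3 := pow_le_inv_add y1 hθ 3 48
    calc M.η ^ 4 * w ^ 3 = (M.η ^ 4 * w) * w ^ 2 := by ring
      _ ≤ (C * C₀ * M.η * y ^ 3) * w ^ 2 := by gcongr
      _ = C * C₀ * M.η * (y ^ 3 * w ^ 2) := by ring
      _ ≤ C * C₀ * M.η * ((M.θ⁻¹ + M.θ ^ 48 * y ^ (3 * (48 + 1))) * w ^ 2) := by gcongr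
      _ = C * C₀ * M.η * (M.θ⁻¹ * w ^ 2 + (M.θ ^ 48 * w ^ 2) * y ^ 147) := by ring
      _ ≤ C * C₀ * M.η * (M.θ⁻¹ * w ^ 2 + (C ^ 2 * C₀ ^ 2 * y ^ 6) * y ^ 147) := by gcongr
      _ = _ := by ring
  have i1 : Integrable (fun x => M.W α x ^ 2) M.μ := ((M.adm_W hα).pow 2).integrable _
  have i2 : Integrable (fun x => M.amp x ^ 153) M.μ := (M.adm_amp.pow 153).integrable _
  have i3 : Integrable (fun x => |M.W α x| ^ 3) M.μ := ((M.adm_W hα).norm.pow 3).integrable _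
  rw [← integral_const_mul]
  refine (integral_mono (i3.const_mul _) (g := fun x => C * C₀ * M.η * (M.θ⁻¹ * M.W α x ^ 2
      + C ^ 2 * C₀ ^ 2 * M.amp x ^ 153))
    (((i1.const_mul _).add (i2.const_mul _)).const_mul _) hpt).trans ?_
  rw [integral_const_mul, integral_add (i1.const_mul _) (i2.const_mul _), integral_const_mul,
    integral_const_mul]
  have := h1 M
  have := h2 M
  calc C * C₀ * M.η * (M.θ⁻¹ * ∫ x, M.W α x ^ 2 ∂M.μ + C ^ 2 * C₀ ^ 2 * ∫ x, M.amp x ^ 153 ∂M.μ)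
      ≤ C * C₀ * M.η * (M.θ⁻¹ * D2 + C ^ 2 * C₀ ^ 2 * (D1 * M.θ⁻¹)) := by gcongr
    _ = C * C₀ * (D2 + C ^ 2 * C₀ ^ 2 * D1) * (M.η * M.θ⁻¹) := by ring
    _ ≤ _ := by
      rw [M.η_mul_inv_θ]
      have := le_abs_self C₀
      gcongr

end Model

lemma interpolation_terms {D b η p y ω : ℝ} (hD : 0 ≤ D) (hb : 0 ≤ b) (hη : 0 < η) (hη1 : η ≤ 1)
    (hy : 1 ≤ y) (hω : 1 ≤ ω) (hbη : b ≤ D * η ^ 2) (hp1 : p ≤ D * η)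
    (hp2 : η ^ 3 * p ≤ D * (η * (b + η ^ 6))) :
    let G := (b + η ^ 6) * (η * y ^ 9 + η * ω ^ 2 + η ^ 4 * ω ^ 3)
    let β := b * ω + η ^ 3 * y ^ 3
    b ^ 3 ≤ D ^ 2 * G ∧ b ^ 2 * β ≤ (D ^ 2 + D) * G ∧ b * (p * y ^ 3) ≤ D * G ∧
    b * β ^ 2 ≤ (2 * D ^ 2 + 2) * G ∧ β * (p * y ^ 3) ≤ 2 * D * G ∧
    β ^ 3 ≤ (4 * D ^ 2 + 4) * G ∧ η * (b + η ^ 6) * y ^ 3 ≤ G := by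
  intro G β
  have hy0 : 0 ≤ y := by linarith
  have hω0 : 0 ≤ ω := by linarith
  have y39 : y ^ 3 ≤ y ^ 9 := pow_le_pow_right₀ hy (by norm_num)
  have y69 : y ^ 6 ≤ y ^ 9 := pow_le_pow_right₀ hy (by norm_num)
  have y9 : 1 ≤ y ^ 9 := one_le_pow₀ hy
  have ω12 : ω ≤ ω ^ 2 := by simpa using pow_le_pow_right₀ hω (show 1 ≤ 2 by norm_num)
  have e41 : η ^ 4 ≤ η := pow_le_of_le_one hη.le hη1 (by norm_num)
  have e51 : η ^ 5 ≤ η := pow_le_of_le_one hη.le hη1 (by norm_num)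
  have e61 : η ^ 6 ≤ η := pow_le_of_le_one hη.le hη1 (by norm_num)
  have e32 : η ^ 3 ≤ 1 := pow_le_one₀ hη.le hη1
  set u1 := b * (η * y ^ 9) with hu1
  set u2 := b * (η * ω ^ 2) with hu2
  set u3 := b * (η ^ 4 * ω ^ 3) with hu3
  set v1 := η ^ 6 * (η * y ^ 9) with hv1
  set v2 := η ^ 6 * (η * ω ^ 2 + η ^ 4 * ω ^ 3) with hv2
  have pu1 : 0 ≤ u1 := by positivity
  have pu2 : 0 ≤ u2 := by positivity
  have pu3 : 0 ≤ u3 := by positivity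
  have pv1 : 0 ≤ v1 := by positivity
  have pv2 : 0 ≤ v2 := by positivity
  have hG : G = u1 + u2 + u3 + v1 + v2 := by
    simp only [G, hu1, hu2, hu3, hv1, hv2]
    ring
  have b2 : b ^ 2 ≤ D ^ 2 * η ^ 4 := by
    calc b ^ 2 ≤ (D * η ^ 2) ^ 2 := by gcongr
      _ = _ := by ring
  have hG0 : 0 ≤ G := by rw [hG]; positivity
  have le1 : u1 ≤ G := by linarith
  have le2 : u2 ≤ G := by linarith
  have le3 : u3 ≤ G := by linarith
  have le4 : u1 + v1 ≤ G := by linarith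
  have le5 : u2 + (u1 + v1) ≤ G := by linarith
  have le6 : u3 + v1 ≤ G := by linarith
  refine ⟨?_, ?_, ?_, ?_, ?_, ?_, ?_⟩
  · calc b ^ 3 = b * b ^ 2 := by ring
      _ ≤ b * (D ^ 2 * η ^ 4) := by gcongr
      _ ≤ b * (D ^ 2 * (η * y ^ 9)) := by
        gcongr
        nlinarith
      _ = D ^ 2 * u1 := by ring
      _ ≤ _ := by gcongr
  · have s1 : b ^ 3 * ω ≤ D ^ 2 * u2 := by
      calc b ^ 3 * ω = b * b ^ 2 * ω := by ring
        _ ≤ b * (D ^ 2 * η ^ 4) * ω ^ 2 := by gcongr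
        _ ≤ b * (D ^ 2 * η) * ω ^ 2 := by gcongr
        _ = _ := by ring
    have s2 : b ^ 2 * (η ^ 3 * y ^ 3) ≤ D * u1 := by
      calc b ^ 2 * (η ^ 3 * y ^ 3) = b * b * (η ^ 3 * y ^ 3) := by ring
        _ ≤ b * (D * η ^ 2) * (η ^ 3 * y ^ 9) := by gcongr
        _ = b * D * η ^ 5 * y ^ 9 := by ring
        _ ≤ b * D * η * y ^ 9 := by gcongr
        _ = _ := by ring
    calc b ^ 2 * β = b ^ 3 * ω + b ^ 2 * (η ^ 3 * y ^ 3) := by ring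
      _ ≤ D ^ 2 * u2 + D * u1 := add_le_add s1 s2
      _ ≤ D ^ 2 * G + D * G := by gcongr
      _ = _ := by ring
  · calc b * (p * y ^ 3) ≤ b * (D * η * y ^ 9) := by gcongr
      _ = D * u1 := by ring
      _ ≤ _ := by gcongr
  · have s0 : β ^ 2 ≤ 2 * (b ^ 2 * ω ^ 2 + η ^ 6 * y ^ 6) := by
      simp only [β]
      nlinarith [sq_nonneg (b * ω - η ^ 3 * y ^ 3)]
    calc b * β ^ 2 ≤ b * (2 * (b ^ 2 * ω ^ 2 + η ^ 6 * y ^ 6)) := by gcongr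
      _ ≤ b * (2 * (D ^ 2 * η ^ 4 * ω ^ 2 + η ^ 6 * y ^ 9)) := by gcongr
      _ ≤ b * (2 * (D ^ 2 * η * ω ^ 2 + η * y ^ 9)) := by gcongr
      _ = 2 * D ^ 2 * u2 + 2 * u1 := by ring
      _ ≤ 2 * D ^ 2 * G + 2 * G := by gcongr
      _ = _ := by ring
  · have s0 : ω * y ^ 3 ≤ ω ^ 2 + y ^ 6 := by
      nlinarith [sq_nonneg (ω - y ^ 3), sq_nonneg (ω + y ^ 3)]
    have s1 : b * ω * (p * y ^ 3) ≤ D * (u2 + u1) := by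
      calc b * ω * (p * y ^ 3) = b * p * (ω * y ^ 3) := by ring
        _ ≤ b * (D * η) * (ω ^ 2 + y ^ 9) := by
          gcongr
          linarith
        _ = _ := by ring
    have s2 : η ^ 3 * y ^ 3 * (p * y ^ 3) ≤ D * (u1 + v1) := by
      calc η ^ 3 * y ^ 3 * (p * y ^ 3) = η ^ 3 * p * y ^ 6 := by ring
        _ ≤ D * (η * (b + η ^ 6)) * y ^ 9 := by gcongr
        _ = _ := by ring
    calc β * (p * y ^ 3) = b * ω * (p * y ^ 3) + η ^ 3 * y ^ 3 * (p * y ^ 3) := by ring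
      _ ≤ D * (u2 + u1) + D * (u1 + v1) := add_le_add s1 s2
      _ ≤ D * G + D * G := by
        gcongr
        linarith
      _ = _ := by ring
  · have hβ0 : 0 ≤ b * ω := by positivity
    have hβ1 : 0 ≤ η ^ 3 * y ^ 3 := by positivity
    have s0 : β ^ 3 ≤ 4 * ((b * ω) ^ 3 + (η ^ 3 * y ^ 3) ^ 3) := by
      have := add_pow_le hβ0 hβ1 3
      norm_num at this
      exact this
    have s1 : (b * ω) ^ 3 ≤ D ^ 2 * u3 := by
      calc (b * ω) ^ 3 = b * b ^ 2 * ω ^ 3 := by ring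
        _ ≤ b * (D ^ 2 * η ^ 4) * ω ^ 3 := by gcongr
        _ = _ := by ring
    have s2 : (η ^ 3 * y ^ 3) ^ 3 ≤ v1 := by
      calc (η ^ 3 * y ^ 3) ^ 3 = η ^ 9 * y ^ 9 := by ring
        _ ≤ η ^ 7 * y ^ 9 := by
          have := pow_le_pow_of_le_one hη.le hη1 (show 7 ≤ 9 by norm_num)
          gcongr
        _ = _ := by ring
    calc β ^ 3 ≤ 4 * ((b * ω) ^ 3 + (η ^ 3 * y ^ 3) ^ 3) := s0
      _ ≤ 4 * (D ^ 2 * u3 + v1) := by gcongr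
      _ ≤ 4 * (D ^ 2 * G + G) := by
        gcongr
        linarith
      _ = _ := by ring
  · calc η * (b + η ^ 6) * y ^ 3 ≤ η * (b + η ^ 6) * y ^ 9 := by gcongr
      _ = u1 + v1 := by ring
      _ ≤ G := le4

/-- Error made when only the principal part of the third derivative of `A * exp B` is kept. -/
lemma interpolation_error {C D K b η p y ω : ℝ} {A₀ A₁ A₂ A₃ B₁ B₂ B₃ T E : ℂ}
    (hC : 0 ≤ C) (hD : 0 ≤ D) (hb : 0 ≤ b) (hη : 0 < η) (hη1 : η ≤ 1)
    (hy : 1 ≤ y) (hω : 1 ≤ ω) (hbη : b ≤ D * η ^ 2) (hp1 : p ≤ D * η)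
    (hp2 : η ^ 3 * p ≤ D * (η * (b + η ^ 6)))
    (a0 : ‖A₀‖ ≤ C) (a1 : ‖A₁‖ ≤ C * b) (a2 : ‖A₂‖ ≤ C * b ^ 2) (a3 : ‖A₃‖ ≤ C * b ^ 3)
    (b1 : ‖B₁‖ ≤ C * (b * ω + η ^ 3 * y ^ 3)) (b2 : ‖B₂‖ ≤ C * (p * y ^ 3))
    (b3 : ‖B₃ - T‖ ≤ C * (η * (b + η ^ 6) * y ^ 3)) (hE : ‖E‖ ≤ K) :
    ‖A₃ * E + 3 * (A₂ * (B₁ * E)) + 3 * (A₁ * ((B₂ + B₁ ^ 2) * E))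
      + A₀ * ((B₃ + 3 * (B₁ * B₂) + B₁ ^ 3) * E) - A₀ * T * E‖
      ≤ K * (C * D ^ 2 + 3 * C ^ 2 * (D ^ 2 + D) + 3 * C ^ 2 * D + 3 * C ^ 3 * (2 * D ^ 2 + 2)
        + C ^ 2 + 6 * C ^ 3 * D + C ^ 4 * (4 * D ^ 2 + 4))
        * ((b + η ^ 6) * (η * y ^ 9 + η * ω ^ 2 + η ^ 4 * ω ^ 3)) := by
  obtain ⟨t1, t2, t3, t4, t5, t6, t7⟩ :=
    interpolation_terms hD hb hη hη1 hy hω hbη hp1 hp2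
  have hK : 0 ≤ K := (norm_nonneg _).trans hE
  set G := (b + η ^ 6) * (η * y ^ 9 + η * ω ^ 2 + η ^ 4 * ω ^ 3)
  set β := b * ω + η ^ 3 * y ^ 3
  have e : A₃ * E + 3 * (A₂ * (B₁ * E)) + 3 * (A₁ * ((B₂ + B₁ ^ 2) * E))
      + A₀ * ((B₃ + 3 * (B₁ * B₂) + B₁ ^ 3) * E) - A₀ * T * E
      = (A₃ + 3 * (A₂ * B₁) + 3 * (A₁ * B₂) + 3 * (A₁ * B₁ ^ 2) + A₀ * (B₃ - T)
        + 3 * (A₀ * (B₁ * B₂)) + A₀ * B₁ ^ 3) * E := by ring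
  have hn : ‖A₃ + 3 * (A₂ * B₁) + 3 * (A₁ * B₂) + 3 * (A₁ * B₁ ^ 2) + A₀ * (B₃ - T)
        + 3 * (A₀ * (B₁ * B₂)) + A₀ * B₁ ^ 3‖
      ≤ ‖A₃‖ + 3 * (‖A₂‖ * ‖B₁‖) + 3 * (‖A₁‖ * ‖B₂‖) + 3 * (‖A₁‖ * ‖B₁‖ ^ 2)
        + ‖A₀‖ * ‖B₃ - T‖ + 3 * (‖A₀‖ * (‖B₁‖ * ‖B₂‖)) + ‖A₀‖ * ‖B₁‖ ^ 3 := by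
    refine norm_add_le_of_le (norm_add_le_of_le (norm_add_le_of_le (norm_add_le_of_le
      (norm_add_le_of_le (norm_add_le_of_le le_rfl ?_) ?_) ?_) ?_) ?_) ?_ <;> simp
  rw [e, norm_mul, mul_comm, mul_assoc]
  refine mul_le_mul hE (hn.trans ?_) (norm_nonneg _) hK
  have hCb : 0 ≤ C * b := by positivity
  calc ‖A₃‖ + 3 * (‖A₂‖ * ‖B₁‖) + 3 * (‖A₁‖ * ‖B₂‖) + 3 * (‖A₁‖ * ‖B₁‖ ^ 2)
        + ‖A₀‖ * ‖B₃ - T‖ + 3 * (‖A₀‖ * (‖B₁‖ * ‖B₂‖)) + ‖A₀‖ * ‖B₁‖ ^ 3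
      ≤ C * b ^ 3 + 3 * (C * b ^ 2 * (C * β)) + 3 * (C * b * (C * (p * y ^ 3)))
        + 3 * (C * b * (C * β) ^ 2) + C * (C * (η * (b + η ^ 6) * y ^ 3))
        + 3 * (C * (C * β * (C * (p * y ^ 3)))) + C * (C * β) ^ 3 := by gcongr
    _ = C * b ^ 3 + 3 * C ^ 2 * (b ^ 2 * β) + 3 * C ^ 2 * (b * (p * y ^ 3))
        + 3 * C ^ 3 * (b * β ^ 2) + C ^ 2 * (η * (b + η ^ 6) * y ^ 3)
        + 3 * C ^ 3 * (β * (p * y ^ 3)) + C ^ 4 * β ^ 3 := by ring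
    _ ≤ C * (D ^ 2 * G) + 3 * C ^ 2 * ((D ^ 2 + D) * G) + 3 * C ^ 2 * (D * G)
        + 3 * C ^ 3 * ((2 * D ^ 2 + 2) * G) + C ^ 2 * G
        + 3 * C ^ 3 * (2 * D * G) + C ^ 4 * ((4 * D ^ 2 + 4) * G) := by gcongr
    _ = _ := by ring

section Quadratic

/-- Truncation error of the series `∑ ρ³`. -/
lemma abs_sum_rho_cube_sub_le (N j : ℕ) :
    |∑ k ∈ Finset.range N, rho ((k : ℤ) - j) ^ 3 - kappa|
      ≤ ∑' r : ℤ, if 0 ≤ r + j ∧ r + j < N then 0 else |rho r| ^ 3 := by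
  have hs : Summable fun r : ℤ => rho r ^ 3 :=
    Summable.of_norm (by simpa [norm_pow] using summable_abs_rho_cube)
  have e1 : ∑ k ∈ Finset.range N, rho ((k : ℤ) - j) ^ 3
      = ∑' r : ℤ, if 0 ≤ r + j ∧ r + j < N then rho r ^ 3 else 0 := by
    rw [tsum_eq_sum (s := (Finset.range N).image fun k : ℕ => (k : ℤ) - j)]
    · rw [Finset.sum_image fun a _ b _ hab => by simpa using hab]
      refine Finset.sum_congr rfl fun k hk => ?_
      have := Finset.mem_range.1 hk
      rw [if_pos (by omega)]
    · intro r hr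
      rw [if_neg]
      rintro ⟨h1, h2⟩
      refine hr (Finset.mem_image.2 ⟨(r + j).toNat, Finset.mem_range.2 (by omega), ?_⟩)
      omega
  have hs1 : Summable fun r : ℤ => if 0 ≤ r + j ∧ r + j < N then rho r ^ 3 else 0 := by
    refine Summable.of_norm_bounded summable_abs_rho_cube fun r => ?_
    split_ifs
    · simp [norm_pow]
    · simp
  rw [e1, kappa, ← hs1.tsum_sub hs, ← Real.norm_eq_abs]
  refine tsum_of_norm_bounded (Summable.hasSum ?_) fun r => ?_
  · refine Summable.of_norm_bounded summable_abs_rho_cube fun r => ?_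
    split_ifs <;> simp
  · split_ifs <;> simp

lemma sum_abs_sum_rho_cube_sub_le (N : ℕ) :
    ∑ j ∈ Finset.range N, |∑ k ∈ Finset.range N, rho ((k : ℤ) - j) ^ 3 - kappa| ≤ rhoMass := by
  refine (Finset.sum_le_sum fun j _ => abs_sum_rho_cube_sub_le N j).trans ?_
  have hs : ∀ j : ℕ, Summable fun r : ℤ =>
      if 0 ≤ r + j ∧ r + j < N then 0 else |rho r| ^ 3 := fun j => by
    refine Summable.of_norm_bounded summable_abs_rho_cube fun r => ?_
    split_ifs <;> simp
  rw [← Summable.tsum_finsetSum fun j _ => hs j]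
  refine Summable.tsum_le_tsum (fun r => ?_) (summable_sum fun j _ => hs j) summable_abs_rho
  refine le_trans ?_ (abs_mul_rho_cube_le r)
  have : ∀ j : ℕ, (if 0 ≤ r + j ∧ r + j < N then 0 else |rho r| ^ 3)
      = if ¬ (0 ≤ r + j ∧ r + j < N) then |rho r| ^ 3 else 0 := fun j => by
    split_ifs <;> simp_all
  simp_rw [this]
  rw [← Finset.sum_filter, Finset.sum_const, nsmul_eq_mul]
  gcongr
  have hc : ((Finset.range N).filter fun j : ℕ => ¬ (0 ≤ r + j ∧ r + j < N)).card ≤ r.natAbs := by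
    rcases le_total 0 r with h | h
    · refine (Finset.card_le_card (t := Finset.Ico (N - r.natAbs) N) fun j hj => ?_).trans
        (by simp only [Nat.card_Ico]; omega)
      simp only [Finset.mem_filter, Finset.mem_range, Finset.mem_Ico] at hj ⊢
      omega
    · refine (Finset.card_le_card (t := Finset.range r.natAbs) fun j hj => ?_).trans (by simp)
      simp only [Finset.mem_filter, Finset.mem_range] at hj ⊢
      omega
  calc _ ≤ ((r.natAbs : ℕ) : ℝ) := by exact_mod_cast hc
    _ = _ := by rw [Nat.cast_natAbs]; simp

/-- The bilinear weight in the limiting variance. -/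
def crossWeight (α : Fin 4 → ℝ × ℝ → ℝ) (y z : ℝ × ℝ) : ℝ :=
  6 * ∑ u, ∑ w, dotL (dir w) (dir u) ^ 3 * (α u y * α w z)

lemma CbSmooth.crossWeight {α : Fin 4 → ℝ × ℝ → ℝ} (hα : ∀ w, CbSmooth (α w)) :
    CbSmooth fun z => kappa * crossWeight α z z :=
  ((CbSmooth.sum fun u _ => CbSmooth.sum fun w _ =>
    ((hα u).mul (hα w)).const_mul _).const_mul _).const_mul _

lemma exists_crossWeight_bound {α : Fin 4 → ℝ × ℝ → ℝ} (hα : ∀ w, CbSmooth (α w)) :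
    ∃ K, 0 ≤ K ∧ (∀ y z, |crossWeight α y z| ≤ K) ∧
      ∀ y z z', |crossWeight α y z - crossWeight α y z'| ≤ K * ‖z - z'‖ := by
  choose K hK0 hK using fun w => (hα w).bound
  choose L hL0 hL using fun w => (hα w).lipschitz
  set K' := ∑ w, K w
  set L' := ∑ w, L w
  have hK' : ∀ w z, |α w z| ≤ K' := fun w z =>
    (hK w z).trans (Finset.single_le_sum (fun w _ => hK0 w) (Finset.mem_univ w))
  have hL' : ∀ w y z, |α w y - α w z| ≤ L' * ‖y - z‖ := fun w y z =>
    (hL w y z).trans (by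
      gcongr
      exact Finset.single_le_sum (fun w _ => hL0 w) (Finset.mem_univ w))
  have pK : 0 ≤ K' := Finset.sum_nonneg fun w _ => hK0 w
  have pL : 0 ≤ L' := Finset.sum_nonneg fun w _ => hL0 w
  have hg : ∀ u w, |dotL (dir w) (dir u) ^ 3| ≤ 8 := fun u w => by
    rw [abs_pow]
    calc _ ≤ (2 : ℝ) ^ 3 := by
          gcongr
          exact abs_dotL_dir_dir_le w u
      _ = 8 := by norm_num
  have hsum : ∀ (F : Fin 4 → Fin 4 → ℝ) (B : ℝ), (∀ u w, |F u w| ≤ B) →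
      |6 * ∑ u, ∑ w, F u w| ≤ 96 * B := by
    intro F B h
    rw [abs_mul]
    have : |∑ u, ∑ w, F u w| ≤ ∑ _u : Fin 4, ∑ _w : Fin 4, B :=
      (Finset.abs_sum_le_sum_abs _ _).trans (Finset.sum_le_sum fun u _ =>
        (Finset.abs_sum_le_sum_abs _ _).trans (Finset.sum_le_sum fun w _ => h u w))
    simp at this
    rw [abs_of_pos (by norm_num : (0 : ℝ) < 6)]
    linarith
  refine ⟨96 * (8 * (K' * K')) + 96 * (8 * (K' * L')), by positivity, fun y z => ?_,
    fun y z z' => ?_⟩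
  · have : |crossWeight α y z| ≤ 96 * (8 * (K' * K')) := hsum _ _ fun u w => by
      rw [abs_mul, abs_mul]
      gcongr
      exacts [hg u w, hK' u y, hK' w z]
    have : 0 ≤ 96 * (8 * (K' * L')) := by positivity
    linarith
  · have e : crossWeight α y z - crossWeight α y z'
        = 6 * ∑ u, ∑ w, dotL (dir w) (dir u) ^ 3 * (α u y * (α w z - α w z')) := by
      simp only [crossWeight, mul_sub, Finset.sum_sub_distrib]
    rw [e]
    refine (hsum _ (8 * (K' * (L' * ‖z - z'‖))) fun u w => ?_).trans ?_
    · rw [abs_mul, abs_mul]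
      gcongr
      exacts [hg u w, hK' u y, hL' w z z']
    · have : 0 ≤ 96 * (8 * (K' * K')) * ‖z - z'‖ := by positivity
      linarith

namespace Model

variable {C₀ : ℝ} {m : ℕ} (M : Model C₀ m)

lemma norm_mid_sub_le_aux (x : M.E) (j r : ℕ) (h : j + r < M.N) :
    ‖M.mid (j + r) x - M.mid j x‖ ≤ r * (M.amp x * M.η) := by
  induction r with
  | zero => simp
  | succ r ih =>
    have h1 := ih (by omega)
    have e : M.mid (j + (r + 1)) x - M.mid j x
        = (1 / 2 : ℝ) • (M.incr (j + (r + 1)) x + M.incr (j + r) x)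
          + (M.mid (j + r) x - M.mid j x) := by
      simp only [mid, incr, ← add_assoc, smul_apply,
        add_apply, sub_apply]
      module
    rw [e]
    refine (norm_add_le _ _).trans ?_
    rw [norm_smul]
    have h2 := norm_add_le (M.incr (j + (r + 1)) x) (M.incr (j + r) x)
    have h3 := M.norm_incr_le h x
    have h4 := M.norm_incr_le (k := j + r) (by omega) x
    rw [Real.norm_of_nonneg (by norm_num)]
    push_cast
    linarith

lemma norm_mid_sub_le (x : M.E) {j k : ℕ} (hj : j < M.N) (hk : k < M.N) :
    ‖M.mid j x - M.mid k x‖ ≤ |((k : ℤ) - j : ℤ)| * (M.amp x * M.η) := by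
  rcases le_total j k with h | h
  · obtain ⟨r, rfl⟩ := Nat.exists_eq_add_of_le h
    rw [norm_sub_rev]
    simpa using M.norm_mid_sub_le_aux x j r hk
  · obtain ⟨r, rfl⟩ := Nat.exists_eq_add_of_le h
    simpa using M.norm_mid_sub_le_aux x k r hj

/-- The quadratic form produced by the leading terms of the integration by parts. -/
def Q (α : Fin 4 → ℝ × ℝ → ℝ) (x : M.E) : ℝ :=
  ∑ j ∈ Finset.range M.N, ∑ u, α u (M.mid j x) * M.top α j u x

/-- The limiting conditional variance on the grid. -/
def sigma (α : Fin 4 → ℝ × ℝ → ℝ) (x : M.E) : ℝ :=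
  M.S (fun z => kappa * crossWeight α z z) x

lemma Q_eq (α : Fin 4 → ℝ × ℝ → ℝ) (x : M.E) :
    M.Q α x = M.η ^ 6 * ∑ j ∈ Finset.range M.N, ∑ k ∈ Finset.range M.N,
      rho ((k : ℤ) - j) ^ 3 * crossWeight α (M.mid j x) (M.mid k x) := by
  simp only [Q, top, crossWeight, Finset.mul_sum, e]
  refine Finset.sum_congr rfl fun j _ => ?_
  rw [Finset.sum_comm]
  refine Finset.sum_congr rfl fun k _ => Finset.sum_congr rfl fun u _ =>
    Finset.sum_congr rfl fun w _ => ?_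
  ring

lemma Q_sub_sigma_eq (α : Fin 4 → ℝ × ℝ → ℝ) (x : M.E) :
    M.Q α x - M.sigma α x = M.η ^ 6 * ∑ j ∈ Finset.range M.N,
      (∑ k ∈ Finset.range M.N, rho ((k : ℤ) - j) ^ 3 *
        (crossWeight α (M.mid j x) (M.mid k x) - crossWeight α (M.mid j x) (M.mid j x))
        + (∑ k ∈ Finset.range M.N, rho ((k : ℤ) - j) ^ 3 - kappa)
          * crossWeight α (M.mid j x) (M.mid j x)) := by
  rw [M.Q_eq, sigma, S, ← mul_sub, ← Finset.sum_sub_distrib]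
  congr 1
  refine Finset.sum_congr rfl fun j _ => ?_
  simp only [mul_sub, Finset.sum_sub_distrib, sub_mul, Finset.sum_mul]
  ring

/-- The quadratic form is close to the limiting conditional variance. -/
lemma abs_Q_sub_sigma_le {α : Fin 4 → ℝ × ℝ → ℝ} (hα : ∀ w, CbSmooth (α w)) :
    ∃ C, 0 ≤ C ∧ ∀ (M : Model C₀ m) (x : M.E),
      |M.Q α x - M.sigma α x| ≤ C * (M.η * M.amp x) := by
  obtain ⟨K, pK, hK, hL⟩ := exists_crossWeight_bound hα
  have hr := rhoMass_nonneg
  refine ⟨K * rhoMass * (|C₀| + 1), by positivity, fun M x => ?_⟩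
  have hη := M.η_pos
  have hy := M.one_le_amp x
  rw [M.Q_sub_sigma_eq, abs_mul, abs_of_pos (pow_pos hη 6)]
  have h1 : ∀ j < M.N, |∑ k ∈ Finset.range M.N, rho ((k : ℤ) - j) ^ 3 *
        (crossWeight α (M.mid j x) (M.mid k x) - crossWeight α (M.mid j x) (M.mid j x))|
      ≤ K * (M.amp x * M.η) * rhoMass := by
    intro j hj
    refine (Finset.abs_sum_le_sum_abs _ _).trans ?_
    refine le_trans ?_ (mul_le_mul_of_nonneg_left (sum_abs_rho_le M.N j) (by positivity))
    rw [Finset.mul_sum]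
    refine Finset.sum_le_sum fun k hk => ?_
    rw [abs_mul, abs_pow]
    have h2 := hL (M.mid j x) (M.mid k x) (M.mid j x)
    have h3 := M.norm_mid_sub_le x (Finset.mem_range.1 hk) hj
    have h4 := abs_mul_rho_cube_le ((k : ℤ) - j)
    have h5 : |(((j : ℤ) - k : ℤ) : ℝ)| = |(((k : ℤ) - j : ℤ) : ℝ)| := by
      push_cast
      exact abs_sub_comm _ _
    push_cast at h3 h4 h5
    rw [h5] at h3
    calc |rho ((k : ℤ) - j)| ^ 3 * |crossWeight α (M.mid j x) (M.mid k x)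
          - crossWeight α (M.mid j x) (M.mid j x)|
        ≤ |rho ((k : ℤ) - j)| ^ 3 * (K * (|(k : ℝ) - j| * (M.amp x * M.η))) := by
          gcongr
          exact h2.trans (by gcongr)
      _ = K * (M.amp x * M.η) * (|(k : ℝ) - j| * |rho ((k : ℤ) - j)| ^ 3) := by ring
      _ ≤ _ := by gcongr
  calc M.η ^ 6 * |∑ j ∈ Finset.range M.N,
      (∑ k ∈ Finset.range M.N, rho ((k : ℤ) - j) ^ 3 *
        (crossWeight α (M.mid j x) (M.mid k x) - crossWeight α (M.mid j x) (M.mid j x))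
        + (∑ k ∈ Finset.range M.N, rho ((k : ℤ) - j) ^ 3 - kappa)
          * crossWeight α (M.mid j x) (M.mid j x))|
      ≤ M.η ^ 6 * ∑ j ∈ Finset.range M.N, (K * (M.amp x * M.η) * rhoMass
        + |∑ k ∈ Finset.range M.N, rho ((k : ℤ) - j) ^ 3 - kappa| * K) := by
        gcongr
        refine (Finset.abs_sum_le_sum_abs _ _).trans (Finset.sum_le_sum fun j hj => ?_)
        refine (abs_add_le _ _).trans (add_le_add (h1 j (Finset.mem_range.1 hj)) ?_)
        rw [abs_mul]
        gcongr
        exact hK _ _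
    _ = K * rhoMass * (M.N * M.η ^ 6) * (M.η * M.amp x) + M.η ^ 6 *
        ((∑ j ∈ Finset.range M.N, |∑ k ∈ Finset.range M.N, rho ((k : ℤ) - j) ^ 3 - kappa|) * K) := by
        rw [Finset.sum_add_distrib, Finset.sum_mul]
        simp only [Finset.sum_const, Finset.card_range, nsmul_eq_mul]
        ring
    _ ≤ K * rhoMass * |C₀| * (M.η * M.amp x) + (M.η * M.amp x) * (rhoMass * K) := by
        have h2 := M.N_mul_le.trans (le_abs_self C₀)
        have h3 : M.η ^ 6 ≤ M.η * M.amp x := by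
          have := pow_le_of_le_one hη.le M.η_le (show 6 ≠ 0 by norm_num)
          nlinarith
        have h4 := sum_abs_sum_rho_cube_sub_le M.N
        gcongr
    _ = _ := by ring

lemma adm_S {q : ℝ × ℝ → ℝ} (hq : CbSmooth q) : Adm (M.S q) :=
  (Adm.const _).mul (Adm.sum fun _ _ => hq.adm_comp _)

lemma adm_sigma {α : Fin 4 → ℝ × ℝ → ℝ} (hα : ∀ w, CbSmooth (α w)) : Adm (M.sigma α) :=
  M.adm_S (CbSmooth.crossWeight hα)

lemma adm_top {α : Fin 4 → ℝ × ℝ → ℝ} (hα : ∀ w, CbSmooth (α w)) (j : ℕ) (u : Fin 4) :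
    Adm (M.top α j u) :=
  Adm.sum fun _ _ => Adm.sum fun w _ => ((hα w).adm_comp _).mul (Adm.const _)

lemma adm_Q {α : Fin 4 → ℝ × ℝ → ℝ} (hα : ∀ w, CbSmooth (α w)) : Adm (M.Q α) :=
  Adm.sum fun j _ => Adm.sum fun u _ => ((hα u).adm_comp _).mul (M.adm_top hα j u)

lemma exists_integral_Q_sub_sigma (C₀ : ℝ) (m : ℕ) {α : Fin 4 → ℝ × ℝ → ℝ}
    (hα : ∀ w, CbSmooth (α w)) :
    ∃ D, 0 ≤ D ∧ ∀ M : Model C₀ m, ∫ x, |M.Q α x - M.sigma α x| ∂M.μ ≤ D * M.θ ^ 7 := by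
  obtain ⟨C, pC, hC⟩ := abs_Q_sub_sigma_le (C₀ := C₀) (m := m) hα
  obtain ⟨D, pD, hD⟩ := exists_integral_amp C₀ m 1 (by norm_num)
  refine ⟨C * D, by positivity, fun M => ?_⟩
  have hη := M.η_pos
  have hy : Integrable (fun x => M.amp x) M.μ := M.adm_amp.integrable _
  refine (integral_mono ((((M.adm_Q hα).sub (M.adm_sigma hα)).norm.integrable _))
    (g := fun x => C * (M.η * M.amp x)) ((hy.const_mul _).const_mul _) fun x => ?_).trans ?_
  · exact hC M x
  · rw [integral_const_mul C, integral_const_mul M.η, ← M.η_mul_inv_θ]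
    have := hD M
    simp only [pow_one] at this
    calc C * (M.η * ∫ x, M.amp x ∂M.μ) ≤ C * (M.η * (D * M.θ⁻¹)) := by gcongr
      _ = _ := by ring

end Model

end Quadratic

section Interpolation

namespace Model

variable {C₀ : ℝ} {m : ℕ}

/-- Dominating variable for the directional derivatives of `W`. -/
def dom (M : Model C₀ m) (α : Fin 4 → ℝ × ℝ → ℝ) (x : M.E) : ℝ :=
  1 + ∑ u, |M.W (fun w => dd (dir u) (α w)) x|

lemma one_le_dom (M : Model C₀ m) (α : Fin 4 → ℝ × ℝ → ℝ) (x : M.E) : 1 ≤ M.dom α x :=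
  le_add_of_nonneg_right (Finset.sum_nonneg fun _ _ => abs_nonneg _)

lemma abs_W_dd_add_one_le_dom (M : Model C₀ m) (α : Fin 4 → ℝ × ℝ → ℝ) (u : Fin 4) (x : M.E) :
    |M.W (fun w => dd (dir u) (α w)) x| + 1 ≤ M.dom α x := by
  have := Finset.single_le_sum (f := fun u => |M.W (fun w => dd (dir u) (α w)) x|)
    (fun _ _ => abs_nonneg _) (Finset.mem_univ u)
  rw [dom]
  linarith

lemma adm_dom (M : Model C₀ m) {α : Fin 4 → ℝ × ℝ → ℝ} (hα : ∀ w, CbSmooth (α w)) :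
    Adm (M.dom α) :=
  (Adm.const 1).add (Adm.sum fun u _ => (M.adm_W fun w => (hα w).dd (dir u)).norm)

lemma dom_pow_le (M : Model C₀ m) (α : Fin 4 → ℝ × ℝ → ℝ) (x : M.E) (p : ℕ) :
    M.dom α x ^ (p + 1) ≤ 2 ^ p * (1 + 4 ^ p * ∑ u, |M.W (fun w => dd (dir u) (α w)) x| ^ (p + 1)) := by
  have h0 : 0 ≤ ∑ u, |M.W (fun w => dd (dir u) (α w)) x| :=
    Finset.sum_nonneg fun _ _ => abs_nonneg _
  have h1 := add_pow_le (zero_le_one' ℝ) h0 (p + 1)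
  have h2 := pow_sum_div_card_le_sum_pow (s := Finset.univ)
    (f := fun u => |M.W (fun w => dd (dir u) (α w)) x|) (fun _ _ => abs_nonneg _) p
  rw [div_le_iff₀ (by simp)] at h2
  simp only [Finset.card_univ, Fintype.card_fin, Nat.cast_ofNat] at h2
  rw [one_pow, Nat.add_sub_cancel] at h1
  refine h1.trans ?_
  gcongr
  linarith

lemma exists_integral_dom (C₀ : ℝ) (m : ℕ) {α : Fin 4 → ℝ × ℝ → ℝ} (hα : ∀ w, CbSmooth (α w)) :
    ∃ D, 0 ≤ D ∧ ∀ M : Model C₀ m,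
      ∫ x, (M.η * M.amp x ^ 9 + M.η * M.dom α x ^ 2 + M.η ^ 4 * M.dom α x ^ 3) ∂M.μ
        ≤ D * M.θ ^ 7 := by
  obtain ⟨D9, p9, h9⟩ := exists_integral_amp C₀ m 9 (by norm_num)
  choose D2 p2 h2 using fun u : Fin 4 => exists_integral_W_sq C₀ m fun w => (hα w).dd (dir u)
  choose D3 p3 h3 using fun u : Fin 4 => exists_integral_W_cube C₀ m fun w => (hα w).dd (dir u)
  refine ⟨D9 + 2 * (1 + 4 * ∑ u, D2 u) + 4 * (1 + 16 * ∑ u, D3 u), ?_, fun M => ?_⟩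
  · have := Finset.sum_nonneg fun u (_ : u ∈ Finset.univ) => p2 u
    have := Finset.sum_nonneg fun u (_ : u ∈ Finset.univ) => p3 u
    positivity
  have hη := M.η_pos
  have hθ := M.θ_pos
  have hηθ : M.η ≤ M.θ ^ 7 := pow_le_pow_of_le_one hθ.le M.θ_le (by norm_num)
  have hη4 : M.η ^ 4 ≤ M.θ ^ 7 := (pow_le_of_le_one hη.le M.η_le (by norm_num)).trans hηθ
  have iy : Integrable (fun x => M.amp x ^ 9) M.μ := (M.adm_amp.pow 9).integrable _
  have aW : ∀ u, Adm (fun x => |M.W (fun w => dd (dir u) (α w)) x|) := fun u =>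
    (M.adm_W fun w => (hα w).dd (dir u)).norm
  have iω : ∀ p, Integrable (fun x => M.dom α x ^ p) M.μ := fun p =>
    ((M.adm_dom hα).pow p).integrable _
  have iW : ∀ p u, Integrable (fun x => |M.W (fun w => dd (dir u) (α w)) x| ^ p) M.μ := fun p u =>
    ((aW u).pow p).integrable _
  have key : ∀ p : ℕ, ∫ x, M.dom α x ^ (p + 1) ∂M.μ ≤ 2 ^ p * (1 + 4 ^ p *
      ∑ u, ∫ x, |M.W (fun w => dd (dir u) (α w)) x| ^ (p + 1) ∂M.μ) := by
    intro p
    have is : Integrable (fun x => ∑ u, |M.W (fun w => dd (dir u) (α w)) x| ^ (p + 1)) M.μ :=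
      integrable_finsetSum _ fun u _ => iW _ u
    refine (integral_mono (iω _) (((integrable_const (1 : ℝ)).add (is.const_mul (4 ^ p))).const_mul
      (2 ^ p)) fun x => M.dom_pow_le α x p).trans_eq ?_
    rw [integral_const_mul (2 ^ p)]
    simp only [Pi.add_apply]
    rw [integral_add (integrable_const _) (is.const_mul _), integral_const_mul (4 ^ p),
      integral_finsetSum _ fun u _ => iW _ u]
    simp
  have k2 := key 1
  have k3 := key 2
  norm_num at k2 k3
  have i12 : Integrable (fun x => M.η * M.amp x ^ 9 + M.η * M.dom α x ^ 2) M.μ :=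
    (iy.const_mul _).add ((iω 2).const_mul _)
  rw [integral_add i12 ((iω 3).const_mul _),
    integral_add (iy.const_mul _) ((iω 2).const_mul _), integral_const_mul, integral_const_mul,
    integral_const_mul]
  have e1 : M.η * ∫ x, M.amp x ^ 9 ∂M.μ ≤ D9 * M.θ ^ 7 := by
    rw [← M.η_mul_inv_θ]
    calc _ ≤ M.η * (D9 * M.θ⁻¹) := by
          gcongr
          exact h9 M
      _ = _ := by ring
  have e2 : M.η * ∫ x, M.dom α x ^ 2 ∂M.μ ≤ 2 * (1 + 4 * ∑ u, D2 u) * M.θ ^ 7 := by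
    have : ∑ u, ∫ x, M.W (fun w => dd (dir u) (α w)) x ^ 2 ∂M.μ ≤ ∑ u, D2 u :=
      Finset.sum_le_sum fun u _ => h2 u M
    have h0 : 0 ≤ ∫ x, M.dom α x ^ 2 ∂M.μ := integral_nonneg fun x => sq_nonneg _
    calc M.η * ∫ x, M.dom α x ^ 2 ∂M.μ ≤ M.θ ^ 7 * (2 * (1 + 4 * ∑ u, D2 u)) :=
          mul_le_mul hηθ (by linarith) h0 (by positivity)
      _ = _ := by ring
  have e3 : M.η ^ 4 * ∫ x, M.dom α x ^ 3 ∂M.μ ≤ 4 * (1 + 16 * ∑ u, D3 u) * M.θ ^ 7 := by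
    have : ∑ u, M.η ^ 4 * ∫ x, |M.W (fun w => dd (dir u) (α w)) x| ^ 3 ∂M.μ
        ≤ ∑ u, D3 u * M.θ ^ 7 := Finset.sum_le_sum fun u _ => h3 u M
    rw [← Finset.mul_sum, ← Finset.sum_mul] at this
    calc M.η ^ 4 * ∫ x, M.dom α x ^ 3 ∂M.μ
        ≤ M.η ^ 4 * (4 * (1 + 16 * ∑ u, ∫ x, |M.W (fun w => dd (dir u) (α w)) x| ^ 3 ∂M.μ)) := by
          gcongr
      _ = 4 * (M.η ^ 4 + 16 *
          (M.η ^ 4 * ∑ u, ∫ x, |M.W (fun w => dd (dir u) (α w)) x| ^ 3 ∂M.μ)) := by ring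
      _ ≤ 4 * (M.θ ^ 7 + 16 * ((∑ u, D3 u) * M.θ ^ 7)) := by gcongr
      _ = _ := by ring
  linarith

/-- Exponent of the interpolation between `W` and the conditionally Gaussian limit. -/
def expo (M : Model C₀ m) (α : Fin 4 → ℝ × ℝ → ℝ) (lam r : ℝ) (x : M.E) : ℂ :=
  (Complex.I * (r * lam : ℝ)) * (M.W α x : ℂ)
    + ((-((1 - r ^ 2) * lam ^ 2 / 2) : ℝ) : ℂ) * (M.sigma α x : ℂ)

lemma expo_re (M : Model C₀ m) (α : Fin 4 → ℝ × ℝ → ℝ) (lam r : ℝ) (x : M.E) :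
    (M.expo α lam r x).re = -((1 - r ^ 2) * lam ^ 2 / 2) * M.sigma α x := by
  rw [expo, mul_assoc, ← Complex.ofReal_mul, ← Complex.ofReal_mul, Complex.add_re,
    Complex.I_mul_re, Complex.ofReal_im, Complex.ofReal_re, neg_zero, zero_add]

lemma abs_one_sub_sq_le {r : ℝ} (h0 : -1 ≤ r) (h2 : r ≤ 2) : |1 - r ^ 2| ≤ 3 := by
  rw [abs_le]
  constructor <;> nlinarith

lemma exists_expo_re_le {α : Fin 4 → ℝ × ℝ → ℝ} (hα : ∀ w, CbSmooth (α w)) (lam : ℝ) :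
    ∃ K, ∀ (M : Model C₀ m) (r : ℝ), -1 ≤ r → r ≤ 2 → ∀ x, (M.expo α lam r x).re ≤ K := by
  obtain ⟨C, pC, hC⟩ := exists_jet_S (C₀ := C₀) (m := m) _ (CbSmooth.crossWeight hα)
  refine ⟨2 * lam ^ 2 * C, fun M r h0 h2 x => ?_⟩
  have h3 := abs_one_sub_sq_le h0 h2
  have hs : |M.sigma α x| ≤ C := (hC M).1 x
  rw [expo_re]
  refine (le_abs_self _).trans ?_
  rw [abs_mul]
  gcongr
  rw [abs_neg, abs_div, abs_mul, abs_of_nonneg (sq_nonneg lam), abs_two]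
  nlinarith [sq_nonneg lam]

lemma adm_expo (M : Model C₀ m) {α : Fin 4 → ℝ × ℝ → ℝ} (hα : ∀ w, CbSmooth (α w)) (lam r : ℝ) :
    Adm (M.expo α lam r) :=
  ((Adm.const _).mul (M.adm_W hα).ofReal).add ((Adm.const _).mul (M.adm_sigma hα).ofReal)

/-- Derivatives of the interpolation exponent along a Cameron-Martin vector. -/
lemma exists_jet_expo (C₀ : ℝ) (m : ℕ) {α : Fin 4 → ℝ × ℝ → ℝ}
    (hα : ∀ w, CbSmooth (α w)) (lam : ℝ) :
    ∃ C, 0 ≤ C ∧ ∀ (M : Model C₀ m) (r : ℝ), -1 ≤ r → r ≤ 2 → ∀ j < M.N, ∀ u : Fin 4,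
      ∃ B₁ B₂ B₃ : M.E → ℂ, Jet (M.cmv j u) (M.expo α lam r) B₁ B₂ B₃ ∧ ∀ x,
        ‖B₁ x‖ ≤ C * (M.b j * M.dom α x + M.η ^ 3 * M.amp x ^ 3) ∧
        ‖B₂ x‖ ≤ C * ((M.N * M.η ^ 3 * M.b j ^ 2 + M.η ^ 5) * M.amp x ^ 3) ∧
        ‖B₃ x - Complex.I * (r * lam : ℝ) * M.top α j u x‖
          ≤ C * (M.η * (M.b j + M.η ^ 6) * M.amp x ^ 3) := by
  obtain ⟨C1, p1, h1⟩ := exists_jet_W (C₀ := C₀) (m := m) α hα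
  obtain ⟨C3, p3, h3⟩ := exists_jet_S (C₀ := C₀) (m := m) _ (CbSmooth.crossWeight hα)
  set Λ := 2 * |lam| + 2 * lam ^ 2 with hΛ
  have pΛ : 0 ≤ Λ := by positivity
  set G := 2 * (Λ * (C1 + C3)) with hG
  have pG : 0 ≤ G := by positivity
  set D := |C₀| ^ 3 + 1 with hD
  have pD : 0 ≤ D := by positivity
  refine ⟨G * (1 + D), by positivity, fun M r hr0 hr2 j hj u => ?_⟩
  have hη := M.η_pos
  have hη1 := M.η_le
  have hb := M.b_nonneg hj
  obtain ⟨W₁, W₂, W₃, jW, hW⟩ := h1 M j hj u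
  obtain ⟨S₁, S₂, S₃, jS, hS⟩ := (h3 M).2 j hj u
  have jS' : Jet (M.cmv j u) (M.sigma α) S₁ S₂ S₃ := jS
  clear jS
  have na : ‖Complex.I * (r * lam : ℝ)‖ ≤ Λ := by
    rw [norm_mul, Complex.norm_I, one_mul, Complex.norm_real, Real.norm_eq_abs, abs_mul]
    have : |r| ≤ 2 := abs_le.2 ⟨by linarith, hr2⟩
    nlinarith [abs_nonneg lam, sq_nonneg lam]
  have nc : ‖((-((1 - r ^ 2) * lam ^ 2 / 2) : ℝ) : ℂ)‖ ≤ Λ := by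
    have := abs_one_sub_sq_le hr0 hr2
    rw [Complex.norm_real, Real.norm_eq_abs, abs_neg, abs_div, abs_mul,
      abs_of_nonneg (sq_nonneg lam), abs_two]
    nlinarith [abs_nonneg lam, sq_nonneg lam]
  have jB : Jet (M.cmv j u) (M.expo α lam r) _ _ _ :=
    (jW.ofReal.const_mul (Complex.I * (r * lam : ℝ))).add
      (jS'.ofReal.const_mul ((-((1 - r ^ 2) * lam ^ 2 / 2) : ℝ) : ℂ))
  refine ⟨_, _, _, jB, fun x => ?_⟩
  clear jB jW jS'
  have y1 := M.one_le_amp x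
  have w1 := M.one_le_dom α x
  have w2 := M.abs_W_dd_add_one_le_dom α u x
  have y3 : 1 ≤ M.amp x ^ 3 := one_le_pow₀ y1
  obtain ⟨r1, r2, r3⟩ := hW x
  obtain ⟨s1, s2, s3⟩ := hS x
  have hDC : C₀ ^ 3 + 1 ≤ D := by
    have := le_abs_self C₀
    have : C₀ ^ 3 ≤ |C₀| ^ 3 := by
      rw [← abs_pow]
      exact le_abs_self _
    linarith
  have hp3 := M.N_mul_b_cube_le hj
  generalize Complex.I * (r * lam : ℝ) = a at na ⊢
  generalize ((-((1 - r ^ 2) * lam ^ 2 / 2) : ℝ) : ℂ) = c at nc ⊢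
  generalize M.N * M.η ^ 3 * M.b j ^ 3 + M.η ^ 7 = p' at *
  have pp : 0 ≤ M.N * M.η ^ 3 * M.b j ^ 2 + M.η ^ 5 := by positivity
  generalize M.N * M.η ^ 3 * M.b j ^ 2 + M.η ^ 5 = p at *
  generalize M.dom α x = ω at *
  generalize M.amp x = y at *
  generalize M.η = η at *
  generalize M.b j = b at *
  have comb : ∀ {z w X Y Q : ℝ}, |z| ≤ C1 * X → |w| ≤ C3 * Y → 0 ≤ X → 0 ≤ Y → X + Y ≤ 2 * Q →
      ‖a * (z : ℂ) + c * (w : ℂ)‖ ≤ G * Q := by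
    intro z w X Y Q hz hw hX hY hQ
    refine (norm_add_le _ _).trans ?_
    rw [norm_mul, norm_mul, Complex.norm_real, Complex.norm_real, Real.norm_eq_abs,
      Real.norm_eq_abs]
    calc ‖a‖ * |z| + ‖c‖ * |w| ≤ Λ * (C1 * X) + Λ * (C3 * Y) := by gcongr
      _ ≤ Λ * ((C1 + C3) * (X + Y)) := by
        have : 0 ≤ Λ * (C1 * Y + C3 * X) := by positivity
        linarith
      _ ≤ Λ * ((C1 + C3) * (2 * Q)) := by gcongr
      _ = _ := by rw [hG]; ring
  have l1 : G ≤ G * (1 + D) := le_mul_of_one_le_right pG (by linarith)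
  have l3 : G * D ≤ G * (1 + D) := by gcongr; linarith
  have pp' : 0 ≤ p' ∨ p' ≤ 0 := le_total _ _
  refine ⟨?_, ?_, ?_⟩
  · refine (comb (Q := b * ω + η ^ 3 * y ^ 3) r1 s1 (by positivity)
      (by positivity) ?_).trans (mul_le_mul_of_nonneg_right l1 (by positivity))
    have := mul_le_mul_of_nonneg_left w2 hb
    have : η ^ 3 * 1 ≤ η ^ 3 * y ^ 3 := by gcongr
    have : 0 ≤ b * ω := by positivity
    linarith
  · refine (comb (Q := p * y ^ 3) r2 s2 (by positivity) (by positivity) ?_).trans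
      (mul_le_mul_of_nonneg_right l1 (by positivity))
    have : p * 1 ≤ p * y ^ 3 := by gcongr
    linarith
  · have e : a * (W₃ x : ℂ) + c * (S₃ x : ℂ) - a * (M.top α j u x : ℂ)
        = a * ((W₃ x - M.top α j u x : ℝ) : ℂ) + c * (S₃ x : ℂ) := by
      push_cast
      ring
    rw [e]
    have h5 : p' ≤ D * (η * (b + η ^ 6)) := hp3.trans (by gcongr)
    have h0 : 0 ≤ D * (η * (b + η ^ 6)) := by positivity
    have r3' : |W₃ x - M.top α j u x| ≤ C1 * (D * (η * (b + η ^ 6)) * y ^ 3) :=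
      r3.trans (by gcongr)
    have s3' : |S₃ x| ≤ C3 * (D * (η * (b + η ^ 6))) := s3.trans (by gcongr)
    refine (comb (Q := D * (η * (b + η ^ 6)) * y ^ 3) r3' s3' (by positivity) h0 ?_).trans ?_
    · have : D * (η * (b + η ^ 6)) * 1 ≤ D * (η * (b + η ^ 6)) * y ^ 3 := by gcongr
      linarith
    · calc G * (D * (η * (b + η ^ 6)) * y ^ 3) = G * D * (η * (b + η ^ 6) * y ^ 3) := by ring
        _ ≤ _ := mul_le_mul_of_nonneg_right l3 (by positivity)

/-- Integration by parts in the interpolation, up to a small error. -/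
lemma exists_interpolation_ibp (C₀ : ℝ) (m : ℕ) {α : Fin 4 → ℝ × ℝ → ℝ}
    (hα : ∀ w, CbSmooth (α w)) {ψ : (Fin m → ℝ × ℝ) → ℝ} (hψ : CbSmooth ψ) (lam : ℝ) :
    ∃ D, 0 ≤ D ∧ ∀ (M : Model C₀ m) (r : ℝ), -1 ≤ r → r ≤ 2 → ∀ j < M.N, ∀ u : Fin 4,
      ‖∫ x, (M.herm j u x • (((α u (M.mid j x) * ψ (M.loc x) : ℝ) : ℂ)
          * Complex.exp (M.expo α lam r x))
        - ((α u (M.mid j x) * ψ (M.loc x) : ℝ) : ℂ) * (Complex.I * (r * lam : ℝ) * M.top α j u x)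
          * Complex.exp (M.expo α lam r x)) ∂M.μ‖
        ≤ D * ((M.b j + M.η ^ 6) * M.θ ^ 7) := by
  obtain ⟨C1, p1, h1⟩ := exists_jet_expo C₀ m hα lam
  obtain ⟨C2, p2, h2⟩ := exists_jet_weight (C₀ := C₀) (m := m) α hα ψ hψ
  obtain ⟨K, hK⟩ := exists_expo_re_le (C₀ := C₀) (m := m) hα lam
  obtain ⟨D4, p4, h4⟩ := exists_integral_dom C₀ m hα
  set D := |C₀| ^ 3 + 1 + |C₀| + |C₀| ^ 2 with hD
  have pD : 0 ≤ D := by positivity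
  set C := C1 + C2 with hC
  have pC : 0 ≤ C := by positivity
  set Z := Real.exp K * (C * D ^ 2 + 3 * C ^ 2 * (D ^ 2 + D) + 3 * C ^ 2 * D
    + 3 * C ^ 3 * (2 * D ^ 2 + 2) + C ^ 2 + 6 * C ^ 3 * D + C ^ 4 * (4 * D ^ 2 + 4)) with hZ
  have pZ : 0 ≤ Z := by positivity
  refine ⟨Z * D4, by positivity, fun M r hr0 hr2 j hj u => ?_⟩
  have hη := M.η_pos
  have hη1 := M.η_le
  have hC₀ := M.C₀_nonneg
  have hb := M.b_nonneg hj
  obtain ⟨A₁, A₂, A₃, jA, hA⟩ := h2 M j hj u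
  obtain ⟨B₁, B₂, B₃, jB, hB⟩ := h1 M r hr0 hr2 j hj u
  have hre := hK M r hr0 hr2
  have jF := jA.ofReal.mul (jB.cexp hre)
  have aE : Adm (fun x => Complex.exp (M.expo α lam r x)) := (jB.cexp hre).a0
  have aT : Adm (fun x => ((α u (M.mid j x) * ψ (M.loc x) : ℝ) : ℂ)
      * (Complex.I * (r * lam : ℝ) * M.top α j u x) * Complex.exp (M.expo α lam r x)) :=
    (jA.a0.ofReal.mul ((Adm.const _).mul (M.adm_top hα j u).ofReal)).mul aE
  have iy : Adm (fun x => M.η * M.amp x ^ 9 + M.η * M.dom α x ^ 2 + M.η ^ 4 * M.dom α x ^ 3) :=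
    (((Adm.const _).mul (M.adm_amp.pow 9)).add ((Adm.const _).mul ((M.adm_dom hα).pow 2))).add
      ((Adm.const _).mul ((M.adm_dom hα).pow 3))
  have hDC : C₀ ^ 3 + 1 ≤ D := by
    rw [hD, abs_of_nonneg hC₀]
    nlinarith
  have hDC' : C₀ ≤ D := by
    rw [hD, abs_of_nonneg hC₀]
    have : 0 ≤ C₀ ^ 3 := by positivity
    nlinarith
  have hDC2 : C₀ ^ 2 ≤ D := by
    rw [hD, abs_of_nonneg hC₀]
    have : 0 ≤ C₀ ^ 3 := by positivity
    nlinarith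
  have hD1 : 1 ≤ D := by
    rw [hD]
    have : 0 ≤ |C₀| ^ 3 + |C₀| + |C₀| ^ 2 := by positivity
    linarith
  have l1 : C1 ≤ C := by linarith
  have l2 : C2 ≤ C := by linarith
  have hbη := M.b_le' hj
  have hp2 : M.η ^ 3 * (M.N * M.η ^ 3 * M.b j ^ 2 + M.η ^ 5)
      ≤ D * (M.η * (M.b j + M.η ^ 6)) := by
    calc M.η ^ 3 * (M.N * M.η ^ 3 * M.b j ^ 2 + M.η ^ 5)
        = (M.N * M.η ^ 6) * (M.b j * M.b j) + M.η * (M.η * M.η ^ 6) := by ring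
      _ ≤ C₀ * (M.b j * (C₀ * M.η ^ 2)) + D * (M.η * (1 * M.η ^ 6)) := by
          have h7 : M.η * (M.η * M.η ^ 6) ≤ M.η * (1 * M.η ^ 6) := by gcongr
          have h8 : M.η * (1 * M.η ^ 6) ≤ D * (M.η * (1 * M.η ^ 6)) :=
            le_mul_of_one_le_left (by positivity) hD1
          have h9 : (M.N * M.η ^ 6) * (M.b j * M.b j) ≤ C₀ * (M.b j * (C₀ * M.η ^ 2)) := by
            gcongr
            exact M.N_mul_le
          linarith
      _ = C₀ ^ 2 * (M.b j * M.η ^ 2) + D * (M.η * M.η ^ 6) := by ring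
      _ ≤ D * (M.b j * M.η) + D * (M.η * M.η ^ 6) := by
          gcongr
          exact pow_le_of_le_one hη.le hη1 (by norm_num)
      _ = _ := by ring
  have hp1 := M.N_mul_b_sq_le hj
  rw [integral_sub (((M.adm_herm j u).smul jF.a0).integrable _) (aT.integrable _),
    M.integral_herm_smul hj u jF, ← integral_sub (jF.a3.integrable _) (aT.integrable _)]
  refine (norm_integral_le_of_norm_le (g := fun x => Z * ((M.b j + M.η ^ 6) *
    (M.η * M.amp x ^ 9 + M.η * M.dom α x ^ 2 + M.η ^ 4 * M.dom α x ^ 3)))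
    (((iy.integrable _).const_mul _).const_mul _) (ae_of_all _ fun x => ?_)).trans ?_
  · have y1 := M.one_le_amp x
    have w1 := M.one_le_dom α x
    obtain ⟨q0, q1, q2, q3⟩ := hA x
    obtain ⟨r1, r2, r3⟩ := hB x
    have hE : ‖Complex.exp (M.expo α lam r x)‖ ≤ Real.exp K := by
      rw [Complex.norm_exp]
      exact Real.exp_le_exp.2 (hre x)
    refine interpolation_error (C := C) (D := D) pC pD hb hη hη1 y1 w1 (hbη.trans (by gcongr))
      (hp1.trans (by gcongr)) hp2 ?_ ?_ ?_ ?_ (r1.trans (by gcongr)) (r2.trans ?_)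
      (r3.trans ?_) hE
    · rw [Complex.norm_real]
      exact q0.trans l2
    · rw [Complex.norm_real]
      exact q1.trans (by gcongr)
    · rw [Complex.norm_real]
      exact q2.trans (by gcongr)
    · rw [Complex.norm_real]
      exact q3.trans (by gcongr)
    · exact mul_le_mul_of_nonneg_right l1 (by positivity)
    · exact mul_le_mul_of_nonneg_right l1 (by positivity)
  · rw [integral_const_mul Z, integral_const_mul (M.b j + M.η ^ 6)]
    have := h4 M
    calc _ ≤ Z * ((M.b j + M.η ^ 6) * (D4 * M.θ ^ 7)) := by gcongr
      _ = _ := by ring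

end Model

end Interpolation

section Deriv

namespace Model

variable {C₀ : ℝ} {m : ℕ}

lemma adm_cexp_expo (M : Model C₀ m) {α : Fin 4 → ℝ × ℝ → ℝ} (hα : ∀ w, CbSmooth (α w))
    (lam : ℝ) {r : ℝ} (h0 : -1 ≤ r) (h2 : r ≤ 2) :
    Adm (fun x => Complex.exp (M.expo α lam r x)) := by
  obtain ⟨K, hK⟩ := exists_expo_re_le (C₀ := C₀) (m := m) hα lam
  exact (M.adm_expo hα lam r).cexp (hK M r h0 h2)

lemma adm_loc (M : Model C₀ m) {ψ : (Fin m → ℝ × ℝ) → ℝ} (hψ : CbSmooth ψ) :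
    Adm (fun x => ψ (M.loc x)) := hψ.adm_comp M.loc

/-- Derivative in `r` of the interpolated characteristic functional. -/
lemma hasDerivAt_integral_cexp_expo (M : Model C₀ m) {α : Fin 4 → ℝ × ℝ → ℝ}
    (hα : ∀ w, CbSmooth (α w)) {ψ : (Fin m → ℝ × ℝ) → ℝ} (hψ : CbSmooth ψ) (lam : ℝ)
    {r : ℝ} (h0 : 0 ≤ r) (h1 : r ≤ 1) :
    HasDerivAt (fun r => ∫ x, (ψ (M.loc x) : ℂ) * Complex.exp (M.expo α lam r x) ∂M.μ)
      (∫ x, (ψ (M.loc x) : ℂ) * ((Complex.I * lam * M.W α x + (r * lam ^ 2 : ℝ) * M.sigma α x)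
        * Complex.exp (M.expo α lam r x)) ∂M.μ) r := by
  obtain ⟨K, hK⟩ := exists_expo_re_le (C₀ := C₀) (m := m) hα lam
  have hmem : ∀ s ∈ Metric.ball r 1, -1 ≤ s ∧ s ≤ 2 := fun s hs => by
    rw [Metric.mem_ball, Real.dist_eq, abs_lt] at hs
    exact ⟨by linarith [hs.1], by linarith [hs.2]⟩
  have aψ := (M.adm_loc hψ)
  have aW := M.adm_W hα
  have aσ := M.adm_sigma hα
  have aG : Adm (fun x => |ψ (M.loc x)| * ((|lam| * |M.W α x| + 2 * lam ^ 2 * |M.sigma α x|)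
      * Real.exp K)) :=
    aψ.norm.mul ((((Adm.const _).mul aW.norm).add ((Adm.const _).mul aσ.norm)).mul (Adm.const _))
  have aF : ∀ s, -1 ≤ s → s ≤ 2 →
      Adm (fun x => (ψ (M.loc x) : ℂ) * Complex.exp (M.expo α lam s x)) := fun s hs hs2 =>
    aψ.ofReal.mul (M.adm_cexp_expo hα lam hs hs2)
  refine (hasDerivAt_integral_of_dominated_loc_of_deriv_le (μ := M.μ)
    (F := fun r x => (ψ (M.loc x) : ℂ) * Complex.exp (M.expo α lam r x))
    (F' := fun r x => (ψ (M.loc x) : ℂ) *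
      ((Complex.I * lam * M.W α x + (r * lam ^ 2 : ℝ) * M.sigma α x)
        * Complex.exp (M.expo α lam r x)))
    (Metric.ball_mem_nhds r one_pos) ?_ ((aF r (by linarith) (by linarith)).integrable _) ?_ ?_
    (aG.integrable _) ?_).2
  · filter_upwards [Metric.ball_mem_nhds r one_pos] with s hs
    exact ((aF s (hmem s hs).1 (hmem s hs).2).integrable M.μ).aestronglyMeasurable
  · exact ((aψ.ofReal.mul ((((Adm.const _).mul aW.ofReal).add
      ((Adm.const _).mul aσ.ofReal)).mul (M.adm_cexp_expo hα lam (by linarith) (by linarith)))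
      ).integrable M.μ).aestronglyMeasurable
  · refine ae_of_all _ fun x s hs => ?_
    have hs' := hmem s hs
    rw [norm_mul, norm_mul, Complex.norm_real, Real.norm_eq_abs, Complex.norm_exp]
    have hs2 : |s| ≤ 2 := abs_le.2 ⟨by linarith [hs'.1], hs'.2⟩
    have hn : ‖Complex.I * lam * M.W α x + (s * lam ^ 2 : ℝ) * M.sigma α x‖
        ≤ |lam| * |M.W α x| + 2 * lam ^ 2 * |M.sigma α x| := by
      refine (norm_add_le _ _).trans ?_
      simp only [norm_mul, Complex.norm_I, one_mul, Complex.norm_real, Real.norm_eq_abs,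
        abs_pow, sq_abs]
      gcongr
    gcongr
    exact hK M s hs'.1 hs'.2 x
  · refine ae_of_all _ fun x s _ => ?_
    have hd : HasDerivAt (fun s : ℝ => M.expo α lam s x)
        (Complex.I * lam * M.W α x + (s * lam ^ 2 : ℝ) * M.sigma α x) s := by
      have e1 : HasDerivAt (fun s : ℝ => ((s * lam : ℝ) : ℂ)) ((1 * lam : ℝ) : ℂ) s :=
        ((hasDerivAt_id s).mul_const lam).ofReal_comp
      have e2 : HasDerivAt (fun s : ℝ => ((-((1 - s ^ 2) * lam ^ 2 / 2) : ℝ) : ℂ))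
          ((s * lam ^ 2 : ℝ) : ℂ) s := by
        refine HasDerivAt.ofReal_comp ?_
        have := ((((hasDerivAt_pow 2 s).const_sub 1).mul_const (lam ^ 2)).div_const 2).neg
        refine this.congr_deriv ?_
        norm_num
        ring
      refine (((e1.const_mul Complex.I).mul_const (M.W α x : ℂ)).add
        (e2.mul_const (M.sigma α x : ℂ))).congr_deriv ?_
      rw [one_mul]
    exact (hd.cexp.const_mul _).congr_deriv (by ring)

lemma integrand_deriv_eq (M : Model C₀ m) (α : Fin 4 → ℝ × ℝ → ℝ) (ψ : (Fin m → ℝ × ℝ) → ℝ)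
    (lam r : ℝ) (x : M.E) :
    (ψ (M.loc x) : ℂ) * ((Complex.I * lam * M.W α x + (r * lam ^ 2 : ℝ) * M.sigma α x)
        * Complex.exp (M.expo α lam r x))
      = Complex.I * lam * (∑ j ∈ Finset.range M.N, ∑ u,
        (M.herm j u x • (((α u (M.mid j x) * ψ (M.loc x) : ℝ) : ℂ)
          * Complex.exp (M.expo α lam r x))
        - ((α u (M.mid j x) * ψ (M.loc x) : ℝ) : ℂ) * (Complex.I * (r * lam : ℝ) * M.top α j u x)
          * Complex.exp (M.expo α lam r x)))
        - (r * lam ^ 2 : ℝ) * ((ψ (M.loc x) : ℂ) * ((M.Q α x - M.sigma α x : ℝ) : ℂ)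
          * Complex.exp (M.expo α lam r x)) := by
  generalize Complex.exp (M.expo α lam r x) = z
  have e1 : ∑ j ∈ Finset.range M.N, ∑ u,
      M.herm j u x • (((α u (M.mid j x) * ψ (M.loc x) : ℝ) : ℂ) * z)
      = (M.W α x : ℂ) * ((ψ (M.loc x) : ℂ) * z) := by
    rw [W]
    push_cast
    simp only [Finset.sum_mul, Complex.real_smul]
    exact Finset.sum_congr rfl fun j _ => Finset.sum_congr rfl fun u _ => by ring
  have e2 : ∑ j ∈ Finset.range M.N, ∑ u,
      ((α u (M.mid j x) * ψ (M.loc x) : ℝ) : ℂ) * (Complex.I * (r * lam : ℝ) * M.top α j u x) * z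
      = (M.Q α x : ℂ) * (Complex.I * (r * lam : ℝ) * (ψ (M.loc x) : ℂ) * z) := by
    rw [Q]
    push_cast
    simp only [Finset.sum_mul]
    exact Finset.sum_congr rfl fun j _ => Finset.sum_congr rfl fun u _ => by ring
  simp only [Finset.sum_sub_distrib]
  rw [e1, e2]
  push_cast
  linear_combination (lam ^ 2 * r * M.Q α x * ψ (M.loc x) * z) * Complex.I_sq

lemma exists_norm_deriv_le (C₀ : ℝ) (m : ℕ) {α : Fin 4 → ℝ × ℝ → ℝ}
    (hα : ∀ w, CbSmooth (α w)) {ψ : (Fin m → ℝ × ℝ) → ℝ} (hψ : CbSmooth ψ) (lam : ℝ) :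
    ∃ D, 0 ≤ D ∧ ∀ (M : Model C₀ m) (r : ℝ), 0 ≤ r → r ≤ 1 →
      ‖∫ x, (ψ (M.loc x) : ℂ) * ((Complex.I * lam * M.W α x + (r * lam ^ 2 : ℝ) * M.sigma α x)
        * Complex.exp (M.expo α lam r x)) ∂M.μ‖ ≤ D * M.θ ^ 7 := by
  obtain ⟨D, pD, hD⟩ := exists_interpolation_ibp C₀ m hα hψ lam
  obtain ⟨D', pD', hD'⟩ := exists_integral_Q_sub_sigma C₀ m hα
  obtain ⟨K, hK⟩ := exists_expo_re_le (C₀ := C₀) (m := m) hα lam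
  obtain ⟨L, pL, hL⟩ := hψ.bound
  refine ⟨|lam| * (4 * D * (2 * |C₀|)) + lam ^ 2 * (L * D' * Real.exp K), by positivity,
    fun M r h0 h1 => ?_⟩
  have hθ := M.θ_pos
  have h0' : -1 ≤ r := by linarith
  have h1' : r ≤ 2 := by linarith
  have aE := M.adm_cexp_expo hα lam h0' h1'
  have aψ := M.adm_loc hψ
  have aR : Adm (fun x => (ψ (M.loc x) : ℂ) * ((M.Q α x - M.sigma α x : ℝ) : ℂ)
      * Complex.exp (M.expo α lam r x)) :=
    (aψ.ofReal.mul ((M.adm_Q hα).sub (M.adm_sigma hα)).ofReal).mul aE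
  have aA : ∀ j u, Adm (fun x => ((α u (M.mid j x) * ψ (M.loc x) : ℝ) : ℂ)) := fun j u =>
    (((hα u).adm_comp (M.mid j)).mul aψ).ofReal
  have aG : ∀ j u, Adm (fun x => (M.herm j u x • (((α u (M.mid j x) * ψ (M.loc x) : ℝ) : ℂ)
          * Complex.exp (M.expo α lam r x))
        - ((α u (M.mid j x) * ψ (M.loc x) : ℝ) : ℂ) * (Complex.I * (r * lam : ℝ) * M.top α j u x)
          * Complex.exp (M.expo α lam r x))) := fun j u =>
    ((M.adm_herm j u).smul ((aA j u).mul aE)).sub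
      (((aA j u).mul ((Adm.const _).mul (M.adm_top hα j u).ofReal)).mul aE)
  simp only [integrand_deriv_eq]
  rw [integral_sub, integral_const_mul, integral_const_mul]
  rotate_left
  · exact ((Adm.const _).mul (Adm.sum fun j _ => Adm.sum fun u _ => aG j u)).integrable M.μ
  · exact ((Adm.const _).mul aR).integrable M.μ
  refine (norm_sub_le _ _).trans ?_
  rw [add_mul]
  refine add_le_add ?_ ?_
  · rw [norm_mul, norm_mul, Complex.norm_I, one_mul, Complex.norm_real, Real.norm_eq_abs, mul_assoc]
    gcongr
    rw [integral_finsetSum _ fun j _ => (Adm.sum fun u _ => aG j u).integrable M.μ]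
    refine (norm_sum_le _ _).trans ?_
    have hj : ∀ j ∈ Finset.range M.N, ‖∫ x, ∑ u,
        (M.herm j u x • (((α u (M.mid j x) * ψ (M.loc x) : ℝ) : ℂ)
          * Complex.exp (M.expo α lam r x))
        - ((α u (M.mid j x) * ψ (M.loc x) : ℝ) : ℂ) * (Complex.I * (r * lam : ℝ) * M.top α j u x)
          * Complex.exp (M.expo α lam r x)) ∂M.μ‖ ≤ 4 * D * M.θ ^ 7 * (M.b j + M.η ^ 6) := by
      intro j hj
      rw [integral_finsetSum _ fun u _ => (aG j u).integrable M.μ]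
      refine (norm_sum_le _ _).trans ?_
      refine (Finset.sum_le_sum fun u _ =>
        hD M r h0' h1' j (Finset.mem_range.1 hj) u).trans_eq ?_
      simp
      ring
    refine (Finset.sum_le_sum hj).trans ?_
    rw [← Finset.mul_sum]
    have := M.sum_b_add_le
    have := le_abs_self C₀
    calc _ ≤ 4 * D * M.θ ^ 7 * (2 * |C₀|) := by
          gcongr
          linarith
      _ = _ := by ring
  · rw [norm_mul, Complex.norm_real, Real.norm_eq_abs, abs_mul, abs_of_nonneg h0,
      abs_of_nonneg (sq_nonneg lam), mul_assoc]
    have hint : ‖∫ x, (ψ (M.loc x) : ℂ) * ((M.Q α x - M.sigma α x : ℝ) : ℂ)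
        * Complex.exp (M.expo α lam r x) ∂M.μ‖ ≤ L * Real.exp K * (D' * M.θ ^ 7) := by
      refine (norm_integral_le_of_norm_le
        (g := fun x => L * Real.exp K * |M.Q α x - M.sigma α x|)
        (((((M.adm_Q hα).sub (M.adm_sigma hα)).norm).integrable M.μ).const_mul _)
        (ae_of_all _ fun x => ?_)).trans ?_
      · rw [norm_mul, norm_mul, Complex.norm_real, Complex.norm_real, Complex.norm_exp,
          Real.norm_eq_abs, Real.norm_eq_abs]
        calc _ ≤ L * |M.Q α x - M.sigma α x| * Real.exp K := by
              gcongr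
              · exact hL _
              · exact hK M r h0' h1' x
          _ = _ := by ring
      · rw [integral_const_mul]
        gcongr
        exact hD' M
    calc _ ≤ 1 * (lam ^ 2 * (L * Real.exp K * (D' * M.θ ^ 7))) := by gcongr
      _ = _ := by ring

/-- Quantitative closeness of the characteristic functional of `W` to its conditionally Gaussian
counterpart. -/
theorem exists_norm_integral_sub_le (C₀ : ℝ) (m : ℕ) {α : Fin 4 → ℝ × ℝ → ℝ}
    (hα : ∀ w, CbSmooth (α w)) {ψ : (Fin m → ℝ × ℝ) → ℝ} (hψ : CbSmooth ψ) (lam : ℝ) :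
    ∃ D, 0 ≤ D ∧ ∀ M : Model C₀ m,
      ‖∫ x, (ψ (M.loc x) : ℂ) * Complex.exp (Complex.I * lam * M.W α x) ∂M.μ
        - ∫ x, (ψ (M.loc x) : ℂ) * Complex.exp (-(lam ^ 2 / 2) * M.sigma α x) ∂M.μ‖
        ≤ D * M.θ ^ 7 := by
  obtain ⟨D, pD, hD⟩ := exists_norm_deriv_le C₀ m hα hψ lam
  refine ⟨D, pD, fun M => ?_⟩
  have := norm_image_sub_le_of_norm_deriv_le_segment_01'
    (fun r hr => (M.hasDerivAt_integral_cexp_expo hα hψ lam hr.1 hr.2).hasDerivWithinAt)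
    (fun r hr => hD M r hr.1 hr.2.le)
  simpa [expo] using this

end Model

end Deriv

section Taylor

lemma abs_le_of_hasDerivAt_of_zero {G G' : ℝ → ℝ} {c : ℝ} (hG : ∀ s, HasDerivAt G (G' s) s)
    (h0 : G 0 = 0) (hc : ∀ s ∈ Set.Icc (0 : ℝ) 1, |G' s| ≤ c) :
    ∀ s ∈ Set.Icc (0 : ℝ) 1, |G s| ≤ c := by
  intro s hs
  have h := (convex_Icc (0 : ℝ) 1).norm_image_sub_le_of_norm_hasDerivWithin_le
    (fun x _ => (hG x).hasDerivWithinAt) hc (Set.left_mem_Icc.2 zero_le_one) hs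
  rw [h0, sub_zero, sub_zero, Real.norm_eq_abs, Real.norm_eq_abs, abs_of_nonneg hs.1] at h
  have hc0 : 0 ≤ c := (abs_nonneg _).trans (hc s hs)
  nlinarith [hs.2]

variable {E : Type*} [NormedAddCommGroup E] [NormedSpace ℝ E]

lemma CbSmooth.hasDerivAt_line {g : E → ℝ} (hg : CbSmooth g) (z w : E) (s : ℝ) :
    HasDerivAt (fun s : ℝ => g (z + s • w)) (_root_.dd w g (z + s • w)) s := by
  have h1 : HasDerivAt (fun s : ℝ => z + s • w) w s := by
    simpa using ((hasDerivAt_id s).smul_const w).const_add z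
  exact (hg.differentiable (z + s • w)).hasFDerivAt.comp_hasDerivAt s h1

lemma CbSmooth.hasDerivAt_line_neg {g : E → ℝ} (hg : CbSmooth g) (z w : E) (s : ℝ) :
    HasDerivAt (fun s : ℝ => g (z + (-s) • w)) (-_root_.dd w g (z + (-s) • w)) s := by
  refine (HasDerivAt.scomp (h := fun s : ℝ => -s) s (hg.hasDerivAt_line z w (-s))
    (hasDerivAt_neg s)).congr_deriv ?_
  simp

/-- Symmetric Taylor expansion at a midpoint, up to fifth order. -/
lemma CbSmooth.symm_taylor {g : E → ℝ} (hg : CbSmooth g) : ∃ K, 0 ≤ K ∧ ∀ z w,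
    |g (z + w) - g (z - w) - 2 * _root_.dd w g z
      - _root_.dd w (_root_.dd w (_root_.dd w g)) z / 3| ≤ K * ‖w‖ ^ 5 := by
  obtain ⟨K, hK0, hK⟩ := dd_iterate_bound hg 5
  refine ⟨2 * K, by positivity, fun z w => ?_⟩
  have h1 := hg.dd w
  have h2 := h1.dd w
  have h3 := h2.dd w
  have h4 := h3.dd w
  have hK5 : ∀ y, |_root_.dd w (_root_.dd w (_root_.dd w (_root_.dd w (_root_.dd w g)))) y| ≤ K * ‖w‖ ^ 5 := fun y => hK w y
  set g1 := _root_.dd w g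
  set g2 := _root_.dd w g1
  set g3 := _root_.dd w g2
  set g4 := _root_.dd w g3
  set g5 := _root_.dd w g4
  have b4 := abs_le_of_hasDerivAt_of_zero (c := 2 * (K * ‖w‖ ^ 5))
    (G := fun s => g4 (z + s • w) - g4 (z + (-s) • w))
    (fun s => (h4.hasDerivAt_line z w s).sub (h4.hasDerivAt_line_neg z w s)) (by simp)
    (fun s _ => by
      have := hK5 (z + s • w)
      have := hK5 (z + (-s) • w)
      rw [sub_neg_eq_add]
      exact (abs_add_le _ _).trans (by linarith))
  have b3 := abs_le_of_hasDerivAt_of_zero (c := 2 * (K * ‖w‖ ^ 5))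
    (G := fun s => g3 (z + s • w) + g3 (z + (-s) • w) - 2 * g3 z)
    (fun s => ((h3.hasDerivAt_line z w s).add (h3.hasDerivAt_line_neg z w s)).sub_const _)
    (by simp; ring) b4
  have b2 := abs_le_of_hasDerivAt_of_zero (c := 2 * (K * ‖w‖ ^ 5))
    (G := fun s => g2 (z + s • w) - g2 (z + (-s) • w) - 2 * g3 z * s)
    (fun s => (((h2.hasDerivAt_line z w s).sub (h2.hasDerivAt_line_neg z w s)).sub
      ((hasDerivAt_id s).const_mul (2 * g3 z))).congr_deriv
      (by simp only [g3]; ring))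
    (by simp) b3
  have b1 := abs_le_of_hasDerivAt_of_zero (c := 2 * (K * ‖w‖ ^ 5))
    (G := fun s => g1 (z + s • w) + g1 (z + (-s) • w) - 2 * g1 z - g3 z * s ^ 2)
    (fun s => ((((h1.hasDerivAt_line z w s).add (h1.hasDerivAt_line_neg z w s)).sub_const _).sub
      ((hasDerivAt_pow 2 s).const_mul (g3 z))).congr_deriv
      (by simp only [g2]; push_cast; ring))
    (by simp; ring) b2
  have b0 := abs_le_of_hasDerivAt_of_zero (c := 2 * (K * ‖w‖ ^ 5))
    (G := fun s => g (z + s • w) - g (z + (-s) • w) - 2 * g1 z * s - g3 z / 3 * s ^ 3)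
    (fun s => ((((hg.hasDerivAt_line z w s).sub (hg.hasDerivAt_line_neg z w s)).sub
      ((hasDerivAt_id s).const_mul (2 * g1 z))).sub
      ((hasDerivAt_pow 3 s).const_mul (g3 z / 3))).congr_deriv
      (by simp only [g1]; push_cast; ring))
    (by simp) b1
  have := b0 1 (Set.right_mem_Icc.2 zero_le_one)
  simp only [one_smul, neg_smul, mul_one, one_pow, ← sub_eq_add_neg] at this
  linarith

end Taylor

section Polarization

lemma dd_pair (w : ℝ × ℝ) (g : ℝ × ℝ → ℝ) :
    dd w g = fun z => w.1 * dd (1, 0) g z + w.2 * dd (0, 1) g z := by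
  have : w = w.1 • (1, 0) + w.2 • ((0, 1) : ℝ × ℝ) := by ext <;> simp
  conv_lhs => rw [this]
  rw [dd_add_dir, dd_smul, dd_smul]

lemma dd_linear_comb {g h : ℝ × ℝ → ℝ} (hg : CbSmooth g) (hh : CbSmooth h) (a b : ℝ)
    (w : ℝ × ℝ) : dd w (fun z => a * g z + b * h z) = fun z => a * dd w g z + b * dd w h z := by
  rw [dd_add (hg.const_mul a) (hh.const_mul b), dd_const_mul hg, dd_const_mul hh]

/-- Third directional derivatives in terms of partial derivatives. -/
lemma dd_cube {g : ℝ × ℝ → ℝ} (hg : CbSmooth g) (w z : ℝ × ℝ) :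
    dd w (dd w (dd w g)) z = w.1 ^ 3 * dd (1, 0) (dd (1, 0) (dd (1, 0) g)) z
      + 3 * w.1 ^ 2 * w.2 * dd (1, 0) (dd (1, 0) (dd (0, 1) g)) z
      + 3 * w.1 * w.2 ^ 2 * dd (1, 0) (dd (0, 1) (dd (0, 1) g)) z
      + w.2 ^ 3 * dd (0, 1) (dd (0, 1) (dd (0, 1) g)) z := by
  have e1 : ∀ {h : ℝ × ℝ → ℝ} (a : ℝ × ℝ), CbSmooth h →
      dd a (dd w h) = fun z => w.1 * dd a (dd (1, 0) h) z + w.2 * dd a (dd (0, 1) h) z := by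
    intro h a hh
    rw [dd_pair w h, dd_linear_comb (hh.dd _) (hh.dd _)]
  have h1 := hg.dd (1, 0)
  have h2 := hg.dd (0, 1)
  have e2 : ∀ a b : ℝ × ℝ, dd a (dd b (dd w g)) = fun z =>
      w.1 * dd a (dd b (dd (1, 0) g)) z + w.2 * dd a (dd b (dd (0, 1) g)) z := by
    intro a b
    rw [e1 b hg, dd_linear_comb (h1.dd b) (h2.dd b)]
  rw [dd_pair w (dd w (dd w g))]
  simp only [e1 _ (hg.dd w), e2]
  have c1 : dd (1, 0) (dd (0, 1) (dd (1, 0) g)) = dd (1, 0) (dd (1, 0) (dd (0, 1) g)) := by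
    rw [dd_comm hg]
  have c2 : dd (0, 1) (dd (1, 0) (dd (1, 0) g)) = dd (1, 0) (dd (1, 0) (dd (0, 1) g)) := by
    rw [dd_comm h1, c1]
  have c3 : dd (0, 1) (dd (1, 0) (dd (0, 1) g)) = dd (1, 0) (dd (0, 1) (dd (0, 1) g)) := by
    rw [dd_comm h2]
  have c4 : dd (0, 1) (dd (0, 1) (dd (1, 0) g)) = dd (1, 0) (dd (0, 1) (dd (0, 1) g)) := by
    rw [dd_comm hg, c3]
  rw [c1, c2, c3, c4]
  ring

lemma dd_cube_smul {g : ℝ × ℝ → ℝ} (hg : CbSmooth g) (c : ℝ) (w z : ℝ × ℝ) :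
    dd (c • w) (dd (c • w) (dd (c • w) g)) z = c ^ 3 * dd w (dd w (dd w g)) z := by
  have h1 := hg.dd w
  simp only [dd_smul]
  rw [dd_const_mul h1, dd_const_mul ((h1.dd w).const_mul c), dd_const_mul (h1.dd w)]
  ring

/-- The Laplace operator. -/
def lap (g : ℝ × ℝ → ℝ) (z : ℝ × ℝ) : ℝ := dd (1, 0) (dd (1, 0) g) z + dd (0, 1) (dd (0, 1) g) z

lemma CbSmooth.lap {g : ℝ × ℝ → ℝ} (hg : CbSmooth g) : CbSmooth (lap g) :=
  ((hg.dd _).dd _).add ((hg.dd _).dd _)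

/-- Weights polarizing the third derivative of `g` along the four directions `dir`. -/
def polar (g : ℝ × ℝ → ℝ) : Fin 4 → ℝ × ℝ → ℝ :=
  ![fun z => 1 / 24 * dd (1, 0) (dd (1, 0) (dd (1, 0) g)) z
      + -1 / 24 * dd (1, 0) (dd (0, 1) (dd (0, 1) g)) z,
    fun z => 1 / 24 * dd (0, 1) (dd (0, 1) (dd (0, 1) g)) z
      + -1 / 24 * dd (1, 0) (dd (1, 0) (dd (0, 1) g)) z,
    fun z => 1 / 48 * dd (1, 0) (dd (0, 1) (dd (0, 1) g)) z
      + 1 / 48 * dd (1, 0) (dd (1, 0) (dd (0, 1) g)) z,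
    fun z => 1 / 48 * dd (1, 0) (dd (0, 1) (dd (0, 1) g)) z
      + -1 / 48 * dd (1, 0) (dd (1, 0) (dd (0, 1) g)) z]

lemma CbSmooth.polar {g : ℝ × ℝ → ℝ} (hg : CbSmooth g) (u : Fin 4) : CbSmooth (polar g u) := by
  have h : ∀ a b c : ℝ × ℝ, CbSmooth (_root_.dd a (_root_.dd b (_root_.dd c g))) := fun a b c =>
    ((hg.dd c).dd b).dd a
  fin_cases u
  all_goals exact ((h _ _ _).const_mul _).add ((h _ _ _).const_mul _)

lemma crossWeight_polar (g : ℝ × ℝ → ℝ) (z : ℝ × ℝ) :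
    crossWeight (polar g) z z = dd (1, 0) (dd (1, 0) (dd (1, 0) g)) z ^ 2 / 96
      + dd (0, 1) (dd (0, 1) (dd (0, 1) g)) z ^ 2 / 96
      + dd (1, 0) (dd (0, 1) (dd (0, 1) g)) z ^ 2 / 32
      + dd (1, 0) (dd (1, 0) (dd (0, 1) g)) z ^ 2 / 32 := by
  simp only [crossWeight, Fin.sum_univ_four, dotL_apply, dir, polar]
  simp
  ring

namespace Model

variable {C₀ : ℝ} {m : ℕ}

/-- The third-order variation of `g` along the grid. -/
def thirdVar (M : Model C₀ m) (g : ℝ × ℝ → ℝ) (x : M.E) : ℝ :=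
  ∑ k ∈ Finset.range M.N, dd (M.incr k x) (dd (M.incr k x) (dd (M.incr k x) g)) (M.mid k x) / 24

/-- The midpoint Riemann sum of `dg`. -/
def midSum (M : Model C₀ m) (g : ℝ × ℝ → ℝ) (x : M.E) : ℝ :=
  ∑ k ∈ Finset.range M.N, dd (M.incr k x) g (M.mid k x)

lemma adm_thirdVar (M : Model C₀ m) {g : ℝ × ℝ → ℝ} (hg : CbSmooth g) : Adm (M.thirdVar g) := by
  have h : ∀ (a b c : ℝ × ℝ) (k : ℕ), Adm fun x => dd a (dd b (dd c g)) (M.mid k x) :=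
    fun a b c k => (((hg.dd c).dd b).dd a).adm_comp (M.mid k)
  have i1 : ∀ k, Adm fun x => (M.incr k x).1 := fun k =>
    Adm.clm ((ContinuousLinearMap.fst ℝ ℝ ℝ).comp (M.incr k))
  have i2 : ∀ k, Adm fun x => (M.incr k x).2 := fun k =>
    Adm.clm ((ContinuousLinearMap.snd ℝ ℝ ℝ).comp (M.incr k))
  have e : M.thirdVar g = fun x => ∑ k ∈ Finset.range M.N,
      ((M.incr k x).1 ^ 3 * dd (1, 0) (dd (1, 0) (dd (1, 0) g)) (M.mid k x)
      + 3 * (M.incr k x).1 ^ 2 * (M.incr k x).2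
        * dd (1, 0) (dd (1, 0) (dd (0, 1) g)) (M.mid k x)
      + 3 * (M.incr k x).1 * (M.incr k x).2 ^ 2
        * dd (1, 0) (dd (0, 1) (dd (0, 1) g)) (M.mid k x)
      + (M.incr k x).2 ^ 3 * dd (0, 1) (dd (0, 1) (dd (0, 1) g)) (M.mid k x)) * (1 / 24) := by
    ext x
    refine Finset.sum_congr rfl fun k _ => ?_
    rw [dd_cube hg, div_eq_mul_one_div]
  rw [e]
  exact Adm.sum fun k _ => ((((((i1 k).pow 3).mul (h _ _ _ k)).add
    ((((Adm.const 3).mul ((i1 k).pow 2)).mul (i2 k)).mul (h _ _ _ k))).add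
    ((((Adm.const 3).mul (i1 k)).mul ((i2 k).pow 2)).mul (h _ _ _ k))).add
    (((i2 k).pow 3).mul (h _ _ _ k))).mul (Adm.const _)

lemma thirdVar_sub_W (M : Model C₀ m) {g : ℝ × ℝ → ℝ} (hg : CbSmooth g) (x : M.E) :
    M.thirdVar g x - M.W (polar g) x = M.η ^ 2 / 8 * M.midSum (lap g) x := by
  rw [thirdVar, W, midSum, ← Finset.sum_sub_distrib, Finset.mul_sum]
  refine Finset.sum_congr rfl fun k _ => ?_
  have c2 : dd (0, 1) (dd (1, 0) (dd (1, 0) g)) = dd (1, 0) (dd (1, 0) (dd (0, 1) g)) := by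
    rw [dd_comm (hg.dd _), dd_comm hg]
  have e : ∀ w, dd w (lap g)
      = fun z => dd w (dd (1, 0) (dd (1, 0) g)) z + dd w (dd (0, 1) (dd (0, 1) g)) z := fun w =>
    dd_add ((hg.dd _).dd _) ((hg.dd _).dd _) w
  rw [dd_cube hg, dd_pair _ (lap g), e, e, c2]
  simp only [Fin.sum_univ_four, polar, herm, ξ, V, ContinuousLinearMap.comp_apply, dotL_apply, dir]
  simp
  ring

/-- Telescoping expansion of midpoint Riemann sums. -/
lemma exists_midSum_expansion (C₀ : ℝ) (m : ℕ) {g : ℝ × ℝ → ℝ} (hg : CbSmooth g) :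
    ∃ K, 0 ≤ K ∧ ∀ (M : Model C₀ m) (x : M.E),
      |M.midSum g x + M.thirdVar g x| ≤ K * (1 + M.N * (M.amp x * M.η) ^ 5) := by
  obtain ⟨K, hK0, hK⟩ := hg.symm_taylor
  obtain ⟨L, hL0, hL⟩ := hg.bound
  refine ⟨2 * L + K, by positivity, fun M x => ?_⟩
  have hη := M.η_pos
  have hy := M.one_le_amp x
  have step : ∀ k ∈ Finset.range M.N, |(g (M.P (k + 1) x) - g (M.P k x))
      - (dd (M.incr k x) g (M.mid k x)
        + dd (M.incr k x) (dd (M.incr k x) (dd (M.incr k x) g)) (M.mid k x) / 24)|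
      ≤ K * (M.amp x * M.η) ^ 5 := by
    intro k hk
    have h := hK (M.mid k x) ((1 / 2 : ℝ) • M.incr k x)
    have e1 : M.mid k x + (1 / 2 : ℝ) • M.incr k x = M.P (k + 1) x := by
      simp only [mid, incr, smul_apply, add_apply, sub_apply]
      module
    have e2 : M.mid k x - (1 / 2 : ℝ) • M.incr k x = M.P k x := by
      simp only [mid, incr, smul_apply, add_apply, sub_apply]
      module
    rw [e1, e2, dd_cube_smul hg, dd_smul] at h
    have hn : ‖(1 / 2 : ℝ) • M.incr k x‖ ≤ M.amp x * M.η := by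
      rw [norm_smul]
      have := M.norm_incr_le (Finset.mem_range.1 hk) x
      have := norm_nonneg (M.incr k x)
      norm_num
      linarith
    refine le_trans (le_of_eq ?_) (h.trans (by gcongr))
    congr 1
    ring
  have tel : ∑ k ∈ Finset.range M.N, (g (M.P (k + 1) x) - g (M.P k x))
      = g (M.P M.N x) - g (M.P 0 x) := Finset.sum_range_sub (fun k => g (M.P k x)) M.N
  have hs := (Finset.abs_sum_le_sum_abs _ _).trans (Finset.sum_le_sum step)
  rw [Finset.sum_sub_distrib, tel, Finset.sum_add_distrib, Finset.sum_const, Finset.card_range,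
    nsmul_eq_mul] at hs
  change |_ - (M.midSum g x + M.thirdVar g x)| ≤ _ at hs
  have l1 := hL (M.P M.N x)
  have l0 := hL (M.P 0 x)
  have p5 : 0 ≤ M.N * (M.amp x * M.η) ^ 5 := by positivity
  rw [abs_le] at *
  constructor <;> nlinarith [mul_nonneg hL0 p5]

end Model

end Polarization

section Reduction

namespace Model

variable {C₀ : ℝ} {m : ℕ}

lemma exists_abs_thirdVar_le (C₀ : ℝ) (m : ℕ) {g : ℝ × ℝ → ℝ} (hg : CbSmooth g) :
    ∃ K, 0 ≤ K ∧ ∀ (M : Model C₀ m) (x : M.E),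
      |M.thirdVar g x| ≤ K * (M.N * (M.amp x * M.η) ^ 3) := by
  obtain ⟨K, hK0, hK⟩ := dd_iterate_bound hg 3
  refine ⟨K, hK0, fun M x => ?_⟩
  have hη := M.η_pos
  have hy := M.one_le_amp x
  have step : ∀ k ∈ Finset.range M.N,
      |dd (M.incr k x) (dd (M.incr k x) (dd (M.incr k x) g)) (M.mid k x) / 24|
      ≤ K * (M.amp x * M.η) ^ 3 := by
    intro k hk
    have h : |dd (M.incr k x) (dd (M.incr k x) (dd (M.incr k x) g)) (M.mid k x)|
      ≤ K * ‖M.incr k x‖ ^ 3 := hK (M.incr k x) (M.mid k x)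
    rw [abs_div]
    refine (div_le_self (abs_nonneg _) (by norm_num)).trans (h.trans ?_)
    gcongr
    exact M.norm_incr_le (Finset.mem_range.1 hk) x
  have hs := (Finset.abs_sum_le_sum_abs _ _).trans (Finset.sum_le_sum step)
  rw [Finset.sum_const, Finset.card_range, nsmul_eq_mul] at hs
  exact hs.trans_eq (by ring)

/-- The third-order variation is close to a sum of Hermite polynomials. -/
lemma exists_abs_thirdVar_sub_le (C₀ : ℝ) (m : ℕ) {g : ℝ × ℝ → ℝ} (hg : CbSmooth g) :
    ∃ K, 0 ≤ K ∧ ∀ (M : Model C₀ m) (x : M.E),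
      |M.thirdVar g x - M.W (polar g) x|
        ≤ K * (M.η * M.amp x ^ 5 + M.η ^ 2 * |M.W (polar (lap g)) x|) := by
  obtain ⟨K1, p1, h1⟩ := exists_midSum_expansion C₀ m hg.lap
  obtain ⟨K2, p2, h2⟩ := exists_midSum_expansion C₀ m hg.lap.lap
  obtain ⟨K3, p3, h3⟩ := exists_abs_thirdVar_le C₀ m hg.lap.lap
  refine ⟨1 + (K1 + K2 + K3) * (1 + |C₀|), by positivity, fun M x => ?_⟩
  have hη := M.η_pos
  have hη1 := M.η_le
  have hy := M.one_le_amp x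
  have q1 := h1 M x
  have q2 := h2 M x
  have q3 := h3 M x
  have e1 := M.thirdVar_sub_W hg x
  have e2 := M.thirdVar_sub_W hg.lap x
  have hN : M.N * M.η ^ 6 ≤ |C₀| := M.N_mul_le.trans (le_abs_self _)
  rw [e1]
  have hC := abs_nonneg C₀
  have hN0 : (0 : ℝ) ≤ M.N := Nat.cast_nonneg _
  generalize M.midSum (lap g) x = s1 at *
  generalize M.midSum (lap (lap g)) x = s2 at *
  generalize M.thirdVar (lap g) x = v1 at *
  generalize M.thirdVar (lap (lap g)) x = v2 at *
  generalize M.W (polar (lap g)) x = w at *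
  clear e1 h1 h2 h3
  generalize M.amp x = y at *
  generalize M.η = η at *
  generalize (M.N : ℝ) = N at *
  generalize |C₀| = C at *
  have y35 : y ^ 3 ≤ y ^ 5 := pow_le_pow_right₀ hy (by norm_num)
  have y05 : 1 ≤ y ^ 5 := one_le_pow₀ hy
  have a1 : η ^ 2 * (1 + N * (y * η) ^ 5) ≤ (1 + C) * (η * y ^ 5) := by
    calc η ^ 2 * (1 + N * (y * η) ^ 5) = η * η * 1 + (N * η ^ 6) * (η * y ^ 5) := by ring
      _ ≤ η * 1 * y ^ 5 + C * (η * y ^ 5) := by gcongr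
      _ = _ := by ring
  have a2 : η ^ 4 * (1 + N * (y * η) ^ 5) ≤ (1 + C) * (η * y ^ 5) := by
    refine le_trans ?_ a1
    have : 0 ≤ 1 + N * (y * η) ^ 5 := by positivity
    gcongr ?_ * _
    exact pow_le_pow_of_le_one hη.le hη1 (by norm_num)
  have a3 : η ^ 4 * (N * (y * η) ^ 3) ≤ (1 + C) * (η * y ^ 5) := by
    calc η ^ 4 * (N * (y * η) ^ 3) = (N * η ^ 6) * (η * y ^ 3) := by ring
      _ ≤ C * (η * y ^ 5) := by gcongr
      _ ≤ (1 + C) * (η * y ^ 5) := by gcongr; linarith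
  have t1 : |s1| ≤ K1 * (1 + N * (y * η) ^ 5) + |v1| := by
    have := abs_sub (s1 + v1) v1
    rw [add_sub_cancel_right] at this
    linarith
  have t2 : |s2| ≤ K2 * (1 + N * (y * η) ^ 5) + |v2| := by
    have := abs_sub (s2 + v2) v2
    rw [add_sub_cancel_right] at this
    linarith
  have t3 : |v1| ≤ |w| + η ^ 2 / 8 * |s2| := by
    rw [show v1 = w + η ^ 2 / 8 * s2 by linarith]
    refine (abs_add_le _ _).trans_eq ?_
    rw [abs_mul, abs_of_nonneg (by positivity : 0 ≤ η ^ 2 / 8)]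
  rw [abs_mul, abs_of_nonneg (by positivity : 0 ≤ η ^ 2 / 8)]
  calc η ^ 2 / 8 * |s1|
      ≤ η ^ 2 / 8 * (K1 * (1 + N * (y * η) ^ 5) + (|w| + η ^ 2 / 8 *
          (K2 * (1 + N * (y * η) ^ 5) + K3 * (N * (y * η) ^ 3)))) := by
        gcongr
        refine t1.trans ?_
        gcongr
        refine t3.trans ?_
        gcongr
        exact t2.trans (by gcongr)
    _ = K1 / 8 * (η ^ 2 * (1 + N * (y * η) ^ 5)) + η ^ 2 / 8 * |w|
        + K2 / 64 * (η ^ 4 * (1 + N * (y * η) ^ 5)) + K3 / 64 * (η ^ 4 * (N * (y * η) ^ 3)) := by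
        ring
    _ ≤ K1 * ((1 + C) * (η * y ^ 5)) + η ^ 2 * |w|
        + K2 * ((1 + C) * (η * y ^ 5)) + K3 * ((1 + C) * (η * y ^ 5)) := by
        gcongr <;> nlinarith [sq_nonneg η]
    _ ≤ (1 + (K1 + K2 + K3) * (1 + C)) * (η * y ^ 5 + η ^ 2 * |w|) := by
        have : 0 ≤ η * y ^ 5 := by positivity
        have : 0 ≤ (K1 + K2 + K3) * (1 + C) * (η ^ 2 * |w|) := by positivity
        nlinarith

/-- The third-order variation is close in `L¹` to a sum of Hermite polynomials. -/
lemma exists_integral_abs_thirdVar_sub_le (C₀ : ℝ) (m : ℕ) {g : ℝ × ℝ → ℝ} (hg : CbSmooth g) :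
    ∃ D, 0 ≤ D ∧ ∀ M : Model C₀ m,
      ∫ x, |M.thirdVar g x - M.W (polar g) x| ∂M.μ ≤ D * M.θ ^ 7 := by
  obtain ⟨K, hK0, hK⟩ := exists_abs_thirdVar_sub_le C₀ m hg
  obtain ⟨D1, hD1, h1⟩ := exists_integral_amp C₀ m 5 (by norm_num)
  obtain ⟨D2, hD2, h2⟩ := exists_integral_W_sq C₀ m (fun u => hg.lap.polar u)
  refine ⟨K * (D1 + (1 + D2)), by positivity, fun M => ?_⟩
  have := M.gauss
  have hθ := M.θ_pos
  have hθ1 := M.θ_le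
  have hη := M.η_pos
  have i0 : Integrable (fun x => |M.thirdVar g x - M.W (polar g) x|) M.μ :=
    ((M.adm_thirdVar hg).sub (M.adm_W fun u => hg.polar u)).norm.integrable M.μ
  have i1 : Integrable (fun x => M.amp x ^ 5) M.μ := (M.adm_amp.pow 5).integrable M.μ
  have i2 : Integrable (fun x => M.W (polar (lap g)) x ^ 2) M.μ :=
    ((M.adm_W fun u => hg.lap.polar u).pow 2).integrable M.μ
  calc ∫ x, |M.thirdVar g x - M.W (polar g) x| ∂M.μ
      ≤ ∫ x, K * (M.η * M.amp x ^ 5 + M.η ^ 2 * (1 + M.W (polar (lap g)) x ^ 2)) ∂M.μ := by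
        refine integral_mono (g := fun x => K * (M.η * M.amp x ^ 5
          + M.η ^ 2 * (1 + M.W (polar (lap g)) x ^ 2))) i0 (((i1.const_mul _).add
          (((integrable_const 1).add i2).const_mul _)).const_mul K) fun x => (hK M x).trans ?_
        have : |M.W (polar (lap g)) x| ≤ 1 + M.W (polar (lap g)) x ^ 2 := by
          rw [← sq_abs]
          nlinarith [sq_nonneg (|M.W (polar (lap g)) x| - 1), sq_nonneg (|M.W (polar (lap g)) x|)]
        have h2 : M.η * M.amp x ^ 5 + M.η ^ 2 * |M.W (polar (lap g)) x|
            ≤ M.η * M.amp x ^ 5 + M.η ^ 2 * (1 + M.W (polar (lap g)) x ^ 2) := by gcongr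
        exact mul_le_mul_of_nonneg_left h2 hK0
    _ = K * (M.η * ∫ x, M.amp x ^ 5 ∂M.μ
          + M.η ^ 2 * (1 + ∫ x, M.W (polar (lap g)) x ^ 2 ∂M.μ)) := by
        have i3 : Integrable (fun x => 1 + M.W (polar (lap g)) x ^ 2) M.μ :=
          (integrable_const 1).add i2
        rw [integral_const_mul, integral_add (i1.const_mul _) (i3.const_mul _),
          integral_const_mul, integral_const_mul, integral_add (integrable_const _) i2]
        simp
    _ ≤ K * (M.η * (D1 * M.θ⁻¹) + M.η ^ 2 * (1 + D2)) := by
        exact mul_le_mul_of_nonneg_left (add_le_add (mul_le_mul_of_nonneg_left (h1 M) hη.le)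
          (mul_le_mul_of_nonneg_left (by linarith [h2 M]) (sq_nonneg _))) hK0
    _ = K * (D1 * M.θ ^ 7 + M.θ ^ 16 * (1 + D2)) := by
        rw [← M.η_mul_inv_θ]
        simp only [Model.η]
        ring
    _ ≤ K * (D1 * M.θ ^ 7 + M.θ ^ 7 * (1 + D2)) := by
        have : M.θ ^ 16 ≤ M.θ ^ 7 := pow_le_pow_of_le_one hθ.le hθ1 (by norm_num)
        gcongr
    _ = _ := by ring

lemma _root_.Complex.norm_exp_I_mul_sub_le (a b : ℝ) :
    ‖Complex.exp (Complex.I * a) - Complex.exp (Complex.I * b)‖ ≤ |a - b| := by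
  have h : Complex.exp (Complex.I * a) - Complex.exp (Complex.I * b)
      = Complex.exp (Complex.I * b) * (Complex.exp (Complex.I * (a - b : ℝ)) - 1) := by
    rw [mul_sub, mul_one, ← Complex.exp_add]
    push_cast
    ring_nf
  have e : ‖Complex.exp (Complex.I * b)‖ = 1 := by
    rw [mul_comm]; exact Complex.norm_exp_ofReal_mul_I b
  rw [h, norm_mul, e, one_mul]
  exact Real.norm_exp_I_mul_ofReal_sub_one_le

lemma exists_norm_integral_thirdVar_sub_le (C₀ : ℝ) (m : ℕ) {g : ℝ × ℝ → ℝ} (hg : CbSmooth g)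
    {ψ : (Fin m → ℝ × ℝ) → ℝ} (hψ : CbSmooth ψ) (lam : ℝ) :
    ∃ D, 0 ≤ D ∧ ∀ M : Model C₀ m,
      ‖(∫ x, (ψ (M.loc x) : ℂ) * Complex.exp (Complex.I * lam * M.thirdVar g x) ∂M.μ)
        - ∫ x, (ψ (M.loc x) : ℂ) * Complex.exp (-((lam : ℂ) ^ 2 / 2) * M.sigma (polar g) x) ∂M.μ‖
      ≤ D * M.θ ^ 7 := by
  obtain ⟨D1, hD1, h1⟩ := exists_norm_integral_sub_le C₀ m (fun u => hg.polar u) hψ lam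
  obtain ⟨D2, hD2, h2⟩ := exists_integral_abs_thirdVar_sub_le C₀ m hg
  obtain ⟨K, hK0, hK⟩ := hψ.bound
  refine ⟨K * |lam| * D2 + D1, by positivity, fun M => ?_⟩
  have := M.gauss
  have adm : ∀ V : M.E → ℝ, Adm V →
      Integrable (fun x => (ψ (M.loc x) : ℂ) * Complex.exp (Complex.I * lam * V x)) M.μ := by
    intro V hV
    have hc : Continuous (fun x => (ψ (M.loc x) : ℂ) * Complex.exp (Complex.I * lam * V x)) := by
      have := hψ.continuous
      have := hV.cont
      fun_prop
    refine Integrable.of_bound hc.aestronglyMeasurable K (ae_of_all _ fun x => ?_)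
    have e : ‖Complex.exp (Complex.I * lam * V x)‖ = 1 := by
      rw [show Complex.I * lam * V x = ((lam * V x : ℝ) : ℂ) * Complex.I by push_cast; ring]
      exact Complex.norm_exp_ofReal_mul_I _
    rw [norm_mul, e, mul_one, Complex.norm_real]
    exact hK _
  have iT := adm _ (M.adm_thirdVar hg)
  have iW := adm _ (M.adm_W fun u => hg.polar u)
  have i0 : Integrable (fun x => |M.thirdVar g x - M.W (polar g) x|) M.μ :=
    ((M.adm_thirdVar hg).sub (M.adm_W fun u => hg.polar u)).norm.integrable M.μ
  have key : ‖(∫ x, (ψ (M.loc x) : ℂ) * Complex.exp (Complex.I * lam * M.thirdVar g x) ∂M.μ)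
        - ∫ x, (ψ (M.loc x) : ℂ) * Complex.exp (Complex.I * lam * M.W (polar g) x) ∂M.μ‖
      ≤ K * |lam| * (D2 * M.θ ^ 7) := by
    rw [← integral_sub iT iW]
    refine (norm_integral_le_of_norm_le (i0.const_mul (K * |lam|))
      (ae_of_all _ fun x => ?_)).trans ?_
    · rw [← mul_sub, norm_mul, Complex.norm_real]
      have := Complex.norm_exp_I_mul_sub_le (lam * M.thirdVar g x) (lam * M.W (polar g) x)
      rw [← mul_sub, abs_mul] at this
      push_cast at this
      rw [← mul_assoc, ← mul_assoc] at this
      exact (mul_le_mul (hK _) this (norm_nonneg _) hK0).trans_eq (by ring)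
    · rw [integral_const_mul]
      gcongr
      exact h2 M
  refine (norm_sub_le_norm_sub_add_norm_sub _ _ _).trans ((add_le_add key (h1 M)).trans_eq ?_)
  ring

end Model

end Reduction

section PartialDerivatives

lemma deriv_snd_line {G : ℝ × ℝ → ℝ} (hG : CbSmooth G) (x y : ℝ) :
    deriv (fun v => G (x, v)) y = dd (0, 1) G (x, y) := by
  have h : HasDerivAt (fun v : ℝ => ((x, v) : ℝ × ℝ)) (0, 1) y :=
    (hasDerivAt_const y x).prodMk (hasDerivAt_id y)
  exact ((hG.differentiable (x, y)).hasFDerivAt.comp_hasDerivAt y h).deriv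

lemma deriv_fst_line {G : ℝ × ℝ → ℝ} (hG : CbSmooth G) (x y : ℝ) :
    deriv (fun u => G (u, y)) x = dd (1, 0) G (x, y) := by
  have h : HasDerivAt (fun u : ℝ => ((u, y) : ℝ × ℝ)) (1, 0) x :=
    (hasDerivAt_id x).prodMk (hasDerivAt_const x y)
  exact ((hG.differentiable (x, y)).hasFDerivAt.comp_hasDerivAt x h).deriv

lemma CbSmooth.iterate_dd {E : Type*} [NormedAddCommGroup E] [NormedSpace ℝ E] {g : E → ℝ}
    (hg : CbSmooth g) (w : E) (r : ℕ) : CbSmooth ((_root_.dd w)^[r] g) := by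
  induction r with
  | zero => exact hg
  | succ r ih =>
    rw [Function.iterate_succ_apply']
    exact ih.dd w

lemma iteratedDeriv_snd_line {G : ℝ × ℝ → ℝ} (hG : CbSmooth G) (r : ℕ) (x : ℝ) :
    iteratedDeriv r (fun v => G (x, v)) = fun y => ((dd (0, 1))^[r] G) (x, y) := by
  induction r with
  | zero => simp
  | succ r ih =>
    ext y
    rw [iteratedDeriv_succ, ih, deriv_snd_line (hG.iterate_dd _ r), Function.iterate_succ_apply']

lemma iteratedDeriv_fst_line {G : ℝ × ℝ → ℝ} (hG : CbSmooth G) (r : ℕ) (y : ℝ) :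
    iteratedDeriv r (fun u => G (u, y)) = fun x => ((dd (1, 0))^[r] G) (x, y) := by
  induction r with
  | zero => simp
  | succ r ih =>
    ext x
    rw [iteratedDeriv_succ, ih, deriv_fst_line (hG.iterate_dd _ r), Function.iterate_succ_apply']

lemma pd_eq_iterate_dd {f : ℝ → ℝ → ℝ} (hf : CbSmooth2 f) (k l : ℕ) (x y : ℝ) :
    pd k l f x y = ((dd (1, 0))^[k] ((dd (0, 1))^[l] fun p : ℝ × ℝ => f p.1 p.2)) (x, y) := by
  have h : (fun u => iteratedDeriv l (fun v => f u v) y)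
      = fun u => ((dd (0, 1))^[l] fun p : ℝ × ℝ => f p.1 p.2) (u, y) := by
    ext u
    exact congrFun (iteratedDeriv_snd_line hf l u) y
  rw [pd, h, iteratedDeriv_fst_line (hf.iterate_dd _ l)]

lemma dd_cube_eq_pd {f : ℝ → ℝ → ℝ} (hf : CbSmooth2 f) (w : ℝ × ℝ) (x y : ℝ) :
    dd w (dd w (dd w fun p : ℝ × ℝ => f p.1 p.2)) (x, y)
      = w.1 ^ 3 * pd 3 0 f x y + 3 * w.1 ^ 2 * w.2 * pd 2 1 f x y
        + 3 * w.1 * w.2 ^ 2 * pd 1 2 f x y + w.2 ^ 3 * pd 0 3 f x y := by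
  rw [dd_cube hf]
  simp only [pd_eq_iterate_dd hf, Function.iterate_succ, Function.iterate_zero,
    Function.comp_apply, id]

lemma crossWeight_polar_eq_pd {f : ℝ → ℝ → ℝ} (hf : CbSmooth2 f) (x y : ℝ) :
    crossWeight (polar fun p : ℝ × ℝ => f p.1 p.2) (x, y) (x, y)
      = pd 3 0 f x y ^ 2 / 96 + pd 0 3 f x y ^ 2 / 96 + pd 1 2 f x y ^ 2 / 32
        + pd 2 1 f x y ^ 2 / 32 := by
  rw [crossWeight_polar]
  simp only [pd_eq_iterate_dd hf, Function.iterate_succ, Function.iterate_zero,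
    Function.comp_apply, id]

end PartialDerivatives

section Grid

/-- The odd cube root. -/
def oddPhi (x : ℝ) : ℝ := if 0 ≤ x then phi x else -phi x

lemma abs_oddPhi (x : ℝ) : |oddPhi x| = phi x := by
  rw [oddPhi]
  split_ifs
  · exact abs_of_nonneg (phi_nonneg x)
  · rw [abs_neg, abs_of_nonneg (phi_nonneg x)]

lemma abs_phi_sub_le_oddPhi {x y : ℝ} (h : y ≤ x) : |phi x - phi y| ≤ oddPhi x - oddPhi y := by
  have hx := phi_nonneg x
  have hy := phi_nonneg y
  rw [oddPhi, oddPhi, abs_le]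
  split_ifs with h1 h2 h2
  · have : phi y ≤ phi x := phi_mono (by rwa [abs_of_nonneg h1, abs_of_nonneg h2])
    constructor <;> linarith
  · constructor <;> linarith
  · linarith
  · have : phi x ≤ phi y := phi_mono (by
      rw [abs_of_neg (not_le.1 h1), abs_of_neg (not_le.1 h2)]; linarith)
    constructor <;> linarith

/-- The shifted function `phi` has bounded variation on a uniform grid. -/
lemma sum_abs_phi_sub_le {h : ℝ} (hh : 0 ≤ h) (N : ℕ) (v : ℝ) :
    ∑ k ∈ Finset.range N, |phi (((k + 1 : ℕ) : ℝ) * h - v) - phi ((k : ℝ) * h - v)|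
      ≤ phi (N * h) + 2 * phi v := by
  calc ∑ k ∈ Finset.range N, |phi (((k + 1 : ℕ) : ℝ) * h - v) - phi ((k : ℝ) * h - v)|
      ≤ ∑ k ∈ Finset.range N, (oddPhi (((k + 1 : ℕ) : ℝ) * h - v) - oddPhi ((k : ℝ) * h - v)) :=
        Finset.sum_le_sum fun k _ => abs_phi_sub_le_oddPhi (by push_cast; nlinarith)
    _ = oddPhi (N * h - v) - oddPhi (-v) := by
        rw [Finset.sum_range_sub fun k : ℕ => oddPhi ((k : ℝ) * h - v)]
        simp
    _ ≤ phi (N * h - v) + phi (-v) := by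
        have h1 := abs_oddPhi (N * h - v)
        have h2 := abs_oddPhi (-v)
        have := le_abs_self (oddPhi (N * h - v))
        have := neg_abs_le (oddPhi (-v))
        linarith
    _ ≤ phi (N * h) + 2 * phi v := by
        have := phi_add_le (N * h) (-v)
        rw [phi_neg] at *
        rw [← sub_eq_add_neg] at this
        linarith

/-- Covariance of the value at time `u` with the `j`-th increment on a grid of mesh `h`. -/
def gridCov (h : ℝ) (j : ℕ) (u : ℝ) : ℝ :=
  covH (1 / 6) u (((j + 1 : ℕ) : ℝ) * h) - covH (1 / 6) u ((j : ℝ) * h)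

lemma gridCov_eq (h : ℝ) (j : ℕ) (u : ℝ) :
    gridCov h j u = (phi (((j + 1 : ℕ) : ℝ) * h) - phi ((j : ℝ) * h)) / 2
      - (phi (((j + 1 : ℕ) : ℝ) * h - u) - phi ((j : ℝ) * h - u)) / 2 := by
  rw [gridCov, covH_eq_phi, covH_eq_phi, ← phi_neg (u - _), ← phi_neg (u - (j : ℝ) * h),
    neg_sub, neg_sub]
  ring

lemma gridCov_succ_sub (h : ℝ) (j k : ℕ) :
    gridCov h j (((k + 1 : ℕ) : ℝ) * h) - gridCov h j ((k : ℝ) * h)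
      = phi h * rho ((k : ℤ) - j) := by
  rw [gridCov_eq, gridCov_eq, rho_eq_phi]
  have e : ∀ x : ℝ, phi (x * h) = phi x * phi h := fun x => phi_mul x h
  simp only [← sub_mul, e]
  push_cast
  rw [← phi_neg ((j : ℝ) + 1 - (k + 1)), ← phi_neg ((j : ℝ) - (k + 1)),
    ← phi_neg ((j : ℝ) + 1 - k), ← phi_neg ((j : ℝ) - k)]
  rw [show -((j : ℝ) + 1 - (k + 1)) = k - j by ring, show -((j : ℝ) - (k + 1)) = k - j + 1 by ring,
    show -((j : ℝ) + 1 - k) = k - j - 1 by ring, show -((j : ℝ) - k) = k - j by ring]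
  ring

/-- The off-diagonal part of the covariance between increments and midpoints. -/
def gridTau (h : ℝ) (j k : ℕ) : ℝ :=
  phi h * (phi ((k : ℝ) - j + 1) - phi ((k : ℝ) - j - 1)) / 4

lemma gridCov_succ_add (h : ℝ) (j k : ℕ) :
    (gridCov h j (((k + 1 : ℕ) : ℝ) * h) + gridCov h j ((k : ℝ) * h)) / 2
      = (phi (((j + 1 : ℕ) : ℝ) * h) - phi ((j : ℝ) * h)) / 2 + gridTau h j k := by
  rw [gridCov_eq, gridCov_eq, gridTau]
  have e : ∀ x : ℝ, phi (x * h) = phi x * phi h := fun x => phi_mul x h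
  simp only [← sub_mul, e]
  push_cast
  rw [← phi_neg ((j : ℝ) + 1 - (k + 1)), ← phi_neg ((j : ℝ) - (k + 1)),
    ← phi_neg ((j : ℝ) + 1 - k), ← phi_neg ((j : ℝ) - k)]
  rw [show -((j : ℝ) + 1 - (k + 1)) = k - j by ring, show -((j : ℝ) - (k + 1)) = k - j + 1 by ring,
    show -((j : ℝ) + 1 - k) = k - j - 1 by ring, show -((j : ℝ) - k) = k - j by ring]
  ring

lemma gridTau_self (h : ℝ) (j : ℕ) : gridTau h j j = 0 := by
  rw [gridTau, sub_self, zero_add, zero_sub, phi_neg]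
  simp

lemma abs_gridTau_le (h : ℝ) (j k : ℕ) : |gridTau h j k| ≤ phi h := by
  have h0 := phi_nonneg h
  have h1 := abs_phi_sub_le ((k : ℝ) - j + 1) ((k : ℝ) - j - 1)
  have h2 := phi_add_le 1 1
  rw [show (k : ℝ) - j + 1 - ((k : ℝ) - j - 1) = 1 + 1 by ring] at h1
  rw [phi_one] at h2
  rw [gridTau, abs_div, abs_mul, abs_of_nonneg h0, abs_of_pos (by norm_num : (0 : ℝ) < 4)]
  nlinarith

lemma sum_abs_gridTau_le {h : ℝ} (hh : 0 ≤ h) {N j : ℕ} (hj : j < N) :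
    ∑ k ∈ Finset.range N, |gridTau h j k| ≤ 2 * phi (N * h) := by
  have e : ∀ k : ℕ, gridTau h j k
      = (phi (((k + 1 : ℕ) : ℝ) * h - j * h) - phi ((k : ℝ) * h - j * h)) / 4
        + (phi (((k + 1 : ℕ) : ℝ) * h - (j + 1 : ℕ) * h) - phi ((k : ℝ) * h - (j + 1 : ℕ) * h)) / 4 := by
    intro k
    simp only [← sub_mul, phi_mul _ h, gridTau]
    push_cast
    rw [show (k : ℝ) + 1 - j = k - j + 1 by ring, show (k : ℝ) + 1 - (j + 1) = k - j by ring,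
      show (k : ℝ) - (j + 1) = k - j - 1 by ring]
    ring
  have hm : ∀ i : ℕ, i ≤ N → phi (i * h) ≤ phi (N * h) := by
    intro i hi
    refine phi_mono ?_
    rw [abs_of_nonneg (by positivity), abs_of_nonneg (by positivity)]
    gcongr
  calc ∑ k ∈ Finset.range N, |gridTau h j k|
      ≤ ∑ k ∈ Finset.range N,
        (|phi (((k + 1 : ℕ) : ℝ) * h - j * h) - phi ((k : ℝ) * h - j * h)| / 4
        + |phi (((k + 1 : ℕ) : ℝ) * h - (j + 1 : ℕ) * h) - phi ((k : ℝ) * h - (j + 1 : ℕ) * h)| / 4) := by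
        refine Finset.sum_le_sum fun k _ => ?_
        rw [e]
        refine (abs_add_le _ _).trans_eq ?_
        rw [abs_div, abs_div, abs_of_pos (by norm_num : (0 : ℝ) < 4)]
    _ ≤ (phi (N * h) + 2 * phi (j * h)) / 4 + (phi (N * h) + 2 * phi ((j + 1 : ℕ) * h)) / 4 := by
        rw [Finset.sum_add_distrib, ← Finset.sum_div, ← Finset.sum_div]
        have := sum_abs_phi_sub_le hh N (j * h)
        have := sum_abs_phi_sub_le hh N ((j + 1 : ℕ) * h)
        gcongr
    _ ≤ 2 * phi (N * h) := by
        have := hm j hj.le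
        have := hm (j + 1) hj
        have := phi_nonneg (N * h)
        linarith

/-- A bound for the covariances of the `j`-th increment with the values at the times `s`. -/
def gridB {m : ℕ} (h : ℝ) (s : Fin m → ℝ) (j : ℕ) : ℝ :=
  |phi (((j + 1 : ℕ) : ℝ) * h) - phi ((j : ℝ) * h)|
    + ∑ i, |phi (((j + 1 : ℕ) : ℝ) * h - s i) - phi ((j : ℝ) * h - s i)|

lemma abs_phi_grid_le (h : ℝ) (j : ℕ) (v : ℝ) :
    |phi (((j + 1 : ℕ) : ℝ) * h - v) - phi ((j : ℝ) * h - v)| ≤ phi h := by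
  refine (abs_phi_sub_le _ _).trans_eq ?_
  push_cast
  ring_nf

lemma gridB_le {m : ℕ} (h : ℝ) (s : Fin m → ℝ) (j : ℕ) : gridB h s j ≤ (1 + m) * phi h := by
  have h1 := abs_phi_grid_le h j 0
  rw [sub_zero, sub_zero] at h1
  have h2 : ∑ i, |phi (((j + 1 : ℕ) : ℝ) * h - s i) - phi ((j : ℝ) * h - s i)|
      ≤ ∑ _i : Fin m, phi h := Finset.sum_le_sum fun i _ => abs_phi_grid_le h j (s i)
  rw [Finset.sum_const, Finset.card_univ, Fintype.card_fin, nsmul_eq_mul] at h2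
  rw [gridB]
  linarith

lemma sum_gridB_le {m : ℕ} {h : ℝ} (hh : 0 ≤ h) (s : Fin m → ℝ) (N : ℕ) :
    ∑ j ∈ Finset.range N, gridB h s j ≤ (1 + m) * phi (N * h) + 2 * ∑ i, phi (s i) := by
  have h1 := sum_abs_phi_sub_le hh N 0
  simp only [sub_zero, phi_zero, mul_zero, add_zero] at h1
  have h2 : ∑ i, ∑ j ∈ Finset.range N,
      |phi (((j + 1 : ℕ) : ℝ) * h - s i) - phi ((j : ℝ) * h - s i)|
      ≤ ∑ i, (phi (N * h) + 2 * phi (s i)) :=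
    Finset.sum_le_sum fun i _ => sum_abs_phi_sub_le hh N (s i)
  rw [Finset.sum_add_distrib, Finset.sum_const, Finset.card_univ, Fintype.card_fin, nsmul_eq_mul,
    ← Finset.mul_sum, Finset.sum_comm] at h2
  simp only [gridB, Finset.sum_add_distrib]
  linarith

lemma abs_gridCov_le {m : ℕ} (h : ℝ) (s : Fin m → ℝ) (j : ℕ) (i : Fin m) :
    |gridCov h j (s i)| ≤ gridB h s j := by
  have h1 : |phi (((j + 1 : ℕ) : ℝ) * h - s i) - phi ((j : ℝ) * h - s i)|
      ≤ ∑ i, |phi (((j + 1 : ℕ) : ℝ) * h - s i) - phi ((j : ℝ) * h - s i)| :=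
    Finset.single_le_sum (f := fun i =>
      |phi (((j + 1 : ℕ) : ℝ) * h - s i) - phi ((j : ℝ) * h - s i)|)
      (fun _ _ => abs_nonneg _) (Finset.mem_univ i)
  rw [gridCov_eq, gridB]
  refine (abs_sub _ _).trans ?_
  rw [abs_div, abs_div, abs_of_pos (by norm_num : (0 : ℝ) < 2)]
  have := abs_nonneg (phi (((j + 1 : ℕ) : ℝ) * h) - phi ((j : ℝ) * h))
  have := abs_nonneg (phi (((j + 1 : ℕ) : ℝ) * h - s i) - phi ((j : ℝ) * h - s i))
  linarith

lemma gridGamma_le {m : ℕ} (h : ℝ) (s : Fin m → ℝ) (j : ℕ) :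
    |(phi (((j + 1 : ℕ) : ℝ) * h) - phi ((j : ℝ) * h)) / 2| ≤ gridB h s j := by
  have : 0 ≤ ∑ i, |phi (((j + 1 : ℕ) : ℝ) * h - s i) - phi ((j : ℝ) * h - s i)| :=
    Finset.sum_nonneg fun _ _ => abs_nonneg _
  rw [gridB, abs_div, abs_of_pos (by norm_num : (0 : ℝ) < 2)]
  have := abs_nonneg (phi (((j + 1 : ℕ) : ℝ) * h) - phi ((j : ℝ) * h))
  linarith

end Grid

section Processes

variable [MeasurableSpace Ω] {P : Measure Ω} {X X1 X2 : ℝ → Ω → ℝ}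

lemma map_eq_gaussianReal_moments {Y : Ω → ℝ} (hY : Measurable Y) {v : NNReal}
    (h : P.map Y = gaussianReal 0 v) :
    MemLp Y 2 P ∧ ∫ ω, Y ω ∂P = 0 ∧ ∫ ω, Y ω ^ 2 ∂P = v := by
  refine ⟨?_, ?_, ?_⟩
  · have := memLp_id_gaussianReal' (μ := 0) (v := v) 2 (by simp)
    rw [← h, memLp_map_measure_iff aestronglyMeasurable_id hY.aemeasurable] at this
    exact this
  · have := integral_map hY.aemeasurable (f := fun x : ℝ => x) (μ := P)
      aestronglyMeasurable_id
    rw [← this, h]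
    exact integral_id_gaussianReal
  · have := integral_map hY.aemeasurable (f := fun x : ℝ => x ^ 2) (μ := P)
      (by fun_prop)
    rw [← this, h, ← variance_id_gaussianReal (μ := 0) (v := v),
      variance_of_integral_eq_zero aemeasurable_id (by simp)]
    simp

lemma IsCenteredGaussianProcess.moments (hX : IsCenteredGaussianProcess P X (covH (1 / 6)))
    (t : ℝ) : MemLp (X t) 2 P ∧ ∫ ω, X t ω ∂P = 0 ∧ ∫ ω, X t ω ^ 2 ∂P = phi t := by
  have h := hX.2 1 ![t] ![1]
  simp only [Fin.sum_univ_one, Matrix.cons_val_fin_one, one_mul, mul_one] at h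
  obtain ⟨h1, h2, h3⟩ := map_eq_gaussianReal_moments (hX.1 t) h
  refine ⟨h1, h2, h3.trans ?_⟩
  rw [covH_eq_phi, sub_self, phi_zero, Real.coe_toNNReal _ (by linarith [phi_nonneg t])]
  ring

lemma IsCenteredGaussianProcess.integral_mul (hX : IsCenteredGaussianProcess P X (covH (1 / 6)))
    (s t : ℝ) : ∫ ω, X s ω * X t ω ∂P = covH (1 / 6) s t := by
  have h := hX.2 2 ![s, t] ![1, -1]
  simp only [Fin.sum_univ_two, Matrix.cons_val_zero, Matrix.cons_val_one, one_mul, mul_one,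
    neg_mul, mul_neg, neg_neg] at h
  obtain ⟨-, -, h3⟩ := map_eq_gaussianReal_moments (by
    have := hX.1 s; have := hX.1 t; fun_prop) h
  obtain ⟨ms, -, vs⟩ := hX.moments s
  obtain ⟨mt, -, vt⟩ := hX.moments t
  have e : ∀ ω, X s ω * X t ω = (X s ω ^ 2 + X t ω ^ 2 - (X s ω + -X t ω) ^ 2) / 2 := by
    intro ω; ring
  have i1 : Integrable (fun ω => X s ω ^ 2) P := ms.integrable_sq
  have i2 : Integrable (fun ω => X t ω ^ 2) P := mt.integrable_sq
  have i3 : Integrable (fun ω => (X s ω + -X t ω) ^ 2) P := (ms.add mt.neg).integrable_sq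
  have i12 : Integrable (fun ω => X s ω ^ 2 + X t ω ^ 2) P := i1.add i2
  simp only [e]
  rw [integral_div, integral_sub i12 i3, integral_add i1 i2, vs, vt, h3]
  simp only [covH_eq_phi, sub_self, phi_zero]
  rw [← phi_neg (t - s), neg_sub, Real.coe_toNNReal _ (by linarith [phi_nonneg (s - t)])]
  ring

lemma IndepProcesses.indepFun (h : IndepProcesses P X1 X2) {d : ℕ} (tm : Fin d → ℝ) :
    IndepFun (fun ω i => X1 (tm i) ω) (fun ω i => X2 (tm i) ω) P := by
  have le : ∀ X : ℝ → Ω → ℝ, MeasurableSpace.comap (fun ω i => X (tm i) ω) inferInstance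
      ≤ ⨆ t : ℝ, MeasurableSpace.comap (X t) inferInstance := by
    intro X
    refine Measurable.comap_le (m₁ := ⨆ t : ℝ, MeasurableSpace.comap (X t) inferInstance) ?_
    refine @measurable_pi_lambda _ _ _ (_) _ _ fun i => ?_
    exact measurable_iff_comap_le.2 (le_iSup (fun t => MeasurableSpace.comap (X t) inferInstance)
      (tm i))
  exact indep_of_indep_of_le_left (indep_of_indep_of_le_right h (le X2)) (le X1)

/-- The values of the two processes at the times `tm`. -/
def values (X1 X2 : ℝ → Ω → ℝ) {d : ℕ} (tm : Fin d → ℝ) (ω : Ω) : Fin d → ℝ × ℝ :=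
  fun i => (X1 (tm i) ω, X2 (tm i) ω)

lemma clm_pi_prod_apply {d : ℕ} (L : StrongDual ℝ (Fin d → ℝ × ℝ)) (x : Fin d → ℝ × ℝ) :
    L x = ∑ i, L (Pi.single i (1, 0)) * (x i).1 + ∑ i, L (Pi.single i (0, 1)) * (x i).2 := by
  conv_lhs => rw [← Finset.univ_sum_single x]
  rw [map_sum, ← Finset.sum_add_distrib]
  refine Finset.sum_congr rfl fun i _ => ?_
  have h : (Pi.single i (x i) : Fin d → ℝ × ℝ)
      = (x i).1 • (Pi.single i (1, 0) : Fin d → ℝ × ℝ)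
        + (x i).2 • (Pi.single i (0, 1) : Fin d → ℝ × ℝ) := by
    rw [← Pi.single_smul, ← Pi.single_smul, ← Pi.single_add]
    simp
  rw [h]
  rw [map_add, map_smul, map_smul, smul_eq_mul, smul_eq_mul]
  ring

lemma measurable_values (h1 : ∀ t, Measurable (X1 t)) (h2 : ∀ t, Measurable (X2 t)) {d : ℕ}
    (tm : Fin d → ℝ) : Measurable (values X1 X2 tm) :=
  measurable_pi_lambda _ fun i => (h1 (tm i)).prodMk (h2 (tm i))

lemma exists_map_values_eq_gaussianReal (hX1 : IsCenteredGaussianProcess P X1 (covH (1 / 6)))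
    (hX2 : IsCenteredGaussianProcess P X2 (covH (1 / 6))) (hInd : IndepProcesses P X1 X2)
    {d : ℕ} (tm : Fin d → ℝ) (L : StrongDual ℝ (Fin d → ℝ × ℝ)) :
    ∃ v : NNReal, (P.map (values X1 X2 tm)).map L = gaussianReal 0 v := by
  have hi := (hInd.indepFun tm).comp (φ := fun x => ∑ i, L (Pi.single i (1, 0)) * x i)
    (ψ := fun x => ∑ i, L (Pi.single i (0, 1)) * x i) (by fun_prop) (by fun_prop)
  have h := gaussianReal_add_gaussianReal_of_indepFun hi (hX1.2 d tm _) (hX2.2 d tm _)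
  rw [add_zero] at h
  refine ⟨_, Eq.trans ?_ h⟩
  rw [Measure.map_map (by fun_prop) (measurable_values hX1.1 hX2.1 tm)]
  congr 1
  ext ω
  exact clm_pi_prod_apply L _

lemma isGaussian_map_values (hX1 : IsCenteredGaussianProcess P X1 (covH (1 / 6)))
    (hX2 : IsCenteredGaussianProcess P X2 (covH (1 / 6))) (hInd : IndepProcesses P X1 X2)
    {d : ℕ} (tm : Fin d → ℝ) : IsGaussian (P.map (values X1 X2 tm)) :=
  isGaussian_of_map_eq_gaussianReal fun L =>
    ⟨0, exists_map_values_eq_gaussianReal hX1 hX2 hInd tm L⟩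

lemma integral_clm_map_values (hX1 : IsCenteredGaussianProcess P X1 (covH (1 / 6)))
    (hX2 : IsCenteredGaussianProcess P X2 (covH (1 / 6))) (hInd : IndepProcesses P X1 X2)
    {d : ℕ} (tm : Fin d → ℝ) (L : StrongDual ℝ (Fin d → ℝ × ℝ)) :
    ∫ x, L x ∂(P.map (values X1 X2 tm)) = 0 := by
  obtain ⟨v, hv⟩ := exists_map_values_eq_gaussianReal hX1 hX2 hInd tm L
  exact (map_eq_gaussianReal_moments (by fun_prop) hv).2.1

lemma IndepProcesses.integral_mul (hX1 : IsCenteredGaussianProcess P X1 (covH (1 / 6)))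
    (hX2 : IsCenteredGaussianProcess P X2 (covH (1 / 6))) (hInd : IndepProcesses P X1 X2)
    (s t : ℝ) : ∫ ω, X1 s ω * X2 t ω ∂P = 0 := by
  have h0 : Measurable fun x : Fin 2 → ℝ => x 0 := measurable_pi_apply 0
  have h1 : Measurable fun x : Fin 2 → ℝ => x 1 := measurable_pi_apply 1
  have h := (hInd.indepFun ![s, t]).comp h0 h1
  have := h.integral_fun_mul_eq_mul_integral
    ((hX1.1 s).aestronglyMeasurable) ((hX2.1 t).aestronglyMeasurable)
  refine this.trans ?_
  simp [(hX2.moments t).2.1]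

lemma integral_two_by_two {f₁ f₂ f₃ f₄ : Ω → ℝ} (h₁ : Integrable f₁ P) (h₂ : Integrable f₂ P)
    (h₃ : Integrable f₃ P) (h₄ : Integrable f₄ P) (a b c d : ℝ) :
    Integrable (fun ω => a * (c * f₁ ω + d * f₂ ω) + b * (c * f₃ ω + d * f₄ ω)) P ∧
    ∫ ω, (a * (c * f₁ ω + d * f₂ ω) + b * (c * f₃ ω + d * f₄ ω)) ∂P
      = a * (c * ∫ ω, f₁ ω ∂P + d * ∫ ω, f₂ ω ∂P) + b * (c * ∫ ω, f₃ ω ∂P + d * ∫ ω, f₄ ω ∂P) := by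
  have i₁ : Integrable (fun ω => c * f₁ ω + d * f₂ ω) P := (h₁.const_mul c).add (h₂.const_mul d)
  have i₂ : Integrable (fun ω => c * f₃ ω + d * f₄ ω) P := (h₃.const_mul c).add (h₄.const_mul d)
  refine ⟨(i₁.const_mul a).add (i₂.const_mul b), ?_⟩
  rw [integral_add (i₁.const_mul a) (i₂.const_mul b), integral_const_mul, integral_const_mul,
    integral_add (h₁.const_mul c) (h₂.const_mul d), integral_add (h₃.const_mul c) (h₄.const_mul d)]
  simp only [integral_const_mul]

/-- The Cameron-Martin vector of an increment. -/
lemma isCMVector_map_values (hX1 : IsCenteredGaussianProcess P X1 (covH (1 / 6)))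
    (hX2 : IsCenteredGaussianProcess P X2 (covH (1 / 6))) (hInd : IndepProcesses P X1 X2)
    {d : ℕ} (tm : Fin d → ℝ) (a b : Fin d) (u : ℝ × ℝ)
    {L : StrongDual ℝ (Fin d → ℝ × ℝ)} (hL : ∀ x, L x = dotL u (x a - x b)) :
    IsCMVector (P.map (values X1 X2 tm)) L
      (fun i => (covH (1 / 6) (tm i) (tm a) - covH (1 / 6) (tm i) (tm b)) • u) := by
  refine ⟨fun L' => ?_⟩
  have m1 : ∀ i, MemLp (fun ω => X1 (tm i) ω) 2 P := fun i => (hX1.moments (tm i)).1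
  have m2 : ∀ i, MemLp (fun ω => X2 (tm i) ω) 2 P := fun i => (hX2.moments (tm i)).1
  have c11 : ∀ i j, Integrable (fun ω => X1 (tm i) ω * X1 (tm j) ω) P :=
    fun i j => (m1 i).integrable_mul (m1 j)
  have c12 : ∀ i j, Integrable (fun ω => X1 (tm i) ω * X2 (tm j) ω) P :=
    fun i j => (m1 i).integrable_mul (m2 j)
  have c22 : ∀ i j, Integrable (fun ω => X2 (tm i) ω * X2 (tm j) ω) P :=
    fun i j => (m2 i).integrable_mul (m2 j)
  rw [integral_map (measurable_values hX1.1 hX2.1 tm).aemeasurable (by fun_prop)]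
  set A := fun i => L' (Pi.single i (1, 0))
  set B := fun i => L' (Pi.single i (0, 1))
  have e : ∀ ω, L (values X1 X2 tm ω) * L' (values X1 X2 tm ω)
      = ∑ i, (A i * (u.1 * (X1 (tm i) ω * X1 (tm a) ω - X1 (tm i) ω * X1 (tm b) ω)
          + u.2 * (X1 (tm i) ω * X2 (tm a) ω - X1 (tm i) ω * X2 (tm b) ω))
        + B i * (u.1 * (X1 (tm a) ω * X2 (tm i) ω - X1 (tm b) ω * X2 (tm i) ω)
          + u.2 * (X2 (tm i) ω * X2 (tm a) ω - X2 (tm i) ω * X2 (tm b) ω))) := by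
    intro ω
    rw [hL, dotL_apply, clm_pi_prod_apply L', ← Finset.sum_add_distrib, Finset.mul_sum]
    refine Finset.sum_congr rfl fun i _ => ?_
    simp only [values, Prod.fst_sub, Prod.snd_sub, A, B]
    ring
  simp only [e]
  have j1 : ∀ i, Integrable (fun ω => X1 (tm i) ω * X1 (tm a) ω - X1 (tm i) ω * X1 (tm b) ω) P :=
    fun i => (c11 i a).sub (c11 i b)
  have j2 : ∀ i, Integrable (fun ω => X1 (tm i) ω * X2 (tm a) ω - X1 (tm i) ω * X2 (tm b) ω) P :=
    fun i => (c12 i a).sub (c12 i b)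
  have j3 : ∀ i, Integrable (fun ω => X1 (tm a) ω * X2 (tm i) ω - X1 (tm b) ω * X2 (tm i) ω) P :=
    fun i => (c12 a i).sub (c12 b i)
  have j4 : ∀ i, Integrable (fun ω => X2 (tm i) ω * X2 (tm a) ω - X2 (tm i) ω * X2 (tm b) ω) P :=
    fun i => (c22 i a).sub (c22 i b)
  have k := fun i => integral_two_by_two (j1 i) (j2 i) (j3 i) (j4 i) (A i) (B i) u.1 u.2
  rw [integral_finsetSum _ fun i _ => (k i).1, clm_pi_prod_apply L', ← Finset.sum_add_distrib]
  refine Finset.sum_congr rfl fun i _ => ?_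
  rw [(k i).2]
  rw [integral_sub (c11 i a) (c11 i b), integral_sub (c12 i a) (c12 i b),
    integral_sub (c12 a i) (c12 b i), integral_sub (c22 i a) (c22 i b)]
  simp only [hX1.integral_mul, hX2.integral_mul, hInd.integral_mul hX1 hX2, Prod.smul_fst,
    Prod.smul_snd, smul_eq_mul, A, B]
  ring

end Processes

section GridModel

variable {m : ℕ}

/-- The times `s` together with the first `N + 1` points of the grid of mesh `h`. -/
def gridTimes (s : Fin m → ℝ) (h : ℝ) (N : ℕ) : Fin (m + (N + 1)) → ℝ :=
  Fin.append s fun k : Fin (N + 1) => ((k : ℕ) : ℝ) * h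

/-- Evaluation at the `k`-th grid point. -/
def gridEval (m N k : ℕ) : (Fin (m + (N + 1)) → ℝ × ℝ) →L[ℝ] ℝ × ℝ :=
  if h : k < N + 1 then ContinuousLinearMap.proj (Fin.natAdd m ⟨k, h⟩) else 0

lemma gridEval_apply {N k : ℕ} (h : k < N + 1) (x : Fin (m + (N + 1)) → ℝ × ℝ) :
    gridEval m N k x = x (Fin.natAdd m ⟨k, h⟩) := by
  rw [gridEval, dif_pos h]
  rfl

/-- Evaluation at the times `s`. -/
def locEval (m N : ℕ) : (Fin (m + (N + 1)) → ℝ × ℝ) →L[ℝ] (Fin m → ℝ × ℝ) :=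
  ContinuousLinearMap.pi fun i => ContinuousLinearMap.proj (Fin.castAdd (N + 1) i)

lemma locEval_apply (N : ℕ) (x : Fin (m + (N + 1)) → ℝ × ℝ) (i : Fin m) :
    locEval m N x i = x (Fin.castAdd (N + 1) i) := rfl

lemma gridTimes_natAdd (s : Fin m → ℝ) (h : ℝ) {N k : ℕ} (hk : k < N + 1) :
    gridTimes s h N (Fin.natAdd m ⟨k, hk⟩) = k * h := by
  rw [gridTimes, Fin.append_right]

lemma gridTimes_castAdd (s : Fin m → ℝ) (h : ℝ) (N : ℕ) (i : Fin m) :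
    gridTimes s h N (Fin.castAdd (N + 1) i) = s i := by
  rw [gridTimes, Fin.append_left]

/-- A constant dominating all the bounds required of a model up to time `T`. -/
def gridConst (s : Fin m → ℝ) (T : ℝ) : ℝ :=
  1 + T + (1 + m) * (1 + 2 * phi T) + 2 * ∑ i, phi (s i)

lemma phi_mesh (θ : ℝ) : phi ((θ ^ 8) ^ 6) = (θ ^ 8) ^ 2 := by
  have h := phi_pow_three ((θ ^ 8) ^ 6)
  rw [abs_of_nonneg (by positivity), show (θ ^ 8) ^ 6 = ((θ ^ 8) ^ 2) ^ 3 by ring] at h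
  rw [show (θ ^ 8) ^ 6 = ((θ ^ 8) ^ 2) ^ 3 by ring]
  exact (pow_left_inj₀ (phi_nonneg _) (by positivity) (by norm_num)).1 h

variable [MeasurableSpace Ω] {P : Measure Ω} {X1 X2 : ℝ → Ω → ℝ}

/-- The model given by the values of two independent processes on a grid. -/
def gridModel (hX1 : IsCenteredGaussianProcess P X1 (covH (1 / 6)))
    (hX2 : IsCenteredGaussianProcess P X2 (covH (1 / 6))) (hInd : IndepProcesses P X1 X2)
    (s : Fin m → ℝ) {T : ℝ} (hT : 0 ≤ T) {θ : ℝ} (hθ : 0 < θ) (hθ1 : θ ≤ 1) {N : ℕ}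
    (hN : N * (θ ^ 8) ^ 6 ≤ T) : Model (gridConst s T) m :=
  have hS : 0 ≤ ∑ i, phi (s i) := Finset.sum_nonneg fun _ _ => phi_nonneg _
  have hm : (0 : ℝ) ≤ m := Nat.cast_nonneg m
  have hφT : 0 ≤ phi T := phi_nonneg T
  have hh : 0 ≤ (θ ^ 8) ^ 6 := by positivity
  have hφN : phi (N * (θ ^ 8) ^ 6) ≤ phi T := phi_mono (by
    rwa [abs_of_nonneg (by positivity), abs_of_nonneg hT])
  have hη : 0 ≤ (θ ^ 8) ^ 2 := by positivity
  have hC1 : 1 + m ≤ gridConst s T := by rw [gridConst]; nlinarith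
  { d := m + (N + 1)
    N := N
    θ := θ
    μ := P.map (values X1 X2 (gridTimes s ((θ ^ 8) ^ 6) N))
    P := gridEval m N
    loc := locEval m N
    vec := fun j u i => gridCov ((θ ^ 8) ^ 6) j (gridTimes s ((θ ^ 8) ^ 6) N i) • u
    γ := fun j => (phi (((j + 1 : ℕ) : ℝ) * (θ ^ 8) ^ 6) - phi ((j : ℝ) * (θ ^ 8) ^ 6)) / 2
    τ := gridTau ((θ ^ 8) ^ 6)
    b := gridB ((θ ^ 8) ^ 6) s
    one_le := by linarith
    gauss := isGaussian_map_values hX1 hX2 hInd _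
    cent := integral_clm_map_values hX1 hX2 hInd _
    θ_pos := hθ
    θ_le := hθ1
    N_le := by rw [gridConst]; nlinarith
    cm := fun j hj u => by
      have h := isCMVector_map_values hX1 hX2 hInd (gridTimes s ((θ ^ 8) ^ 6) N)
        (Fin.natAdd m ⟨j + 1, by omega⟩) (Fin.natAdd m ⟨j, by omega⟩) u
        (L := (dotL u).comp (gridEval m N (j + 1) - gridEval m N j)) (fun x => by
          rw [← gridEval_apply (by omega : j + 1 < N + 1) x,
            ← gridEval_apply (by omega : j < N + 1) x]
          rfl)
      simp only [gridTimes_natAdd] at h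
      exact h
    incr_vec := fun j hj k hk u => by
      have h1 : k + 1 < N + 1 := by omega
      have h2 : k < N + 1 := by omega
      rw [sub_apply, gridEval_apply h1, gridEval_apply h2, gridTimes_natAdd,
        gridTimes_natAdd, ← sub_smul, gridCov_succ_sub, phi_mesh]
    mid_vec := fun j hj k hk u => by
      have h1 : k + 1 < N + 1 := by omega
      have h2 : k < N + 1 := by omega
      rw [smul_apply, add_apply, gridEval_apply h1, gridEval_apply h2, gridTimes_natAdd,
        gridTimes_natAdd, ← add_smul, smul_smul, ← gridCov_succ_add]
      congr 1
      ring
    loc_vec := fun j hj u => by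
      have hb : 0 ≤ gridB ((θ ^ 8) ^ 6) s j := (abs_nonneg _).trans (gridGamma_le _ s j)
      refine (pi_norm_le_iff_of_nonneg (by positivity)).2 fun i => ?_
      rw [locEval_apply, gridTimes_castAdd, norm_smul]
      gcongr
      exact abs_gridCov_le _ s j i
    γ_le := fun j _ => gridGamma_le _ s j
    b_le := fun j _ => by
      refine (gridB_le _ s j).trans ?_
      rw [phi_mesh]
      gcongr
    b_sum := by
      refine (sum_gridB_le hh s N).trans ?_
      rw [gridConst]
      nlinarith
    τ_self := fun j _ => gridTau_self _ j
    τ_le := fun j _ k _ => by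
      refine (abs_gridTau_le _ j k).trans ?_
      rw [phi_mesh]
      nlinarith
    τ_sum := fun j hj => by
      refine (sum_abs_gridTau_le hh hj).trans ?_
      rw [gridConst]
      nlinarith }

end GridModel

section Riemann

/-- Riemann sums along midpoints of a continuous path. -/
lemma tendsto_midpoint_riemann {Z : ℝ → ℝ × ℝ} (hZ : Continuous Z) {q : ℝ × ℝ → ℝ}
    (hq : CbSmooth q) {t : ℝ} {h : ℕ → ℝ} (hpos : ∀ n, 0 < h n) (hlim : Tendsto h atTop (nhds 0))
    {N : ℕ → ℕ} (hN : ∀ n, N n * h n ≤ t) (hN1 : ∀ n, t ≤ (N n + 1) * h n) :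
    Tendsto (fun n => h n * ∑ k ∈ Finset.range (N n),
      q ((1 / 2 : ℝ) • (Z (((k + 1 : ℕ) : ℝ) * h n) + Z ((k : ℝ) * h n)))) atTop
      (nhds (∫ u in (0 : ℝ)..t, q (Z u))) := by
  obtain ⟨K, hK0, hK⟩ := hq.bound
  obtain ⟨L, hL0, hL⟩ := hq.lipschitz
  have ht : 0 ≤ t := (mul_nonneg (Nat.cast_nonneg _) (hpos 0).le).trans (hN 0)
  have hqZ : Continuous fun u => q (Z u) := hq.continuous.comp hZ
  have hi : ∀ a b : ℝ, IntervalIntegrable (fun u => q (Z u)) volume a b :=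
    fun a b => hqZ.intervalIntegrable a b
  have huc := (isCompact_Icc (a := (0 : ℝ)) (b := t)).uniformContinuousOn_of_continuous
    hZ.continuousOn
  rw [Metric.tendsto_atTop]
  intro ε hε
  set δ : ℝ := ε / (2 * (t * L + 1)) with hδ
  have hδ0 : 0 < δ := by positivity
  obtain ⟨r, hr0, hr⟩ := Metric.uniformContinuousOn_iff.1 huc δ hδ0
  have hr' : 0 < min r (ε / (2 * (K + 1))) := lt_min hr0 (by positivity)
  obtain ⟨n0, hn0⟩ := Metric.tendsto_atTop.1 hlim _ hr'
  refine ⟨n0, fun n hn => ?_⟩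
  have hn1 := hn0 n hn
  rw [Real.dist_eq, sub_zero, abs_of_pos (hpos n)] at hn1
  have hhr : h n < r := hn1.trans_le (min_le_left _ _)
  have hhK : h n < ε / (2 * (K + 1)) := hn1.trans_le (min_le_right _ _)
  have hp := hpos n
  have hNn := hN n
  have hNn1 := hN1 n
  generalize h n = η at *
  generalize N n = M at *
  set p : ℕ → ℝ := fun k => (k : ℝ) * η with hpdef
  have hpstep : ∀ k, p (k + 1) - p k = η := fun k => by simp only [p]; push_cast; ring
  have hsum : ∫ u in (0 : ℝ)..(M * η), q (Z u)
      = ∑ k ∈ Finset.range M, ∫ u in p k..p (k + 1), q (Z u) := by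
    rw [intervalIntegral.sum_integral_adjacent_intervals fun k _ => hi _ _]
    simp [p]
  have hcell : ∀ k ∈ Finset.range M,
      |η * q ((1 / 2 : ℝ) • (Z (p (k + 1)) + Z (p k))) - ∫ u in p k..p (k + 1), q (Z u)|
        ≤ L * δ * η := by
    intro k hk
    have hk1 : p (k + 1) ≤ t := by
      have : ((k + 1 : ℕ) : ℝ) ≤ M := by exact_mod_cast Finset.mem_range.1 hk
      exact (mul_le_mul_of_nonneg_right this hp.le).trans hNn
    have hk0 : 0 ≤ p k := by positivity
    have hkk : p k ≤ p (k + 1) := by linarith [hpstep k]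
    have e : η * q ((1 / 2 : ℝ) • (Z (p (k + 1)) + Z (p k)))
        = ∫ _u in p k..p (k + 1), q ((1 / 2 : ℝ) • (Z (p (k + 1)) + Z (p k))) := by
      rw [intervalIntegral.integral_const, hpstep, smul_eq_mul]
    rw [e, ← intervalIntegral.integral_sub (by simp) (hi _ _), ← Real.norm_eq_abs]
    refine (intervalIntegral.norm_integral_le_of_norm_le_const (C := L * δ) fun u hu => ?_).trans_eq
      (by rw [hpstep, abs_of_pos hp])
    rw [Set.uIoc_of_le hkk] at hu
    have hu0 : 0 ≤ u := hk0.trans hu.1.le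
    have hut : u ≤ t := hu.2.trans hk1
    have d1 : ‖Z (p (k + 1)) - Z u‖ ≤ δ := by
      rw [← dist_eq_norm]
      refine (hr _ ⟨hk0.trans hkk, hk1⟩ _ ⟨hu0, hut⟩ ?_).le
      rw [Real.dist_eq, abs_of_nonneg (by linarith [hu.2])]
      linarith [hu.1, hpstep k]
    have d2 : ‖Z (p k) - Z u‖ ≤ δ := by
      rw [← dist_eq_norm]
      refine (hr _ ⟨hk0, hkk.trans hk1⟩ _ ⟨hu0, hut⟩ ?_).le
      rw [Real.dist_eq, abs_of_nonpos (by linarith [hu.1])]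
      linarith [hu.2, hpstep k]
    refine (hL _ _).trans ?_
    gcongr
    have e2 : (1 / 2 : ℝ) • (Z (p (k + 1)) + Z (p k)) - Z u
        = (1 / 2 : ℝ) • ((Z (p (k + 1)) - Z u) + (Z (p k) - Z u)) := by module
    rw [e2, norm_smul, Real.norm_of_nonneg (by norm_num)]
    have := norm_add_le (Z (p (k + 1)) - Z u) (Z (p k) - Z u)
    linarith
  have h1 : |η * ∑ k ∈ Finset.range M, q ((1 / 2 : ℝ) • (Z (p (k + 1)) + Z (p k)))
      - ∫ u in (0 : ℝ)..(M * η), q (Z u)| ≤ t * L * δ := by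
    rw [hsum, Finset.mul_sum, ← Finset.sum_sub_distrib]
    refine (Finset.abs_sum_le_sum_abs _ _).trans ((Finset.sum_le_sum hcell).trans ?_)
    rw [Finset.sum_const, Finset.card_range, nsmul_eq_mul]
    calc (M : ℝ) * (L * δ * η) = (M * η) * (L * δ) := by ring
      _ ≤ t * (L * δ) := by gcongr
      _ = _ := by ring
  have h2 : |∫ u in (M * η)..t, q (Z u)| ≤ K * η := by
    rw [← Real.norm_eq_abs]
    refine (intervalIntegral.norm_integral_le_of_norm_le_const fun u _ => hK (Z u)).trans ?_
    gcongr
    rw [abs_of_nonneg (by linarith)]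
    linarith
  rw [Real.dist_eq, ← intervalIntegral.integral_add_adjacent_intervals (hi 0 (M * η)) (hi _ t)]
  have h3 : t * L * δ < ε / 2 := by
    rw [hδ, mul_div_assoc', div_lt_div_iff₀ (by positivity) (by norm_num)]
    nlinarith
  have h4 : K * η ≤ ε / 2 := by
    rw [lt_div_iff₀ (by positivity)] at hhK
    nlinarith
  rw [← sub_sub]
  refine (abs_sub _ _).trans_lt ?_
  linarith

end Riemann

lemma Model.S_eq {C₀ : ℝ} {m : ℕ} (M : Model C₀ m) {q : ℝ × ℝ → ℝ} {x : M.E} {h : ℝ} {N : ℕ}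
    {z : ℕ → ℝ × ℝ} (hη : M.η ^ 6 = h) (hN : M.N = N) (hz : ∀ k < N, M.mid k x = z k) :
    M.S q x = h * ∑ k ∈ Finset.range N, q (z k) := by
  rw [Model.S, hη, hN]
  exact congrArg _ (Finset.sum_congr rfl fun k hk => by rw [hz k (Finset.mem_range.1 hk)])

lemma two_rpow_mesh (n : ℕ) :
    (((2 : ℝ) ^ (-(n : ℝ) / 96)) ^ 8) ^ 6 = (2 : ℝ) ^ (-(n : ℝ) / 2) := by
  rw [← pow_mul, ← Real.rpow_natCast, ← Real.rpow_mul (by norm_num)]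
  congr 1
  push_cast
  ring

/-- The values of the processes as a point of the state space of the model. -/
def dyadicValues {m : ℕ} (X1 X2 : ℝ → Ω → ℝ) (s : Fin m → ℝ) (t : ℝ) (n : ℕ) (ω : Ω) :
    Fin (m + (nSteps n t + 1)) → ℝ × ℝ :=
  values X1 X2 (gridTimes s ((((2 : ℝ) ^ (-(n : ℝ) / 96)) ^ 8) ^ 6) (nSteps n t)) ω

lemma gridEval_dyadicValues {m : ℕ} (X1 X2 : ℝ → Ω → ℝ) (s : Fin m → ℝ) (t : ℝ) (n : ℕ) {k : ℕ} (hk : k < nSteps n t + 1) (ω : Ω) :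
    gridEval m (nSteps n t) k (dyadicValues X1 X2 s t n ω)
      = (X1 (dyadicPt n k) ω, X2 (dyadicPt n k) ω) := by
  rw [gridEval_apply hk, dyadicValues, values, gridTimes_natAdd, two_rpow_mesh]
  rfl

section Transfer

variable {m : ℕ} [MeasurableSpace Ω] {P : Measure Ω} {X1 X2 : ℝ → Ω → ℝ}

lemma nSteps_mul_le {t : ℝ} (ht : 0 ≤ t) (n : ℕ) :
    (nSteps n t : ℝ) * (2 : ℝ) ^ (-(n : ℝ) / 2) ≤ t := by
  have h := Nat.floor_le (a := (2 : ℝ) ^ ((n : ℝ) / 2) * t) (by positivity)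
  calc (nSteps n t : ℝ) * (2 : ℝ) ^ (-(n : ℝ) / 2)
      ≤ (2 : ℝ) ^ ((n : ℝ) / 2) * t * (2 : ℝ) ^ (-(n : ℝ) / 2) := by
        gcongr
        exact h
    _ = t * ((2 : ℝ) ^ ((n : ℝ) / 2) * (2 : ℝ) ^ (-(n : ℝ) / 2)) := by ring
    _ = t := by
        rw [← Real.rpow_add (by norm_num), neg_div, add_neg_cancel, Real.rpow_zero, mul_one]

lemma le_nSteps_add_one_mul (t : ℝ) (n : ℕ) :
    t ≤ ((nSteps n t : ℝ) + 1) * (2 : ℝ) ^ (-(n : ℝ) / 2) := by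
  have h := Nat.lt_floor_add_one ((2 : ℝ) ^ ((n : ℝ) / 2) * t)
  calc t = t * ((2 : ℝ) ^ ((n : ℝ) / 2) * (2 : ℝ) ^ (-(n : ℝ) / 2)) := by
        rw [← Real.rpow_add (by norm_num), neg_div, add_neg_cancel, Real.rpow_zero, mul_one]
    _ = (2 : ℝ) ^ ((n : ℝ) / 2) * t * (2 : ℝ) ^ (-(n : ℝ) / 2) := by ring
    _ ≤ _ := by
        gcongr
        exact h.le

/-- The model for the dyadic grid of level `n`. -/
def dyadicModel (hX1 : IsCenteredGaussianProcess P X1 (covH (1 / 6)))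
    (hX2 : IsCenteredGaussianProcess P X2 (covH (1 / 6))) (hInd : IndepProcesses P X1 X2)
    (s : Fin m → ℝ) {t : ℝ} (ht : 0 ≤ t) (n : ℕ) : Model (gridConst s t) m :=
  gridModel hX1 hX2 hInd s ht (θ := (2 : ℝ) ^ (-(n : ℝ) / 96)) (Real.rpow_pos_of_pos two_pos _)
    (Real.rpow_le_one_of_one_le_of_nonpos one_le_two
      (div_nonpos_of_nonpos_of_nonneg (neg_nonpos.2 n.cast_nonneg) (by norm_num)))
    (N := nSteps n t) (by rw [two_rpow_mesh]; exact nSteps_mul_le ht n)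

variable (hX1 : IsCenteredGaussianProcess P X1 (covH (1 / 6)))
  (hX2 : IsCenteredGaussianProcess P X2 (covH (1 / 6))) (hInd : IndepProcesses P X1 X2)
  (s : Fin m → ℝ) {t : ℝ} (ht : 0 ≤ t) (n : ℕ)

lemma dyadicModel_loc (ω : Ω) : (dyadicModel hX1 hX2 hInd s ht n).loc (dyadicValues X1 X2 s t n ω)
    = fun i => (X1 (s i) ω, X2 (s i) ω) := by
  ext1 i
  change values X1 X2 _ ω (Fin.castAdd _ i) = _
  rw [values, gridTimes_castAdd]

lemma dyadicModel_incr {k : ℕ} (hk : k < nSteps n t) (ω : Ω) :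
    (dyadicModel hX1 hX2 hInd s ht n).incr k (dyadicValues X1 X2 s t n ω)
      = (Xincr X1 n k ω, Xincr X2 n k ω) := by
  change (gridEval m (nSteps n t) (k + 1) - gridEval m (nSteps n t) k) _ = _
  rw [sub_apply, gridEval_dyadicValues X1 X2 s t n (by omega), gridEval_dyadicValues X1 X2 s t n (by omega)]
  rfl

lemma dyadicModel_mid {k : ℕ} (hk : k < nSteps n t) (ω : Ω) :
    (dyadicModel hX1 hX2 hInd s ht n).mid k (dyadicValues X1 X2 s t n ω)
      = (1 / 2 : ℝ) • ((X1 (dyadicPt n (k + 1)) ω, X2 (dyadicPt n (k + 1)) ω)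
        + (X1 (dyadicPt n k) ω, X2 (dyadicPt n k) ω)) := by
  change ((1 / 2 : ℝ) • (gridEval m (nSteps n t) (k + 1) + gridEval m (nSteps n t) k)) _ = _
  rw [smul_apply, add_apply, gridEval_dyadicValues X1 X2 s t n (by omega),
    gridEval_dyadicValues X1 X2 s t n (by omega)]

lemma dyadicModel_thirdVar {f : ℝ → ℝ → ℝ} (hf : CbSmooth2 f) (ω : Ω) :
    (dyadicModel hX1 hX2 hInd s ht n).thirdVar (fun p => f p.1 p.2) (dyadicValues X1 X2 s t n ω)
      = 1 / 24 * (∑ j ∈ Finset.range (nSteps n t),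
          (Xmid X1 X2 (pd 3 0 f) n j ω * Xincr X1 n j ω ^ 3)) +
        1 / 24 * (∑ j ∈ Finset.range (nSteps n t),
          (Xmid X1 X2 (pd 0 3 f) n j ω * Xincr X2 n j ω ^ 3)) +
        1 / 8 * (∑ j ∈ Finset.range (nSteps n t),
          (Xmid X1 X2 (pd 1 2 f) n j ω * Xincr X1 n j ω * Xincr X2 n j ω ^ 2)) +
        1 / 8 * (∑ j ∈ Finset.range (nSteps n t),
          (Xmid X1 X2 (pd 2 1 f) n j ω * Xincr X1 n j ω ^ 2 * Xincr X2 n j ω)) := by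
  simp only [Finset.mul_sum, ← Finset.sum_add_distrib]
  refine Finset.sum_congr rfl fun k hk => ?_
  have hk' : k < nSteps n t := Finset.mem_range.1 hk
  rw [dyadicModel_incr hX1 hX2 hInd s ht n hk', dyadicModel_mid hX1 hX2 hInd s ht n hk',
    Prod.mk_add_mk, Prod.smul_mk, dd_cube_eq_pd hf]
  simp only [Xmid, smul_eq_mul, one_div_mul_eq_div]
  ring

lemma dyadicModel_S (q : ℝ × ℝ → ℝ) (ω : Ω) :
    (dyadicModel hX1 hX2 hInd s ht n).S q (dyadicValues X1 X2 s t n ω)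
      = (2 : ℝ) ^ (-(n : ℝ) / 2) * ∑ k ∈ Finset.range (nSteps n t),
        q ((1 / 2 : ℝ) • ((X1 (dyadicPt n (k + 1)) ω, X2 (dyadicPt n (k + 1)) ω)
            + (X1 (dyadicPt n k) ω, X2 (dyadicPt n k) ω))) :=
  Model.S_eq _ (two_rpow_mesh n) rfl fun _ hk => dyadicModel_mid hX1 hX2 hInd s ht n hk ω

end Transfer

section Limit

variable {m : ℕ} [MeasurableSpace Ω] {P : Measure Ω} {X1 X2 : ℝ → Ω → ℝ}

lemma measurable_dyadicValues (hX1 : IsCenteredGaussianProcess P X1 (covH (1 / 6)))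
    (hX2 : IsCenteredGaussianProcess P X2 (covH (1 / 6))) (s : Fin m → ℝ) (t : ℝ) (n : ℕ) :
    Measurable (dyadicValues X1 X2 s t n) :=
  measurable_values hX1.1 hX2.1 _

lemma integral_dyadicModel (hX1 : IsCenteredGaussianProcess P X1 (covH (1 / 6)))
    (hX2 : IsCenteredGaussianProcess P X2 (covH (1 / 6))) (hInd : IndepProcesses P X1 X2)
    (s : Fin m → ℝ) {t : ℝ} (ht : 0 ≤ t) (n : ℕ)
    {G : (dyadicModel hX1 hX2 hInd s ht n).E → ℂ} (hG : Continuous G) :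
    ∫ x, G x ∂(dyadicModel hX1 hX2 hInd s ht n).μ = ∫ ω, G (dyadicValues X1 X2 s t n ω) ∂P :=
  integral_map (measurable_dyadicValues hX1 hX2 s t n).aemeasurable hG.aestronglyMeasurable

lemma tendsto_mesh : Tendsto (fun n : ℕ => (2 : ℝ) ^ (-(n : ℝ) / 96)) atTop (nhds 0) := by
  have h : ∀ n : ℕ, (2 : ℝ) ^ (-(n : ℝ) / 96) = ((2 : ℝ) ^ (-(1 : ℝ) / 96)) ^ n := fun n => by
    rw [← Real.rpow_natCast, ← Real.rpow_mul (by norm_num)]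
    congr 1
    ring
  simp only [h]
  exact tendsto_pow_atTop_nhds_zero_of_lt_one (by positivity)
    (Real.rpow_lt_one_of_one_lt_of_neg one_lt_two (by norm_num))

/-- The Riemann sums of the conditional variance converge along each continuous path. -/
lemma tendsto_dyadicModel_S (hX1 : IsCenteredGaussianProcess P X1 (covH (1 / 6)))
    (hX2 : IsCenteredGaussianProcess P X2 (covH (1 / 6))) (hInd : IndepProcesses P X1 X2)
    (s : Fin m → ℝ) {t : ℝ} (ht : 0 ≤ t) {q : ℝ × ℝ → ℝ} (hq : CbSmooth q) {ω : Ω}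
    (hc1 : Continuous fun u => X1 u ω) (hc2 : Continuous fun u => X2 u ω) :
    Tendsto (fun n => (dyadicModel hX1 hX2 hInd s ht n).S q (dyadicValues X1 X2 s t n ω)) atTop
      (nhds (∫ u in (0 : ℝ)..t, q (X1 u ω, X2 u ω))) := by
  have hlim : Tendsto (fun n : ℕ => (2 : ℝ) ^ (-(n : ℝ) / 2)) atTop (nhds 0) := by
    simpa [two_rpow_mesh] using (tendsto_mesh.pow 8).pow 6
  simp only [dyadicModel_S]
  exact tendsto_midpoint_riemann (Z := fun u => (X1 u ω, X2 u ω)) (hc1.prodMk hc2) hq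
    (fun n => by positivity) hlim (nSteps_mul_le ht) (le_nSteps_add_one_mul t)

lemma abs_dyadicModel_S_le (hX1 : IsCenteredGaussianProcess P X1 (covH (1 / 6)))
    (hX2 : IsCenteredGaussianProcess P X2 (covH (1 / 6))) (hInd : IndepProcesses P X1 X2)
    (s : Fin m → ℝ) {t : ℝ} (ht : 0 ≤ t) {q : ℝ × ℝ → ℝ} {K : ℝ} (hK : ∀ z, |q z| ≤ K)
    (n : ℕ) (ω : Ω) :
    |(dyadicModel hX1 hX2 hInd s ht n).S q (dyadicValues X1 X2 s t n ω)| ≤ t * K := by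
  have hK0 : 0 ≤ K := (abs_nonneg _).trans (hK 0)
  rw [dyadicModel_S, abs_mul, abs_of_pos (by positivity)]
  refine (mul_le_mul_of_nonneg_left ((Finset.abs_sum_le_sum_abs _ _).trans
    (Finset.sum_le_sum fun _ _ => hK _)) (by positivity)).trans ?_
  rw [Finset.sum_const, Finset.card_range, nsmul_eq_mul]
  calc (2 : ℝ) ^ (-(n : ℝ) / 2) * (nSteps n t * K)
      = nSteps n t * (2 : ℝ) ^ (-(n : ℝ) / 2) * K := by ring
    _ ≤ t * K := mul_le_mul_of_nonneg_right (nSteps_mul_le ht n) hK0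

lemma norm_cexp_neg_sq_mul_le (lam : ℝ) {x K : ℝ} (hx : |x| ≤ K) :
    ‖Complex.exp (-((lam : ℂ) ^ 2 / 2) * x)‖ ≤ Real.exp (lam ^ 2 / 2 * K) := by
  have e : (-((lam : ℂ) ^ 2 / 2) * x) = ((-(lam ^ 2 / 2) * x : ℝ) : ℂ) := by push_cast; ring
  rw [e, Complex.norm_exp, Complex.ofReal_re]
  refine Real.exp_le_exp.2 ?_
  have := mul_le_mul_of_nonneg_left ((neg_le_abs x).trans hx) (by positivity : 0 ≤ lam ^ 2 / 2)
  linarith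

lemma tendsto_integral_cexp_dyadicModel_S [IsProbabilityMeasure P]
    (hX1 : IsCenteredGaussianProcess P X1 (covH (1 / 6)))
    (hX2 : IsCenteredGaussianProcess P X2 (covH (1 / 6))) (hInd : IndepProcesses P X1 X2)
    (hc1 : ∀ ω, Continuous fun u => X1 u ω) (hc2 : ∀ ω, Continuous fun u => X2 u ω)
    (s : Fin m → ℝ) {t : ℝ} (ht : 0 ≤ t) {q : ℝ × ℝ → ℝ} (hq : CbSmooth q)
    {ψ : (Fin m → ℝ × ℝ) → ℝ} (hψ : CbSmooth ψ) (lam : ℝ) :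
    Tendsto (fun n => ∫ ω, (ψ (fun i => (X1 (s i) ω, X2 (s i) ω)) : ℂ)
        * Complex.exp (-((lam : ℂ) ^ 2 / 2)
          * (dyadicModel hX1 hX2 hInd s ht n).S q (dyadicValues X1 X2 s t n ω)) ∂P) atTop
      (nhds (∫ ω, (ψ (fun i => (X1 (s i) ω, X2 (s i) ω)) : ℂ)
        * Complex.exp (-((lam : ℂ) ^ 2 / 2) * (∫ u in (0 : ℝ)..t, q (X1 u ω, X2 u ω) : ℝ)) ∂P)) := by
  obtain ⟨K, hK0, hK⟩ := hq.bound
  obtain ⟨B, hB0, hB⟩ := hψ.bound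
  have hmψ : Measurable fun ω => ψ fun i => (X1 (s i) ω, X2 (s i) ω) :=
    hψ.continuous.measurable.comp
      (measurable_pi_lambda _ fun i => (hX1.1 (s i)).prodMk (hX2.1 (s i)))
  refine tendsto_integral_of_dominated_convergence
    (fun _ => B * Real.exp (lam ^ 2 / 2 * (t * K))) (fun n => ?_) (integrable_const _)
    (fun n => Eventually.of_forall fun ω => ?_) (Eventually.of_forall fun ω => ?_)
  · have hS : Measurable fun ω =>
        (dyadicModel hX1 hX2 hInd s ht n).S q (dyadicValues X1 X2 s t n ω) :=
      (Model.adm_S _ hq).cont.measurable.comp (measurable_dyadicValues hX1 hX2 s t n)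
    exact ((Complex.measurable_ofReal.comp hmψ).mul (Complex.measurable_exp.comp
      ((Complex.measurable_ofReal.comp hS).const_mul _))).aestronglyMeasurable
  · rw [norm_mul, Complex.norm_real]
    exact mul_le_mul (hB _)
      (norm_cexp_neg_sq_mul_le lam (abs_dyadicModel_S_le hX1 hX2 hInd s ht hK n ω))
      (norm_nonneg _) hB0
  · have h := tendsto_dyadicModel_S hX1 hX2 hInd s ht hq (hc1 ω) (hc2 ω)
    exact ((Complex.continuous_exp.tendsto _).comp
      (((Complex.continuous_ofReal.tendsto _).comp h).const_mul _)).const_mul _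

/-- The integrated conditional variance in terms of partial derivatives. -/
lemma integral_crossWeight_polar {f : ℝ → ℝ → ℝ} (hf : CbSmooth2 f) {x y : ℝ → ℝ}
    (hx : Continuous x) (hy : Continuous y) (t : ℝ) :
    ∫ u in (0 : ℝ)..t, kappa * crossWeight (polar fun p : ℝ × ℝ => f p.1 p.2) (x u, y u) (x u, y u)
      = kappa / 96 * (∫ u in (0 : ℝ)..t, pd 3 0 f (x u) (y u) ^ 2)
        + kappa / 96 * (∫ u in (0 : ℝ)..t, pd 0 3 f (x u) (y u) ^ 2)
        + kappa / 32 * (∫ u in (0 : ℝ)..t, pd 1 2 f (x u) (y u) ^ 2)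
        + kappa / 32 * (∫ u in (0 : ℝ)..t, pd 2 1 f (x u) (y u) ^ 2) := by
  have hc : ∀ (k l : ℕ) (a : ℝ),
      IntervalIntegrable (fun u => a * pd k l f (x u) (y u) ^ 2) volume 0 t := fun k l a => by
    simp only [pd_eq_iterate_dd hf]
    have h : CbSmooth ((dd ((1, 0) : ℝ × ℝ))^[k] ((dd (0, 1))^[l] fun p => f p.1 p.2)) :=
      CbSmooth.iterate_dd (CbSmooth.iterate_dd hf _ _) _ _
    exact (((h.continuous.comp (hx.prodMk hy)).pow 2).const_mul a).intervalIntegrable _ _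
  simp only [← intervalIntegral.integral_const_mul]
  rw [← intervalIntegral.integral_add (hc _ _ _) (hc _ _ _),
    ← intervalIntegral.integral_add ((hc _ _ _).add (hc _ _ _)) (hc _ _ _),
    ← intervalIntegral.integral_add (((hc _ _ _).add (hc _ _ _)).add (hc _ _ _)) (hc _ _ _)]
  refine intervalIntegral.integral_congr fun u _ => ?_
  simp only [crossWeight_polar_eq_pd hf]
  ring

end Limit

theorem stable_convergence_third_variation_critical
    {Ω : Type*} [MeasurableSpace Ω] (P : Measure Ω) [IsProbabilityMeasure P]
    (X1 X2 : ℝ → Ω → ℝ)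
    (hX1 : IsCenteredGaussianProcess P X1 (covH (1 / 6)))
    (hX2 : IsCenteredGaussianProcess P X2 (covH (1 / 6)))
    (hInd : IndepProcesses P X1 X2)
    (hc1 : ∀ ω, Continuous fun u => X1 u ω)
    (hc2 : ∀ ω, Continuous fun u => X2 u ω)
    (f : ℝ → ℝ → ℝ) (hf : CbSmooth2 f)
    (t : ℝ) (ht : 0 ≤ t)
    (m : ℕ) (hm : 1 ≤ m)
    (ψ : (Fin m → ℝ × ℝ) → ℝ) (hψ : CbSmooth ψ)
    (s : Fin m → ℝ) (lam : ℝ) :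
    Tendsto
      (fun n : ℕ => ∫ ω,
        Complex.ofReal (ψ fun i => (X1 (s i) ω, X2 (s i) ω)) *
          Complex.exp (Complex.I * (lam : ℂ) *
            Complex.ofReal
              (1 / 24 * (∑ j ∈ Finset.range (nSteps n t),
                  (Xmid X1 X2 (pd 3 0 f) n j ω * Xincr X1 n j ω ^ 3)) +
                1 / 24 * (∑ j ∈ Finset.range (nSteps n t),
                  (Xmid X1 X2 (pd 0 3 f) n j ω * Xincr X2 n j ω ^ 3)) +
                1 / 8 * (∑ j ∈ Finset.range (nSteps n t),
                  (Xmid X1 X2 (pd 1 2 f) n j ω * Xincr X1 n j ω * Xincr X2 n j ω ^ 2)) +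
                1 / 8 * (∑ j ∈ Finset.range (nSteps n t),
                  (Xmid X1 X2 (pd 2 1 f) n j ω * Xincr X1 n j ω ^ 2 * Xincr X2 n j ω)))) ∂P)
      atTop
      (nhds (∫ ω,
        Complex.ofReal (ψ fun i => (X1 (s i) ω, X2 (s i) ω)) *
          Complex.exp (-((lam : ℂ) ^ 2 / 2) *
            Complex.ofReal
              (((∑' r : ℤ, rhoH (1 / 6) r ^ 3) / 96 *
                  ∫ u in (0 : ℝ)..t, pd 3 0 f (X1 u ω) (X2 u ω) ^ 2) +
                ((∑' r : ℤ, rhoH (1 / 6) r ^ 3) / 96 *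
                  ∫ u in (0 : ℝ)..t, pd 0 3 f (X1 u ω) (X2 u ω) ^ 2) +
                ((∑' r : ℤ, rhoH (1 / 6) r ^ 3) / 32 *
                  ∫ u in (0 : ℝ)..t, pd 1 2 f (X1 u ω) (X2 u ω) ^ 2) +
                ((∑' r : ℤ, rhoH (1 / 6) r ^ 3) / 32 *
                  ∫ u in (0 : ℝ)..t, pd 2 1 f (X1 u ω) (X2 u ω) ^ 2))) ∂P)) := by
  have hF : CbSmooth fun p : ℝ × ℝ => f p.1 p.2 := hf
  obtain ⟨D, -, hD⟩ := Model.exists_norm_integral_thirdVar_sub_le (gridConst s t) m hF hψ lam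
  have hlim := tendsto_integral_cexp_dyadicModel_S hX1 hX2 hInd hc1 hc2 s ht
    (CbSmooth.crossWeight fun u => hF.polar u) hψ lam
  simp only [integral_crossWeight_polar hf (hc1 _) (hc2 _)] at hlim
  refine tendsto_of_tendsto_of_dist hlim (squeeze_zero (fun _ => dist_nonneg) (fun n => ?_)
    (by simpa using (tendsto_mesh.pow 7).const_mul D))
  rw [dist_comm, dist_eq_norm]
  refine le_of_eq_of_le ?_ (hD (dyadicModel hX1 hX2 hInd s ht n))
  rw [integral_dyadicModel, integral_dyadicModel]
  · simp only [dyadicModel_loc, dyadicModel_thirdVar hX1 hX2 hInd s ht n hf]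
    rfl
  · exact (Complex.continuous_ofReal.comp (hψ.continuous.comp (Model.loc _).continuous)).mul
      (Complex.continuous_exp.comp (continuous_const.mul
        (Complex.continuous_ofReal.comp
          (Model.adm_sigma _ fun u => hF.polar u).cont)))
  · exact (Complex.continuous_ofReal.comp (hψ.continuous.comp (Model.loc _).continuous)).mul
      (Complex.continuous_exp.comp (continuous_const.mul
        (Complex.continuous_ofReal.comp (Model.adm_thirdVar _ hF).cont)))

end
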